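/- arXiv:math/0111327 — 7 statements merged into one kernel-verified Lean document; each statement's English description precedes it below -/
import Mathlib

section
/- Let p, q ≥ 2 with (p,q) ≠ (2,2), and let F = ℤ/p * ℤ/q be the free product of cyclic groups of orders p and q with generators a and b respectively. Let n, m ≥ 1 be integers and let v ∈ F be such that v(ab)^m v⁻¹ does not lie in the cyclic subgroup generated by ab. If the pair ((ab)^n, v(ab)^m v⁻¹) does not freely generate a free subgroup of rank 2 of F, then one of p, q equals 2, min(n,m) = 1 and max(n,m) ≤ 3; moreover, in that case, if max(n,m) > 1 or the other one of p, q is even, then v(ab)^m v⁻¹ is not conjugate to any element of the cyclic subgroup generated by ab by an element of the subgroup generated by {(ab)^n, v(ab)^m v⁻¹}. -/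
/-- The free product `ℤ/p * ℤ/q`, presented as `⟨a, b | aᵖ, b^q⟩`, with `a` indexed
by `true` and `b` indexed by `false`. -/
def ZModFreeProdZMod (p q : ℕ) : Type :=
  PresentedGroup ({FreeGroup.of true ^ p, FreeGroup.of false ^ q} : Set (FreeGroup Bool))

instance (p q : ℕ) : Group (ZModFreeProdZMod p q) := by
  unfold ZModFreeProdZMod; infer_instance

/-- The generator `a` of the order-`p` factor of `ℤ/p * ℤ/q`. -/
def Pa (p q : ℕ) : ZModFreeProdZMod p q := PresentedGroup.of true
/-- The generator `b` of the order-`q` factor of `ℤ/p * ℤ/q`. -/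
def Pb (p q : ℕ) : ZModFreeProdZMod p q := PresentedGroup.of false

namespace ZModFreeProdZMod

open Matrix
open scoped Pointwise MatrixGroups

lemma mul_entry {R : Type*} [CommRing R] (M N : SL(2, R)) (i j : Fin 2) :
    (M * N) i j = M i 0 * N 0 j + M i 1 * N 1 j := by
  rw [Matrix.SpecialLinearGroup.coe_mul, mul_apply, Fin.sum_univ_two]

lemma neg_entry {R : Type*} [CommRing R] (M : SL(2, R)) (i j : Fin 2) :
    (-M) i j = -(M i j) := rfl

lemma inv_eq {R : Type*} [CommRing R] (M : SL(2, R)) :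
    ((M⁻¹ : SL(2, R)) : Matrix (Fin 2) (Fin 2) R) = !![M 1 1, -M 0 1; -M 1 0, M 0 0] := by
  rw [Matrix.SpecialLinearGroup.coe_inv, adjugate_fin_two]

lemma ext_entry {R : Type*} [CommRing R] {M N : SL(2, R)} (h00 : M 0 0 = N 0 0)
    (h01 : M 0 1 = N 0 1) (h10 : M 1 0 = N 1 0) (h11 : M 1 1 = N 1 1) : M = N := by
  ext i j
  fin_cases i <;> fin_cases j <;> assumption

lemma det_eq {R : Type*} [CommRing R] (V : SL(2, R)) :
    V 0 0 * V 1 1 - V 0 1 * V 1 0 = 1 := by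
  have := V.det_coe
  rwa [det_fin_two] at this

/-- The unipotent upper triangular matrix with corner entry `t`. -/
def unip (t : ℝ) : SL(2, ℝ) := ⟨!![1, t; 0, 1], by simp [det_fin_two_of]⟩

@[simp] lemma unip_zero_zero (t : ℝ) : unip t 0 0 = 1 := rfl
@[simp] lemma unip_zero_one (t : ℝ) : unip t 0 1 = t := rfl
@[simp] lemma unip_one_zero (t : ℝ) : unip t 1 0 = 0 := rfl
@[simp] lemma unip_one_one (t : ℝ) : unip t 1 1 = 1 := rfl

lemma unip_mul (s t : ℝ) : unip s * unip t = unip (s + t) := by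
  apply ext_entry <;> simp [mul_entry, add_comm]

lemma unip_zero : unip 0 = 1 := by
  apply ext_entry <;> simp

lemma unip_inv (t : ℝ) : (unip t)⁻¹ = unip (-t) := by
  rw [inv_eq_iff_mul_eq_one, unip_mul, add_neg_cancel, unip_zero]

lemma unip_pow (t : ℝ) (n : ℕ) : unip t ^ n = unip (n * t) := by
  induction n with
  | zero => simp [unip_zero]
  | succ n ih => rw [pow_succ, ih, unip_mul]; congr 1; push_cast; ring

lemma unip_zpow (t : ℝ) (z : ℤ) : unip t ^ z = unip (z * t) := by
  cases z with
  | ofNat n => simp [unip_pow]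
  | negSucc n => rw [zpow_negSucc, unip_pow, unip_inv]; congr 1; push_cast; ring

lemma conj_unip (V : SL(2, ℝ)) (k : ℝ) :
    ((V * unip k * V⁻¹ : SL(2, ℝ)) : Matrix (Fin 2) (Fin 2) ℝ) =
      !![1 - k * V 0 0 * V 1 0, k * V 0 0 ^ 2; -k * V 1 0 ^ 2, 1 + k * V 0 0 * V 1 0] := by
  have h := det_eq V
  ext i j
  rw [mul_entry, mul_entry, mul_entry, inv_eq]
  fin_cases i <;> fin_cases j <;> simp
  · linear_combination h
  · ring
  · ring
  · linear_combination h

/-- Two unipotent elements of `SL(2, ℝ)` with distinct fixed points freely generate a free group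
when the product of their translation lengths is large enough. -/
lemma unip_conj_unip_free (h k : ℝ) (V : SL(2, ℝ)) (hh : 0 < h) (hk : 0 < k)
    (hV : 4 ≤ h * k * V 1 0 ^ 2) :
    Function.Injective
      (FreeGroup.lift (fun i : Bool => if i then unip h else V * unip k * V⁻¹)) := by
  have hc : V 1 0 ≠ 0 := by
    intro h0
    norm_num [h0] at hV
  obtain ⟨κ, hκ⟩ : ∃ κ, κ = k * V 1 0 ^ 2 := ⟨_, rfl⟩
  have hκ0 : 0 < κ := by rw [hκ]; positivity
  have hhκ : 4 ≤ h * κ := by rw [hκ]; linarith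
  obtain ⟨t, ht⟩ : ∃ t, V 0 0 = t * V 1 0 := ⟨V 0 0 / V 1 0, by field_simp⟩
  obtain ⟨x, hx⟩ : ∃ x : SL(2, ℝ) → ℝ, x = fun g => g 0 0 - t * g 1 0 := ⟨_, rfl⟩
  obtain ⟨y, hy⟩ : ∃ y : SL(2, ℝ) → ℝ, y = fun g => g 1 0 := ⟨_, rfl⟩
  have hA : ∀ l g, x (unip l * g) = x g + l * y g ∧ y (unip l * g) = y g := by
    intro l g
    simp only [hx, hy, mul_entry, unip_zero_zero, unip_zero_one, unip_one_zero, unip_one_one]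
    constructor <;> ring
  have hB : ∀ l g, x (V * unip l * V⁻¹ * g) = x g ∧
      y (V * unip l * V⁻¹ * g) = y g - l * V 1 0 ^ 2 * x g := by
    intro l g
    simp only [hx, hy, mul_entry (V * unip l * V⁻¹), conj_unip]
    simp [ht]
    constructor <;> ring
  have hBinv : (V * unip k * V⁻¹)⁻¹ = V * unip (-k) * V⁻¹ := by
    rw [← unip_inv]; group
  have hdisj : ∀ g, h / 2 * y g ^ 2 ≤ |x g * y g| → κ / 2 * x g ^ 2 ≤ |x g * y g| →
      |x g * y g| = κ / 2 * x g ^ 2 := by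
    intro g h1 h2
    refine le_antisymm ?_ h2
    by_contra! h3
    have h4 : |x g * y g| ^ 2 = x g ^ 2 * y g ^ 2 := by rw [sq_abs]; ring
    have h5 : 0 < |x g * y g| := lt_of_le_of_lt (by positivity) h3
    have h6 : h / 2 * y g ^ 2 * (κ / 2 * x g ^ 2) < |x g * y g| * |x g * y g| :=
      mul_lt_mul' h1 h3 (by positivity) h5
    have h7 : 0 ≤ (x g ^ 2 * y g ^ 2) * (h * κ - 4) :=
      mul_nonneg (by positivity) (by linarith)
    nlinarith
  have hne : ∀ g, x g = 0 → y g ≠ 0 := by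
    intro g h1 h2
    have := det_eq g
    simp only [hx, hy] at h1 h2
    simp only [h2, mul_zero, sub_zero] at h1
    simp [h1, h2] at this
  obtain ⟨g₀, hg₀⟩ : ∃ g, x g = 1 ∧ y g = 0 := ⟨1, by simp [hx, hy]⟩
  refine FreeGroup.injective_lift_of_ping_pong _ (α := SL(2, ℝ))
    (fun i => if i then {g | h / 2 * y g ^ 2 ≤ x g * y g}
      else {g | x g * y g ≤ - (κ / 2) * x g ^ 2 ∧ x g ≠ 0})
    (fun i => if i then {g | x g * y g < - (h / 2) * y g ^ 2}
      else {g | κ / 2 * x g ^ 2 < x g * y g ∨ x g = 0}) ?_ ?_ ?_ ?_ ?_ ?_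
  · rintro (_ | _)
    · refine ⟨V * unip k * V⁻¹ * g₀, ?_⟩
      simp [hB, hg₀, ← hκ]
      linarith
    · exact ⟨g₀, by simp [hg₀]⟩
  · have key : ∀ g, h / 2 * y g ^ 2 ≤ x g * y g →
        ¬ (x g * y g ≤ - (κ / 2) * x g ^ 2 ∧ x g ≠ 0) := by
      rintro g h1 ⟨h2, h3⟩
      have : 0 < κ / 2 * x g ^ 2 := by positivity
      nlinarith [mul_nonneg hh.le (sq_nonneg (y g))]
    rintro (_ | _) (_ | _) hij <;> simp only [ne_eq, not_true_eq_false] at hij <;>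
      refine Set.disjoint_left.mpr fun g h1 h2 => ?_ <;> simp at h1 h2
    · exact key g h2 (by simpa using h1)
    · exact key g h1 (by simpa using h2)
  · have key : ∀ g, x g * y g < - (h / 2) * y g ^ 2 →
        ¬ (κ / 2 * x g ^ 2 < x g * y g ∨ x g = 0) := by
      rintro g h1 (h2 | h2)
      · nlinarith [mul_nonneg hh.le (sq_nonneg (y g)), mul_nonneg hκ0.le (sq_nonneg (x g))]
      · rw [h2] at h1
        nlinarith [mul_nonneg hh.le (sq_nonneg (y g))]
    rintro (_ | _) (_ | _) hij <;> simp only [ne_eq, not_true_eq_false] at hij <;>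
      refine Set.disjoint_left.mpr fun g h1 h2 => ?_ <;> simp at h1 h2
    · exact key g (by simpa using h2) h1
    · exact key g (by simpa using h1) h2
  · rintro (_ | _) (_ | _) <;> refine Set.disjoint_left.mpr fun g h1 h2 => ?_ <;>
      simp at h1 h2
    · rcases h2 with h2 | h2
      · nlinarith [mul_nonneg hκ0.le (sq_nonneg (x g))]
      · exact h1.2 h2
    · have h3 : x g * y g < 0 := by
        nlinarith [mul_nonneg hh.le (sq_nonneg (y g))]
      have h4 := hdisj g
      rw [abs_of_neg h3] at h4
      have h5 : 0 < κ / 2 * x g ^ 2 := by have := h1.2; positivity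
      have h6 := h4 (by linarith) (by linarith)
      have h8 : x g * y g = - (κ / 2 * x g ^ 2) := by linarith
      have h9 : y g = - (κ / 2) * x g := by
        apply mul_left_cancel₀ h1.2; linarith
      rw [h9] at h2
      have h10 : 0 < x g ^ 2 := by have := h1.2; positivity
      nlinarith [mul_pos hκ0 h10, mul_nonneg (mul_pos hκ0 h10).le (sub_nonneg.2 hhκ)]
    · rcases h2 with h2 | h2
      · have h3 : 0 < x g * y g := by
          nlinarith [mul_nonneg hκ0.le (sq_nonneg (x g))]
        have h4 := hdisj g
        rw [abs_of_pos h3] at h4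
        linarith [h4 h1 h2.le]
      · have := hne g h2
        have : 0 < h / 2 * y g ^ 2 := by positivity
        rw [h2] at h1
        linarith
    · have h3 : h / 2 * y g ^ 2 = 0 := by
        nlinarith [mul_nonneg hh.le (sq_nonneg (y g))]
      nlinarith
  · rintro (_ | _) _ ⟨g, hg, rfl⟩ <;> simp at hg ⊢
    · simp [hB, ← hκ]
      refine ⟨?_, hg.2⟩
      nlinarith [hg.1]
    · simp [hA]
      nlinarith [hg]
  · rintro (_ | _) _ ⟨g, hg, rfl⟩ <;> simp only [Pi.inv_apply] at hg ⊢
    · simp only [Bool.false_eq_true, if_false, hBinv, smul_eq_mul, Set.mem_ofPred_eq, hB,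
        Set.mem_compl_iff, not_and_or, not_le, not_not] at hg ⊢
      rcases hg with hg | hg
      · left
        rw [neg_mul, ← hκ]
        nlinarith [hg]
      · exact Or.inr hg
    · simp only [if_true, unip_inv, smul_eq_mul, Set.mem_ofPred_eq, hA,
        Set.mem_compl_iff, not_le] at hg ⊢
      nlinarith [hg]

section NormalForm

variable {p q : ℕ}

lemma Pa_pow (p q : ℕ) : Pa p q ^ p = 1 :=
  PresentedGroup.one_of_mem (rels := {FreeGroup.of true ^ p, FreeGroup.of false ^ q})
    (x := FreeGroup.of true ^ p) (by simp)

lemma Pb_pow (p q : ℕ) : Pb p q ^ q = 1 :=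
  PresentedGroup.one_of_mem (rels := {FreeGroup.of true ^ p, FreeGroup.of false ^ q})
    (x := FreeGroup.of false ^ q) (by simp)

/-- The universal property of `ℤ/p * ℤ/q`. -/
lemma exists_hom {H : Type*} [Group H] {x y : H} (hx : x ^ p = 1) (hy : y ^ q = 1) :
    ∃ f : ZModFreeProdZMod p q →* H, f (Pa p q) = x ∧ f (Pb p q) = y := by
  have h : ∀ r ∈ ({FreeGroup.of true ^ p, FreeGroup.of false ^ q} : Set (FreeGroup Bool)),
      FreeGroup.lift (fun i : Bool => if i then x else y) r = 1 := by
    rintro r (rfl | rfl) <;> simp [hx, hy]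
  let f := PresentedGroup.toGroup h
  exact ⟨f, PresentedGroup.toGroup.of h, PresentedGroup.toGroup.of h⟩

lemma closure_Pa_Pb (p q : ℕ) : Subgroup.closure {Pa p q, Pb p q} = ⊤ := by
  have h := PresentedGroup.closure_range_of
    ({FreeGroup.of true ^ p, FreeGroup.of false ^ q} : Set (FreeGroup Bool))
  refine (congrArg Subgroup.closure (Set.ext fun g => ⟨?_, ?_⟩)).trans h
  · rintro (rfl | rfl)
    exacts [⟨true, rfl⟩, ⟨false, rfl⟩]
  · rintro ⟨_ | _, rfl⟩
    exacts [Or.inr rfl, Or.inl rfl]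

/-- Induction by right multiplication by the two generators. -/
lemma induction_right (hp : 0 < p) (hq : 0 < q) {P : ZModFreeProdZMod p q → Prop} (one : P 1)
    (mul_Pa : ∀ g, P g → P (g * Pa p q)) (mul_Pb : ∀ g, P g → P (g * Pb p q)) (g) : P g := by
  have hpow : ∀ x, (∀ g, P g → P (g * x)) → ∀ (k : ℕ) g, P g → P (g * x ^ k) := by
    intro x hx k
    induction k with
    | zero => simp
    | succ k ih => intro g hg; rw [pow_succ, ← mul_assoc]; exact hx _ (ih g hg)
  have hinv : ∀ x : ZModFreeProdZMod p q, ∀ r, 0 < r → x ^ r = 1 → x⁻¹ = x ^ (r - 1) := by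
    intro x r hr h
    rw [inv_eq_iff_mul_eq_one, ← pow_succ', Nat.sub_add_cancel hr, h]
  have hg : g ∈ Subgroup.closure {Pa p q, Pb p q} := by simp [closure_Pa_Pb]
  induction hg using Subgroup.closure_induction_right with
  | one => exact one
  | mul_right x _ y hy ih =>
    rcases hy with rfl | rfl
    exacts [mul_Pa _ ih, mul_Pb _ ih]
  | mul_inv_cancel x _ y hy ih =>
    rcases hy with rfl | rfl
    · rw [hinv _ p hp (Pa_pow p q)]
      exact hpow _ mul_Pa _ _ ih
    · rw [hinv _ q hq (Pb_pow p q)]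
      exact hpow _ mul_Pb _ _ ih

/-- The set of syllables `aᵏbˡ` with both letters nontrivial. -/
def syllables (p q : ℕ) : Set (ZModFreeProdZMod p q) :=
  {g | ∃ k l, 1 ≤ k ∧ k < p ∧ 1 ≤ l ∧ l < q ∧ g = Pa p q ^ k * Pb p q ^ l}

/-- Every element is, up to a power of `ab` on the left, a product of syllables followed by a power
of `a`. -/
lemma exists_eq_zpow_mul (hp : 2 ≤ p) (hq : 2 ≤ q) (g : ZModFreeProdZMod p q) :
    ∃ z : ℤ, ∃ h ∈ Submonoid.closure (syllables p q), ∃ k < p,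
      g = (Pa p q * Pb p q) ^ z * h * Pa p q ^ k := by
  induction g using induction_right (Nat.zero_lt_of_lt hp) (Nat.zero_lt_of_lt hq) with
  | one => exact ⟨0, 1, one_mem _, 0, by omega, by simp⟩
  | mul_Pa g ih =>
    obtain ⟨z, h, hh, k, hk, rfl⟩ := ih
    rcases Nat.lt_or_ge (k + 1) p with hk' | hk'
    · exact ⟨z, h, hh, k + 1, hk', by rw [mul_assoc, pow_succ]⟩
    · refine ⟨z, h, hh, 0, by omega, ?_⟩
      rw [mul_assoc, ← pow_succ, show k + 1 = p by omega, Pa_pow, pow_zero]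
  | mul_Pb g ih =>
    obtain ⟨z, h, hh, k, hk, rfl⟩ := ih
    rcases Nat.eq_zero_or_pos k with rfl | hk0
    · induction hh using Submonoid.closure_induction_right with
      | one =>
        rcases hq.lt_or_eq with hq' | hq'
        · refine ⟨z - 1, Pa p q ^ 1 * Pb p q ^ 2, Submonoid.subset_closure
            ⟨1, 2, le_rfl, by omega, by omega, by omega, rfl⟩, 0, by omega, ?_⟩
          rw [_root_.zpow_sub_one]
          group
        · refine ⟨z - 1, 1, one_mem _, 1, by omega, ?_⟩
          have h2 : (Pb p q)⁻¹ = Pb p q := by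
            rw [inv_eq_iff_mul_eq_one, ← pow_two]
            subst hq'
            exact Pb_pow p 2
          rw [_root_.zpow_sub_one, _root_.mul_inv_rev, h2]
          group
      | mul_right x hx y hy ih =>
        obtain ⟨k, l, hk1, hkp, hl1, hlq, rfl⟩ := hy
        rcases Nat.lt_or_ge (l + 1) q with hl | hl
        · refine ⟨z, x * (Pa p q ^ k * Pb p q ^ (l + 1)), mul_mem hx (Submonoid.subset_closure
            ⟨k, l + 1, hk1, hkp, by omega, hl, rfl⟩), 0, by omega, ?_⟩
          rw [pow_succ]
          group
        · refine ⟨z, x, hx, k, hkp, ?_⟩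
          have : Pb p q ^ l * Pb p q = 1 := by
            rw [← pow_succ, show l + 1 = q by omega, Pb_pow]
          simp only [mul_assoc, pow_zero, this, mul_one]
    · refine ⟨z, h * (Pa p q ^ k * Pb p q ^ 1), mul_mem hh (Submonoid.subset_closure
        ⟨k, 1, hk0, hk, le_rfl, by omega, rfl⟩), 0, by omega, ?_⟩
      group

end NormalForm

section Sine

lemma sin_mul_le_sin_mul {r : ℕ} (hr : 0 < r) {j k : ℝ} (hj : 0 ≤ j) (hjk : j ≤ k)
    (hkr : k ≤ r - j) : Real.sin (j * (Real.pi / r)) ≤ Real.sin (k * (Real.pi / r)) := by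
  have hr' : (0 : ℝ) < r := by exact_mod_cast hr
  have hθ : 0 < Real.pi / r := by have := Real.pi_pos; positivity
  have hrθ : r * (Real.pi / r) = Real.pi := by field_simp
  have h1 := mul_nonneg hj hθ.le
  have h2 := mul_le_mul_of_nonneg_right hjk hθ.le
  have h3 := mul_le_mul_of_nonneg_right hkr hθ.le
  rw [sub_mul, hrθ] at h3
  rcases le_total (k * (Real.pi / r)) (Real.pi / 2) with h | h
  · exact Real.sin_le_sin_of_le_of_le_pi_div_two (by linarith) h h2
  · rw [← Real.sin_pi_sub (k * (Real.pi / r))]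
    exact Real.sin_le_sin_of_le_of_le_pi_div_two (by linarith) (by linarith) (by linarith)

/-- The normalized sines `sin (kπ/r) / sin (π/r)`. -/
noncomputable def nsin (r k : ℕ) : ℝ :=
  Real.sin (k * (Real.pi / r)) / Real.sin (Real.pi / r)

/-- The trace `2 cos (π/r)`. -/
noncomputable def tr (r : ℕ) : ℝ := 2 * Real.cos (Real.pi / r)

variable {r : ℕ}

lemma sin_pi_div_pos (hr : 2 ≤ r) : 0 < Real.sin (Real.pi / r) := by
  have hr' : (2 : ℝ) ≤ r := by exact_mod_cast hr
  have := Real.pi_pos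
  apply Real.sin_pos_of_pos_of_lt_pi
  · positivity
  · rw [div_lt_iff₀ (by linarith)]
    nlinarith

@[simp] lemma nsin_zero (r : ℕ) : nsin r 0 = 0 := by simp [nsin]

lemma nsin_one (hr : 2 ≤ r) : nsin r 1 = 1 := by
  simp [nsin, (sin_pi_div_pos hr).ne']

lemma nsin_add_two (r k : ℕ) : nsin r (k + 2) = tr r * nsin r (k + 1) - nsin r k := by
  unfold nsin tr
  rw [show ((k + 2 : ℕ) : ℝ) * (Real.pi / r) = (k + 1 : ℕ) * (Real.pi / r) + Real.pi / r by
    push_cast; ring, show (k : ℝ) * (Real.pi / r) = (k + 1 : ℕ) * (Real.pi / r) - Real.pi / r by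
    push_cast; ring, Real.sin_add, Real.sin_sub]
  ring

lemma nsin_two (hr : 2 ≤ r) : nsin r 2 = tr r := by
  simpa [nsin_one hr] using nsin_add_two r 0

lemma nsin_self (hr : 2 ≤ r) : nsin r r = 0 := by
  have : (r : ℝ) ≠ 0 := by positivity
  simp [nsin, mul_div_cancel₀, this]

lemma nsin_le_nsin (hr : 2 ≤ r) {j k : ℕ} (hjk : j ≤ k) (hkr : k + j ≤ r) :
    nsin r j ≤ nsin r k := by
  refine div_le_div_of_nonneg_right (sin_mul_le_sin_mul (by omega) (by positivity) ?_ ?_)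
    (sin_pi_div_pos hr).le
  · exact_mod_cast hjk
  · rw [le_sub_iff_add_le]
    exact_mod_cast hkr

lemma nsin_nonneg (hr : 2 ≤ r) {k : ℕ} (hkr : k ≤ r) : 0 ≤ nsin r k := by
  simpa using nsin_le_nsin hr (Nat.zero_le k) (by simpa using hkr)

lemma one_le_nsin (hr : 2 ≤ r) {k : ℕ} (hk : 1 ≤ k) (hkr : k < r) : 1 ≤ nsin r k := by
  simpa [nsin_one hr] using nsin_le_nsin hr hk hkr

lemma nsin_self_add_one (hr : 2 ≤ r) : nsin r (r + 1) = -1 := by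
  have h : (r : ℝ) ≠ 0 := by positivity
  have := (sin_pi_div_pos hr).ne'
  rw [nsin, Nat.cast_add_one, add_mul, one_mul, mul_div_cancel₀ _ h, add_comm, Real.sin_add_pi,
    neg_div, div_self this]

lemma tr_le_nsin (hr : 2 ≤ r) {k : ℕ} (hk : 2 ≤ k) (hkr : k + 2 ≤ r) : tr r ≤ nsin r k := by
  simpa [nsin_two hr] using nsin_le_nsin hr hk hkr

lemma tr_nonneg (hr : 2 ≤ r) : 0 ≤ tr r := by
  rw [← nsin_two hr]
  exact nsin_nonneg hr hr

lemma tr_two : tr 2 = 0 := by simp [tr]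

lemma tr_three : tr 3 = 1 := by simp [tr]

lemma one_le_tr (hr : 3 ≤ r) : 1 ≤ tr r := by
  rw [← nsin_two (by omega : 2 ≤ r)]
  exact one_le_nsin (by omega) one_le_two hr

lemma two_le_tr_sq (hr : 4 ≤ r) : 2 ≤ tr r ^ 2 := by
  have hr' : (4 : ℝ) ≤ r := by exact_mod_cast hr
  have h : tr 4 ≤ tr r := by
    refine mul_le_mul_of_nonneg_left (Real.cos_le_cos_of_nonneg_of_le_pi ?_ ?_ ?_) zero_le_two
    · positivity
    · have := Real.pi_pos
      push_cast
      linarith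
    · push_cast
      gcongr
  have h4 : tr 4 = √2 := by
    simp [tr]
    ring
  rw [h4] at h
  calc (2 : ℝ) = √2 ^ 2 := by simp
    _ ≤ tr r ^ 2 := by gcongr

end Sine

section Representation

/-- The projection of `SL(2, ℝ)` onto its quotient by the center. -/
abbrev proj : SL(2, ℝ) →* SL(2, ℝ) ⧸ Subgroup.center SL(2, ℝ) :=
  QuotientGroup.mk' (Subgroup.center SL(2, ℝ))

lemma proj_neg (M : SL(2, ℝ)) : proj (-M) = proj M := by
  refine QuotientGroup.eq.mpr (Matrix.SpecialLinearGroup.mem_center_iff.mpr ⟨-1, by simp, ?_⟩)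
  rw [inv_neg, neg_mul, inv_mul_cancel]
  ext i j
  fin_cases i <;> fin_cases j <;> simp

lemma eq_or_eq_neg_of_proj_eq {M N : SL(2, ℝ)} (h : proj M = proj N) : M = N ∨ M = -N := by
  obtain ⟨r, hr, hM⟩ := Matrix.SpecialLinearGroup.mem_center_iff.mp (QuotientGroup.eq.mp h.symm)
  have hr' : r = 1 ∨ r = -1 := by simpa using hr
  have hMN : M = N * (N⁻¹ * M) := by group
  rcases hr' with rfl | rfl
  · left
    have : N⁻¹ * M = 1 := Subtype.ext (by simpa using hM.symm)
    rw [hMN, this, mul_one]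
  · right
    have : N⁻¹ * M = -1 := Subtype.ext (by
      rw [← hM]
      ext i j
      fin_cases i <;> fin_cases j <;> simp)
    rw [hMN, this, mul_neg, mul_one]

/-- The elliptic matrix representing the generator of the first factor. -/
noncomputable def matA (r : ℕ) : SL(2, ℝ) := ⟨!![tr r, -1; 1, 0], by simp [det_fin_two_of]⟩

/-- The elliptic matrix representing the generator of the second factor. -/
noncomputable def matB (r : ℕ) : SL(2, ℝ) := ⟨!![0, -1; 1, tr r], by simp [det_fin_two_of]⟩

lemma matA_coe (r : ℕ) : (matA r : Matrix (Fin 2) (Fin 2) ℝ) = !![tr r, -1; 1, 0] := rfl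

lemma matB_coe (r : ℕ) : (matB r : Matrix (Fin 2) (Fin 2) ℝ) = !![0, -1; 1, tr r] := rfl

lemma matA_pow_col {r : ℕ} (hr : 2 ≤ r) (k : ℕ) :
    (matA r ^ k) 0 0 = nsin r (k + 1) ∧ (matA r ^ k) 1 0 = nsin r k := by
  induction k with
  | zero => simp [nsin_one hr]
  | succ k ih =>
    rw [pow_succ', mul_entry, mul_entry, ih.1, ih.2, nsin_add_two]
    simp [matA_coe, sub_eq_add_neg]

lemma matB_pow_col {r : ℕ} (hr : 2 ≤ r) (k : ℕ) :
    (matB r ^ k) 0 1 = -nsin r k ∧ (matB r ^ k) 1 1 = nsin r (k + 1) := by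
  induction k with
  | zero => simp [nsin_one hr]
  | succ k ih =>
    rw [pow_succ', mul_entry, mul_entry, ih.1, ih.2, nsin_add_two]
    simp [matB_coe, sub_eq_add_neg, add_comm]

lemma matA_pow_succ {r : ℕ} (hr : 2 ≤ r) (k : ℕ) :
    ((matA r ^ (k + 1) : SL(2, ℝ)) : Matrix (Fin 2) (Fin 2) ℝ) =
      !![nsin r (k + 2), -nsin r (k + 1); nsin r (k + 1), -nsin r k] := by
  have h := matA_pow_col hr (k + 1)
  have h' := matA_pow_col hr k
  ext i j
  fin_cases i <;> fin_cases j
  · exact h.1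
  · change (matA r ^ (k + 1)) 0 1 = -nsin r (k + 1)
    rw [pow_succ, mul_entry]
    simp [matA_coe, h']
  · exact h.2
  · change (matA r ^ (k + 1)) 1 1 = -nsin r k
    rw [pow_succ, mul_entry]
    simp [matA_coe, h']

lemma matB_pow_succ {r : ℕ} (hr : 2 ≤ r) (k : ℕ) :
    ((matB r ^ (k + 1) : SL(2, ℝ)) : Matrix (Fin 2) (Fin 2) ℝ) =
      !![-nsin r k, -nsin r (k + 1); nsin r (k + 1), nsin r (k + 2)] := by
  have h := matB_pow_col hr (k + 1)
  have h' := matB_pow_col hr k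
  ext i j
  fin_cases i <;> fin_cases j
  · change (matB r ^ (k + 1)) 0 0 = -nsin r k
    rw [pow_succ, mul_entry]
    simp [matB_coe, h']
  · exact h.1
  · change (matB r ^ (k + 1)) 1 0 = nsin r (k + 1)
    rw [pow_succ, mul_entry]
    simp [matB_coe, h']
  · exact h.2

lemma matA_pow_self {r : ℕ} (hr : 2 ≤ r) : matA r ^ r = -1 := by
  obtain ⟨k, rfl⟩ : ∃ k, r = k + 1 := ⟨r - 1, by omega⟩
  have h0 := nsin_self hr
  have h1 := nsin_self_add_one hr
  have h2 := nsin_add_two (k + 1) k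
  rw [h0, h1] at h2
  apply ext_entry <;> simp [matA_pow_succ hr, h0, h1]
  linarith

lemma matB_pow_self {r : ℕ} (hr : 2 ≤ r) : matB r ^ r = -1 := by
  obtain ⟨k, rfl⟩ : ∃ k, r = k + 1 := ⟨r - 1, by omega⟩
  have h0 := nsin_self hr
  have h1 := nsin_self_add_one hr
  have h2 := nsin_add_two (k + 1) k
  rw [h0, h1] at h2
  apply ext_entry <;> simp [matB_pow_succ hr, h0, h1]
  linarith

variable {p q : ℕ}

/-- `f` is the representation of `ℤ/p * ℤ/q` as the triangle group of signature `(p, q, ∞)`. -/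
def IsTriangleRep (f : ZModFreeProdZMod p q →* SL(2, ℝ) ⧸ Subgroup.center SL(2, ℝ)) : Prop :=
  f (Pa p q) = proj (matA p) ∧ f (Pb p q) = proj (matB q)

lemma exists_isTriangleRep (hp : 2 ≤ p) (hq : 2 ≤ q) :
    ∃ f : ZModFreeProdZMod p q →* SL(2, ℝ) ⧸ Subgroup.center SL(2, ℝ), IsTriangleRep f := by
  apply exists_hom
  · rw [← map_pow, matA_pow_self hp, proj_neg, map_one]
  · rw [← map_pow, matB_pow_self hq, proj_neg, map_one]

variable {f : ZModFreeProdZMod p q →* SL(2, ℝ) ⧸ Subgroup.center SL(2, ℝ)}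

lemma IsTriangleRep.map_Pa_mul_Pb (hf : IsTriangleRep f) :
    f (Pa p q * Pb p q) = proj (unip (tr p + tr q)) := by
  rw [map_mul, hf.1, hf.2, ← map_mul, ← proj_neg]
  congr 1
  apply ext_entry <;> simp [matA_coe, matB_coe, add_comm]

/-- The nonnegative matrix representing a syllable. -/
lemma IsTriangleRep.exists_syllable (hf : IsTriangleRep f) (hp : 2 ≤ p) (hq : 2 ≤ q) (k l : ℕ) :
    ∃ W : SL(2, ℝ), proj W = f (Pa p q ^ (k + 1) * Pb p q ^ (l + 1)) ∧
      W 0 0 = nsin p (k + 2) * nsin q l + nsin p (k + 1) * nsin q (l + 1) ∧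
      W 0 1 = nsin p (k + 2) * nsin q (l + 1) + nsin p (k + 1) * nsin q (l + 2) ∧
      W 1 0 = nsin p (k + 1) * nsin q l + nsin p k * nsin q (l + 1) ∧
      W 1 1 = nsin p (k + 1) * nsin q (l + 1) + nsin p k * nsin q (l + 2) := by
  refine ⟨-(matA p ^ (k + 1) * matB q ^ (l + 1)), ?_, ?_⟩
  · rw [proj_neg, map_mul, map_mul, map_pow, map_pow, map_pow, map_pow, hf.1, hf.2]
  · rw [neg_entry, neg_entry, neg_entry, neg_entry, mul_entry, mul_entry, mul_entry, mul_entry,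
      matA_pow_succ hp, matB_pow_succ hq]
    refine ⟨?_, ?_, ?_, ?_⟩ <;> simp <;> ring

/-- The products of syllables are represented by matrices whose lower left entry is at least one,
apart from the powers of `ab`. -/
lemma IsTriangleRep.exists_of_mem_closure (hf : IsTriangleRep f) (hp : 2 ≤ p) (hq : 2 ≤ q)
    {h : ZModFreeProdZMod p q} (hh : h ∈ Submonoid.closure (syllables p q)) :
    ∃ N : SL(2, ℝ), proj N = f h ∧ 1 ≤ N 1 1 ∧ 0 ≤ N 1 0 ∧
      ((N 1 0 = 0 ∧ h ∈ Subgroup.zpowers (Pa p q * Pb p q)) ∨ 1 ≤ N 1 0) := by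
  induction hh using Submonoid.closure_induction_right with
  | one => exact ⟨1, by simp, by simp, by simp, Or.inl ⟨by simp, one_mem _⟩⟩
  | mul_right x hx y hy ih =>
    obtain ⟨k, l, hk1, hkp, hl1, hlq, rfl⟩ := hy
    obtain ⟨k, rfl⟩ : ∃ i, k = i + 1 := ⟨k - 1, by omega⟩
    obtain ⟨l, rfl⟩ : ∃ i, l = i + 1 := ⟨l - 1, by omega⟩
    obtain ⟨N, hN, h11, h10, hN'⟩ := ih
    obtain ⟨W, hW, w00, w01, w10, w11⟩ := hf.exists_syllable hp hq k l
    have s0 : 0 ≤ nsin p k := nsin_nonneg hp (by omega)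
    have s1 : 1 ≤ nsin p (k + 1) := one_le_nsin hp hk1 hkp
    have s2 : 0 ≤ nsin p (k + 2) := nsin_nonneg hp hkp
    have t0 : 0 ≤ nsin q l := nsin_nonneg hq (by omega)
    have t1 : 1 ≤ nsin q (l + 1) := one_le_nsin hq hl1 hlq
    have t2 : 0 ≤ nsin q (l + 2) := nsin_nonneg hq hlq
    have hst := one_le_mul_of_one_le_of_one_le s1 t1
    have W00 : 1 ≤ W 0 0 := by rw [w00]; linarith [mul_nonneg s2 t0]
    have W01 : 0 ≤ W 0 1 := by rw [w01]; positivity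
    have W10 : 0 ≤ W 1 0 := by rw [w10]; positivity
    have W11 : 1 ≤ W 1 1 := by rw [w11]; linarith [mul_nonneg s0 t2]
    have W10' : (k = 0 ∧ l = 0) ∨ 1 ≤ W 1 0 := by
      rcases Nat.eq_zero_or_pos l with rfl | hl
      · rcases Nat.eq_zero_or_pos k with rfl | hk
        · exact Or.inl ⟨rfl, rfl⟩
        · right
          rw [w10]
          have := one_le_mul_of_one_le_of_one_le (one_le_nsin hp hk (by omega)) t1
          linarith [mul_nonneg (zero_le_one.trans s1) t0]
      · right
        rw [w10]
        have := one_le_mul_of_one_le_of_one_le s1 (one_le_nsin hq hl (by omega))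
        linarith [mul_nonneg s0 (zero_le_one.trans t1)]
    refine ⟨N * W, by rw [map_mul, map_mul, hN, hW], ?_, ?_, ?_⟩
    · rw [mul_entry]
      linarith [one_le_mul_of_one_le_of_one_le h11 W11, mul_nonneg h10 W01]
    · rw [mul_entry]
      positivity
    · rw [mul_entry]
      rcases hN' with ⟨hN0, hx'⟩ | hN'
      · rcases W10' with ⟨rfl, rfl⟩ | hW'
        · left
          refine ⟨by rw [hN0, w10]; simp, mul_mem hx' ?_⟩
          simp
        · right
          linarith [one_le_mul_of_one_le_of_one_le h11 hW',
            mul_nonneg h10 (zero_le_one.trans W00)]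
      · right
        linarith [one_le_mul_of_one_le_of_one_le hN' W00,
          mul_nonneg (zero_le_one.trans h11) W10]

/-- The lower left entry of the matrix of `(ab)ᶻ h aᵏ`. -/
lemma IsTriangleRep.abs_lower_left (hf : IsTriangleRep f) (hp : 2 ≤ p)
    {M N : SL(2, ℝ)} {h : ZModFreeProdZMod p q} {z : ℤ} {k : ℕ} (hN : proj N = f h)
    (hM : proj M = f ((Pa p q * Pb p q) ^ z * h * Pa p q ^ k)) :
    |M 1 0| = |N 1 0 * nsin p (k + 1) + N 1 1 * nsin p k| := by
  rw [map_mul, map_mul, map_zpow, map_pow, hf.map_Pa_mul_Pb, ← hN, hf.1, ← map_zpow, ← map_pow,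
    ← map_mul, ← map_mul, unip_zpow] at hM
  have hk := matA_pow_col hp k
  rcases eq_or_eq_neg_of_proj_eq hM with rfl | rfl
  · simp [mul_entry, hk]
  · rw [neg_entry, abs_neg]
    simp [mul_entry, hk]

/-- Elements outside the cyclic group generated by `ab` have lower left entry at least one. -/
lemma IsTriangleRep.mem_zpowers_or_one_le (hf : IsTriangleRep f) (hp : 2 ≤ p) (hq : 2 ≤ q)
    {g : ZModFreeProdZMod p q} {M : SL(2, ℝ)} (hM : proj M = f g) :
    g ∈ Subgroup.zpowers (Pa p q * Pb p q) ∨ 1 ≤ |M 1 0| := by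
  obtain ⟨z, h, hh, k, hk, rfl⟩ := exists_eq_zpow_mul hp hq g
  obtain ⟨N, hN, h11, h10, hN'⟩ := hf.exists_of_mem_closure hp hq hh
  rw [hf.abs_lower_left hp hN hM]
  rcases Nat.eq_zero_or_pos k with rfl | hk0
  · rcases hN' with ⟨-, hN'⟩ | hN'
    · left
      rw [pow_zero, mul_one]
      exact mul_mem (Subgroup.zpow_mem_zpowers _ z) hN'
    · right
      simpa [nsin_one hp] using hN'.trans (le_abs_self _)
  · right
    refine le_trans ?_ (le_abs_self _)
    linarith [one_le_mul_of_one_le_of_one_le h11 (one_le_nsin hp hk0 hk),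
      mul_nonneg h10 (nsin_nonneg hp (by omega : k + 1 ≤ p))]

/-- The stabilizer of the cusp fixed by `ab` is generated by `ab`. -/
lemma IsTriangleRep.mem_zpowers_of_conj (hf : IsTriangleRep f) (hp : 2 ≤ p) (hq : 2 ≤ q)
    (hpos : 0 < tr p + tr q) {w : ZModFreeProdZMod p q} {m : ℕ} (hm : 1 ≤ m) {z : ℤ}
    (h : w * (Pa p q * Pb p q) ^ m * w⁻¹ = (Pa p q * Pb p q) ^ z) :
    w ∈ Subgroup.zpowers (Pa p q * Pb p q) := by
  obtain ⟨M, hM⟩ := QuotientGroup.mk'_surjective _ (f w)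
  refine (hf.mem_zpowers_or_one_le hp hq hM).resolve_right fun h1 => ?_
  have h2 := congrArg f h
  rw [map_mul, map_mul, map_inv, map_pow, map_zpow, hf.map_Pa_mul_Pb, ← hM, ← map_pow,
    ← map_zpow, ← map_inv, ← map_mul, ← map_mul, unip_pow, unip_zpow] at h2
  have h3 : (M * unip (m * (tr p + tr q)) * M⁻¹) 1 0 = 0 := by
    rcases eq_or_eq_neg_of_proj_eq h2 with h2 | h2 <;> rw [h2] <;> simp [neg_entry]
  rw [conj_unip] at h3
  have hm' : (m : ℝ) ≠ 0 := by positivity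
  have h4 : M 1 0 = 0 := by simpa [hpos.ne', hm'] using h3
  norm_num [h4] at h1

/-- A criterion for a pair of powers of conjugates of `ab` to freely generate a free group. -/
lemma IsTriangleRep.injective_lift (hf : IsTriangleRep f) (hpos : 0 < tr p + tr q)
    {n m : ℕ} (hn : 1 ≤ n) (hm : 1 ≤ m) {v : ZModFreeProdZMod p q} {V : SL(2, ℝ)}
    (hV : proj V = f v) (h4 : 4 ≤ n * m * (tr p + tr q) ^ 2 * V 1 0 ^ 2) :
    Function.Injective
      (FreeGroup.lift (fun i : Bool =>
        if i then (Pa p q * Pb p q) ^ n else v * (Pa p q * Pb p q) ^ m * v⁻¹) :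
        FreeGroup Bool →* ZModFreeProdZMod p q) := by
  have hn' : (0 : ℝ) < n := by positivity
  have hm' : (0 : ℝ) < m := by positivity
  have hinj := unip_conj_unip_free (n * (tr p + tr q)) (m * (tr p + tr q)) V (by positivity)
    (by positivity) (by linarith)
  set φ := FreeGroup.lift (fun i : Bool => if i then unip (n * (tr p + tr q))
    else V * unip (m * (tr p + tr q)) * V⁻¹)
  set ψ := (FreeGroup.lift (fun i : Bool =>
        if i then (Pa p q * Pb p q) ^ n else v * (Pa p q * Pb p q) ^ m * v⁻¹) :
        FreeGroup Bool →* ZModFreeProdZMod p q)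
  have hcomp : proj.comp φ = f.comp ψ := by
    apply FreeGroup.ext_hom
    rintro (_ | _)
    · simp only [MonoidHom.comp_apply, φ, ψ, FreeGroup.lift_apply_of, Bool.false_eq_true, if_false]
      rw [map_mul, map_mul, map_mul, map_mul, map_inv, map_inv, map_pow f, hf.map_Pa_mul_Pb, hV,
        ← unip_pow, map_pow]
    · simp only [MonoidHom.comp_apply, φ, ψ, FreeGroup.lift_apply_of, if_true]
      rw [map_pow f, hf.map_Pa_mul_Pb, ← unip_pow, map_pow]
  rw [injective_iff_map_eq_one]
  intro w hw
  have h1 : proj (φ w) = proj 1 := by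
    rw [← MonoidHom.comp_apply, hcomp, MonoidHom.comp_apply, hw, map_one, map_one]
  have h2 : φ (w ^ 2) = φ 1 := by
    rw [map_pow, map_one]
    rcases eq_or_eq_neg_of_proj_eq h1 with h | h <;> rw [h] <;> simp
  exact (pow_eq_one_iff_left two_ne_zero).mp (hinj h2)

lemma le_nsin_of_even {r k : ℕ} {L : ℝ} (hr : 2 ≤ r) (hre : Even r) (hL : r ≠ 2 → L = tr r)
    (hk : Even k) (hk0 : 0 < k) (hkr : k < r) : L ≤ nsin r k := by
  obtain ⟨i, rfl⟩ := hre
  obtain ⟨j, rfl⟩ := hk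
  rw [hL (by omega)]
  exact tr_le_nsin hr (by omega) (by omega)

/-- When `p` and `q` are even and one of them is `2`, the elements of even length outside the cyclic
group generated by `ab` have lower left entry at least the width of the cusp. -/
lemma IsTriangleRep.mem_zpowers_or_le_of_even (hf : IsTriangleRep f) (hp : 2 ≤ p) (hq : 2 ≤ q)
    (hpe : Even p) (hqe : Even q) (h2 : p = 2 ∨ q = 2) {ε : ZModFreeProdZMod p q →* ℤˣ}
    (hεa : ε (Pa p q) = -1) (hεb : ε (Pb p q) = -1) {g : ZModFreeProdZMod p q} (hg : ε g = 1)
    {M : SL(2, ℝ)} (hM : proj M = f g) :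
    g ∈ Subgroup.zpowers (Pa p q * Pb p q) ∨ tr p + tr q ≤ |M 1 0| := by
  obtain ⟨L, hL⟩ : ∃ L, L = tr p + tr q := ⟨_, rfl⟩
  have hL0 : 0 ≤ L := by rw [hL]; exact add_nonneg (tr_nonneg hp) (tr_nonneg hq)
  have hLp : p ≠ 2 → L = tr p := fun h => by rw [hL, h2.resolve_left h, tr_two, add_zero]
  have hLq : q ≠ 2 → L = tr q := fun h => by rw [hL, h2.resolve_right h, tr_two, zero_add]
  have hmul : ∀ {a b : ℝ}, L ≤ a → 1 ≤ b → L ≤ a * b := fun ha hb => by nlinarith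
  have hmul' : ∀ {a b : ℝ}, 1 ≤ a → L ≤ b → L ≤ a * b := fun ha hb => by nlinarith
  have key : ∀ h ∈ Submonoid.closure (syllables p q), ∃ N : SL(2, ℝ), proj N = f h ∧
      1 ≤ N 1 1 ∧ 0 ≤ N 1 0 ∧ (ε h = 1 →
        (N 1 0 = 0 ∧ h ∈ Subgroup.zpowers (Pa p q * Pb p q)) ∨ L ≤ N 1 0) ∧
      (ε h = -1 → L ≤ N 1 1) := by
    intro h hh
    induction hh using Submonoid.closure_induction_right with
    | one => exact ⟨1, by simp, by simp, by simp, fun _ => Or.inl ⟨by simp, one_mem _⟩,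
        fun h => by simp at h⟩
    | mul_right x hx y hy ih =>
      obtain ⟨k, l, hk1, hkp, hl1, hlq, rfl⟩ := hy
      obtain ⟨k, rfl⟩ : ∃ i, k = i + 1 := ⟨k - 1, by omega⟩
      obtain ⟨l, rfl⟩ : ∃ i, l = i + 1 := ⟨l - 1, by omega⟩
      obtain ⟨N, hN, h11, h10, hN1, hN2⟩ := ih
      obtain ⟨W, hW, w00, w01, w10, w11⟩ := hf.exists_syllable hp hq k l
      have s0 : 0 ≤ nsin p k := nsin_nonneg hp (by omega)
      have s1 : 1 ≤ nsin p (k + 1) := one_le_nsin hp hk1 hkp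
      have s2 : 0 ≤ nsin p (k + 2) := nsin_nonneg hp hkp
      have t0 : 0 ≤ nsin q l := nsin_nonneg hq (by omega)
      have t1 : 1 ≤ nsin q (l + 1) := one_le_nsin hq hl1 hlq
      have t2 : 0 ≤ nsin q (l + 2) := nsin_nonneg hq hlq
      have hst := one_le_mul_of_one_le_of_one_le s1 t1
      have W00 : 1 ≤ W 0 0 := by rw [w00]; linarith [mul_nonneg s2 t0]
      have W01 : 0 ≤ W 0 1 := by rw [w01]; positivity
      have W10 : 0 ≤ W 1 0 := by rw [w10]; positivity
      have W11 : 1 ≤ W 1 1 := by rw [w11]; linarith [mul_nonneg s0 t2]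
      have hε : ε (Pa p q ^ (k + 1) * Pb p q ^ (l + 1)) = (-1) ^ (k + l) := by
        rw [map_mul, map_pow, map_pow, hεa, hεb, ← pow_add,
          show k + 1 + (l + 1) = k + l + 2 by ring, pow_add]
        simp
      have hpos := mul_nonneg h10 W01
      have hpos' := mul_nonneg h10 (zero_le_one.trans W00)
      have hpos'' := mul_nonneg (zero_le_one.trans h11) W10
      refine ⟨N * W, by rw [map_mul, map_mul, hN, hW], ?_, ?_, ?_⟩
      · rw [mul_entry]
        linarith [one_le_mul_of_one_le_of_one_le h11 W11]
      · rw [mul_entry]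
        positivity
      rw [mul_entry, mul_entry, map_mul ε, hε]
      rcases Nat.even_or_odd (k + l) with hkl | hkl
      · rw [hkl.neg_one_pow, mul_one]
        refine ⟨fun hx1 => ?_, fun hx1 => by linarith [hmul (hN2 hx1) W11]⟩
        have hW' : (k = 0 ∧ l = 0) ∨ L ≤ W 1 0 := by
          have hk : Even k := by
            by_contra hk
            have hl : ¬ Even l := fun hl => hk ((Nat.even_add.mp hkl).mpr hl)
            rcases h2 with rfl | rfl
            · exact hk (by rw [show k = 0 by omega]; exact Even.zero)
            · exact hl (by rw [show l = 0 by omega]; exact Even.zero)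
          have hl : Even l := (Nat.even_add.mp hkl).mp hk
          rcases Nat.eq_zero_or_pos l with rfl | hl0
          · rcases Nat.eq_zero_or_pos k with rfl | hk0
            · exact Or.inl ⟨rfl, rfl⟩
            · right
              rw [w10]
              linarith [hmul (le_nsin_of_even hp hpe hLp hk hk0 (by omega)) t1,
                mul_nonneg (zero_le_one.trans s1) t0]
          · right
            rw [w10]
            linarith [hmul' s1 (le_nsin_of_even hq hqe hLq hl hl0 (by omega)),
              mul_nonneg s0 (zero_le_one.trans t1)]
        rcases hN1 hx1 with ⟨hN0, hx'⟩ | hN'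
        · rcases hW' with ⟨rfl, rfl⟩ | hW'
          · left
            refine ⟨by rw [hN0, w10]; simp, mul_mem hx' ?_⟩
            simp
          · right
            linarith [hmul' h11 hW']
        · right
          linarith [hmul hN' W00]
      · rw [hkl.neg_one_pow]
        have hW' : 1 ≤ W 1 0 ∧ L ≤ W 1 1 := by
          rw [w10, w11]
          rcases Nat.even_or_odd k with hk | hk
          · have hl : Odd l := (Nat.odd_add'.mp hkl).mpr hk
            have := one_le_mul_of_one_le_of_one_le s1 (one_le_nsin hq hl.pos (by omega))
            have := le_nsin_of_even hq hqe hLq hl.add_one (by omega) hlq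
            constructor
            · linarith [mul_nonneg s0 (zero_le_one.trans t1)]
            · linarith [hmul' s1 this, mul_nonneg s0 t2]
          · have := one_le_mul_of_one_le_of_one_le (one_le_nsin hp hk.pos (by omega)) t1
            have := le_nsin_of_even hp hpe hLp hk.add_one (by omega) hkp
            constructor
            · linarith [mul_nonneg (zero_le_one.trans s1) t0]
            · linarith [hmul this t1, mul_nonneg s0 t2]
        refine ⟨fun hx1 => Or.inr ?_, fun hx1 => ?_⟩
        · linarith [hmul (hN2 (by simpa [neg_eq_iff_eq_neg] using hx1)) hW'.1]
        · linarith [hmul' h11 hW'.2]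
  obtain ⟨z, h, hh, k, hk, rfl⟩ := exists_eq_zpow_mul hp hq g
  obtain ⟨N, hN, h11, h10, hN1, hN2⟩ := key h hh
  rw [← hL, hf.abs_lower_left hp hN hM]
  rw [map_mul, map_mul, map_zpow, map_mul, map_pow, hεa, hεb, neg_mul_neg, one_mul, _root_.one_zpow,
    one_mul] at hg
  have hpos := mul_nonneg h10 (nsin_nonneg hp (by omega : k + 1 ≤ p))
  rcases Nat.eq_zero_or_pos k with rfl | hk0
  · rcases hN1 (by simpa using hg) with ⟨-, hN'⟩ | hN'
    · left
      rw [pow_zero, mul_one]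
      exact mul_mem (Subgroup.zpow_mem_zpowers _ z) hN'
    · right
      simpa [nsin_one hp] using hN'.trans (le_abs_self _)
  · right
    refine le_trans ?_ (le_abs_self _)
    rcases Nat.even_or_odd k with hke | hko
    · linarith [hmul' h11 (le_nsin_of_even hp hpe hLp hke hk0 hk)]
    · rw [hko.neg_one_pow] at hg
      linarith [hmul (hN2 (by simpa [neg_eq_iff_eq_neg] using hg)) (one_le_nsin hp hk0 hk)]

/-- The inclusion of `SL(2, ℤ)` into `SL(2, ℝ)`. -/
abbrev castSL : SL(2, ℤ) →* SL(2, ℝ) := Matrix.SpecialLinearGroup.map (Int.castRingHom ℝ)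

/-- The elements of `ℤ/p * ℤ/q` represented by integral matrices whose lower left entry is divisible
by `N`. -/
def congruenceSubgroup (f : ZModFreeProdZMod p q →* SL(2, ℝ) ⧸ Subgroup.center SL(2, ℝ)) (N : ℤ) :
    Subgroup (ZModFreeProdZMod p q) where
  carrier := {g | ∃ M : SL(2, ℤ), proj (castSL M) = f g ∧ N ∣ M 1 0}
  one_mem' := ⟨1, by simp, by simp⟩
  mul_mem' := by
    rintro x y ⟨M, hM, hM'⟩ ⟨M₁, hM₁, hM₁'⟩
    refine ⟨M * M₁, by rw [map_mul, map_mul, map_mul, hM, hM₁], ?_⟩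
    rw [mul_entry]
    exact dvd_add (hM'.mul_right _) (hM₁'.mul_left _)
  inv_mem' := by
    rintro x ⟨M, hM, hM'⟩
    refine ⟨M⁻¹, by rw [map_inv, map_inv, map_inv, hM], ?_⟩
    rw [inv_eq]
    simpa using hM'

/-- The integral unipotent upper triangular matrix with corner entry `t`. -/
def intUnip (t : ℤ) : SL(2, ℤ) := ⟨!![1, t; 0, 1], by simp [det_fin_two_of]⟩

lemma intUnip_coe (t : ℤ) : (intUnip t : Matrix (Fin 2) (Fin 2) ℤ) = !![1, t; 0, 1] := rfl

lemma castSL_intUnip (t : ℤ) : castSL (intUnip t) = unip t := by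
  apply ext_entry <;> simp [intUnip_coe]

lemma IsTriangleRep.exists_integral (hf : IsTriangleRep f) (hp : 2 ≤ p) (hq : 2 ≤ q) {i j : ℤ}
    (hi : tr p = i) (hj : tr q = j) (g : ZModFreeProdZMod p q) :
    ∃ M : SL(2, ℤ), proj (castSL M) = f g := by
  let A : SL(2, ℤ) := ⟨!![i, -1; 1, 0], by simp [det_fin_two_of]⟩
  let B : SL(2, ℤ) := ⟨!![0, -1; 1, j], by simp [det_fin_two_of]⟩
  have hAc : (A : Matrix (Fin 2) (Fin 2) ℤ) = !![i, -1; 1, 0] := rfl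
  have hBc : (B : Matrix (Fin 2) (Fin 2) ℤ) = !![0, -1; 1, j] := rfl
  have hA : castSL A = matA p := by
    apply ext_entry <;> simp [hAc, matA_coe, hi]
  have hB : castSL B = matB q := by
    apply ext_entry <;> simp [hBc, matB_coe, hj]
  induction g using induction_right (Nat.zero_lt_of_lt hp) (Nat.zero_lt_of_lt hq) with
  | one => exact ⟨1, by simp⟩
  | mul_Pa g ih =>
    obtain ⟨M, hM⟩ := ih
    exact ⟨M * A, by rw [map_mul, map_mul, map_mul, hM, hA, hf.1]⟩
  | mul_Pb g ih =>
    obtain ⟨M, hM⟩ := ih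
    exact ⟨M * B, by rw [map_mul, map_mul, map_mul, hM, hB, hf.2]⟩

lemma IsTriangleRep.mem_congruenceSubgroup (hf : IsTriangleRep f) (h1 : tr p + tr q = 1) (N : ℤ) :
    Pa p q * Pb p q ∈ congruenceSubgroup f N :=
  ⟨intUnip 1, by rw [castSL_intUnip, hf.map_Pa_mul_Pb, h1, Int.cast_one], by simp [intUnip_coe]⟩

lemma IsTriangleRep.conj_mem_congruenceSubgroup (hf : IsTriangleRep f) (h1 : tr p + tr q = 1)
    {g : ZModFreeProdZMod p q} (hg : ∃ M : SL(2, ℤ), proj (castSL M) = f g) (N : ℕ) :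
    g * (Pa p q * Pb p q) ^ N * g⁻¹ ∈ congruenceSubgroup f N := by
  obtain ⟨M, hM⟩ := hg
  refine ⟨M * intUnip N * M⁻¹, ?_, ?_⟩
  · rw [map_mul, map_mul, map_mul, map_mul, map_mul, map_mul, map_inv, map_inv, map_inv, map_pow,
      hM, hf.map_Pa_mul_Pb, h1, castSL_intUnip, ← map_pow, unip_pow]
    simp
  · rw [mul_entry, mul_entry, mul_entry, inv_eq, intUnip_coe]
    exact ⟨-M 1 0 ^ 2, by simp; ring⟩

end Representation

section Subgroups

variable {G : Type*} [Group G] {K : Subgroup G} {c u v : G} {n m : ℕ}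

lemma mem_of_conj_mem (hc : c ∈ K) (hB : v * c ^ m * v⁻¹ ∈ K)
    (hu : u ∈ Subgroup.closure {c ^ n, v * c ^ m * v⁻¹}) (huv : u⁻¹ * v ∈ K) : v ∈ K := by
  have huK : u ∈ K := by
    refine (Subgroup.closure_le K).mpr ?_ hu
    rintro x (rfl | rfl)
    exacts [pow_mem hc n, hB]
  simpa using mul_mem huK huv

lemma mem_of_inv_conj_mem (hc : c ∈ K) (hA : v⁻¹ * c ^ n * v ∈ K)
    (hu : u ∈ Subgroup.closure {c ^ n, v * c ^ m * v⁻¹}) (huv : u⁻¹ * v ∈ K) : v ∈ K := by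
  have huK : u ∈ K.comap (MulAut.conj v⁻¹).toMonoidHom := by
    refine (Subgroup.closure_le _).mpr ?_ hu
    rintro x (rfl | rfl)
    · simpa using hA
    · simpa [mul_assoc] using pow_mem hc m
  have huK' : v⁻¹ * u * v ∈ K := by simpa using huK
  have := mul_mem huv huK'
  simpa [mul_assoc] using this

end Subgroups

section Representation

variable {p q : ℕ} {f : ZModFreeProdZMod p q →* SL(2, ℝ) ⧸ Subgroup.center SL(2, ℝ)}

/-- In the modular group, a power of `ab` and a conjugate of a power of `ab` by an element of a
congruence subgroup of level `N ≥ 2` outside the cyclic group generated by `ab` freely generate a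
free group. -/
lemma IsTriangleRep.injective_lift_of_mem_congruenceSubgroup (hf : IsTriangleRep f) (hp : 2 ≤ p)
    (hq : 2 ≤ q) (h1 : tr p + tr q = 1) {n m : ℕ} (hn : 1 ≤ n) (hm : 1 ≤ m) {N : ℕ} (hN : 2 ≤ N)
    {v : ZModFreeProdZMod p q} (hv : v ∉ Subgroup.zpowers (Pa p q * Pb p q))
    (hvN : v ∈ congruenceSubgroup f N) :
    Function.Injective
      (FreeGroup.lift (fun i : Bool =>
        if i then (Pa p q * Pb p q) ^ n else v * (Pa p q * Pb p q) ^ m * v⁻¹) :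
        FreeGroup Bool →* ZModFreeProdZMod p q) := by
  obtain ⟨Z, hZ, d, hd⟩ := hvN
  have h10 := (hf.mem_zpowers_or_one_le hp hq hZ).resolve_left hv
  have hcast : castSL Z 1 0 = (N : ℝ) * d := by simp [hd]
  refine hf.injective_lift (by rw [h1]; exact one_pos) hn hm hZ ?_
  have hd0 : d ≠ 0 := by
    rintro rfl
    rw [hcast] at h10
    norm_num at h10
  have hd1 : (1 : ℝ) ≤ d ^ 2 := by
    exact_mod_cast Int.add_one_le_iff.mpr (by positivity : 0 < d ^ 2)
  have hN' : (4 : ℝ) ≤ N ^ 2 := by exact_mod_cast Nat.pow_le_pow_left hN 2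
  have hnm : (1 : ℝ) ≤ n * m := by exact_mod_cast Nat.mul_pos hn hm
  rw [h1, hcast, one_pow, mul_one, mul_pow]
  nlinarith [mul_le_mul hN' hd1 zero_le_one (by positivity)]

end Representation

end ZModFreeProdZMod

open ZModFreeProdZMod

/-- **Pairs of peripheral powers in triangle-type free products.**
Let `p, q ≥ 2` with `(p,q) ≠ (2,2)`, `n, m ≥ 1`, and `v ∈ ℤ/p * ℤ/q` with
`v(ab)ᵐv⁻¹ ∉ ⟨ab⟩`.  If the pair `((ab)ⁿ, v(ab)ᵐv⁻¹)` does not freely generate a free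
subgroup of rank 2, then one of `p, q` is `2`, `min(n,m) = 1` and `max(n,m) ≤ 3`; and if
moreover `max(n,m) > 1` or the other of `p, q` is even, then `v(ab)ᵐv⁻¹` is not conjugate
into `⟨ab⟩` by any element of the subgroup generated by the pair. -/
theorem zModFreeProdZMod_not_free_pair (p q : ℕ) (hp : 2 ≤ p) (hq : 2 ≤ q)
    (hpq : ¬(p = 2 ∧ q = 2)) (n m : ℕ) (hn : 1 ≤ n) (hm : 1 ≤ m)
    (v : ZModFreeProdZMod p q)
    (hv : v * (Pa p q * Pb p q) ^ m * v⁻¹ ∉ Subgroup.zpowers (Pa p q * Pb p q))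
    (hnotfree : ¬ Function.Injective
      (FreeGroup.lift (fun i : Bool =>
        if i then (Pa p q * Pb p q) ^ n else v * (Pa p q * Pb p q) ^ m * v⁻¹) :
        FreeGroup Bool →* ZModFreeProdZMod p q)) :
    (p = 2 ∨ q = 2) ∧ min n m = 1 ∧ max n m ≤ 3 ∧
    ((1 < max n m ∨ (p = 2 ∧ Even q) ∨ (q = 2 ∧ Even p)) →
      ∀ u ∈ Subgroup.closure
          {(Pa p q * Pb p q) ^ n, v * (Pa p q * Pb p q) ^ m * v⁻¹},
        ∀ z : ℤ, u * (Pa p q * Pb p q) ^ z * u⁻¹ ≠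
          v * (Pa p q * Pb p q) ^ m * v⁻¹) := by
  obtain ⟨f, hf⟩ := exists_isTriangleRep hp hq
  obtain ⟨V, hV⟩ := QuotientGroup.mk'_surjective _ (f v)
  have hvc : v ∉ Subgroup.zpowers (Pa p q * Pb p q) := fun h =>
    hv (mul_mem (mul_mem h (pow_mem (Subgroup.mem_zpowers _) m)) (inv_mem h))
  have hV1 : 1 ≤ V 1 0 ^ 2 :=
    (one_le_sq_iff_one_le_abs _).mpr ((hf.mem_zpowers_or_one_le hp hq hV).resolve_left hvc)
  have hnm : (1 : ℝ) ≤ n * m := by exact_mod_cast Nat.mul_pos hn hm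
  have htr : ∃ r, 3 ≤ r ∧ tr r ≤ tr p + tr q ∧
      ((p = 2 ∧ q = r) ∨ (q = 2 ∧ p = r) ∨ 2 ≤ tr p + tr q) := by
    by_cases hp2 : p = 2
    · exact ⟨q, by omega, by simp [hp2, tr_two], Or.inl ⟨hp2, rfl⟩⟩
    · refine ⟨p, by omega, by linarith [tr_nonneg hq], ?_⟩
      by_cases hq2 : q = 2
      · exact Or.inr (Or.inl ⟨hq2, rfl⟩)
      · exact Or.inr (Or.inr (by
          linarith [one_le_tr (by omega : 3 ≤ p), one_le_tr (by omega : 3 ≤ q)]))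
  obtain ⟨r, hr, hrL, hpqr⟩ := htr
  obtain ⟨L, hL⟩ : ∃ L, L = tr p + tr q := ⟨_, rfl⟩
  rw [← hL] at hrL hpqr
  have hr1 := one_le_tr hr
  have hL1 : 1 ≤ L := hr1.trans hrL
  have hLpos : 0 < tr p + tr q := by linarith
  have hlt : n * m * L ^ 2 * V 1 0 ^ 2 < 4 := by
    by_contra! h
    exact hnotfree (hf.injective_lift hLpos hn hm hV (hL ▸ h))
  have hlt' : n * m * L ^ 2 < 4 := by nlinarith [mul_nonneg (zero_le_one.trans hnm) (sq_nonneg L)]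
  have hpq2 : (p = 2 ∧ q = r) ∨ (q = 2 ∧ p = r) := by
    rcases hpqr with h | h | h
    · exact Or.inl h
    · exact Or.inr h
    · nlinarith
  have hL2 : 1 ≤ L ^ 2 := by nlinarith
  have hnm4 : n * m < 4 := by
    have : (n * m : ℝ) < 4 := by nlinarith
    exact_mod_cast this
  have hmin : n = 1 ∨ m = 1 := by
    by_contra! h
    have := Nat.mul_le_mul (by omega : 2 ≤ n) (by omega : 2 ≤ m)
    omega
  refine ⟨hpq2.imp And.left And.left, ?_, ?_, ?_⟩
  · omega
  · rcases hmin with rfl | rfl <;> omega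
  intro hcase u hu z huz
  have hw : u⁻¹ * v ∈ Subgroup.zpowers (Pa p q * Pb p q) := by
    refine hf.mem_zpowers_of_conj hp hq hLpos hm (z := z) ?_
    calc u⁻¹ * v * (Pa p q * Pb p q) ^ m * (u⁻¹ * v)⁻¹
        = u⁻¹ * (v * (Pa p q * Pb p q) ^ m * v⁻¹) * u := by group
      _ = (Pa p q * Pb p q) ^ z := by rw [← huz]; group
  have hwK : ∀ {K : Subgroup (ZModFreeProdZMod p q)}, Pa p q * Pb p q ∈ K → u⁻¹ * v ∈ K :=
    fun hc => (Subgroup.zpowers_le.mpr hc) hw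
  by_cases hmax : 1 < max n m
  · have hnm2 : (2 : ℝ) ≤ n * m := by
      have : 2 ≤ n * m := by rcases hmin with rfl | rfl <;> omega
      exact_mod_cast this
    have hr3 : r = 3 := by
      by_contra h
      have := two_le_tr_sq (by omega : 4 ≤ r)
      nlinarith
    have h1 : tr p + tr q = 1 := by
      rcases hpq2 with ⟨rfl, rfl⟩ | ⟨rfl, rfl⟩ <;> simp [hr3, tr_two, tr_three]
    have hrep : ∀ g : ZModFreeProdZMod p q,
        ∃ M : Matrix.SpecialLinearGroup (Fin 2) ℤ, proj (castSL M) = f g := by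
      rcases hpq2 with ⟨rfl, rfl⟩ | ⟨rfl, rfl⟩ <;> subst hr3
      · exact hf.exists_integral hp hq (i := 0) (j := 1) (by simp [tr_two]) (by simp [tr_three])
      · exact hf.exists_integral hp hq (i := 1) (j := 0) (by simp [tr_three]) (by simp [tr_two])
    rcases hmin with hn1 | hm1
    · refine hnotfree (hf.injective_lift_of_mem_congruenceSubgroup hp hq h1 hn hm
        (N := m) (by omega) hvc ?_)
      have hc := hf.mem_congruenceSubgroup h1 m
      exact mem_of_conj_mem hc (hf.conj_mem_congruenceSubgroup h1 (hrep v) m) hu (hwK hc)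
    · refine hnotfree (hf.injective_lift_of_mem_congruenceSubgroup hp hq h1 hn hm
        (N := n) (by omega) hvc ?_)
      have hc := hf.mem_congruenceSubgroup h1 n
      have hA := hf.conj_mem_congruenceSubgroup h1 (hrep v⁻¹) n
      rw [inv_inv] at hA
      exact mem_of_inv_conj_mem hc hA hu (hwK hc)
  · have hpe : Even p := by
      rcases hcase.resolve_left hmax with ⟨h, -⟩ | ⟨-, h⟩
      exacts [h ▸ even_two, h]
    have hqe : Even q := by
      rcases hcase.resolve_left hmax with ⟨-, h⟩ | ⟨h, -⟩
      exacts [h, h ▸ even_two]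
    obtain ⟨ε, hεa, hεb⟩ := exists_hom (p := p) (q := q) (x := (-1 : ℤˣ)) (y := -1)
      hpe.neg_one_pow hqe.neg_one_pow
    have hc : Pa p q * Pb p q ∈ ε.ker := by simp [MonoidHom.mem_ker, hεa, hεb]
    have hεv : v ∈ ε.ker := mem_of_conj_mem hc
      ((MonoidHom.normal_ker ε).conj_mem _ (pow_mem hc m) v) hu (hwK hc)
    have hLV := (hf.mem_zpowers_or_le_of_even hp hq hpe hqe
      (hpq2.imp And.left And.left) hεa hεb hεv hV).resolve_left hvc
    rw [← hL] at hLV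
    have hr4 : 2 ≤ tr r ^ 2 := two_le_tr_sq (by
      rcases hpq2 with ⟨-, rfl⟩ | ⟨-, rfl⟩
      · obtain ⟨i, rfl⟩ := hqe; omega
      · obtain ⟨i, rfl⟩ := hpe; omega)
    have hL4 : 2 ≤ L ^ 2 := by nlinarith
    have hLV2 : L ^ 2 ≤ V 1 0 ^ 2 := by
      rw [← sq_abs (V 1 0)]
      exact pow_le_pow_left₀ (zero_le_one.trans hL1) hLV 2
    nlinarith [mul_le_mul hL4 (hL4.trans hLV2) zero_le_two (sq_nonneg L),
      mul_nonneg (sq_nonneg L) (sq_nonneg (V 1 0))]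
end

section
/- Let K = ⟨s, f | s f s⁻¹ = f⁻¹⟩ be the Klein bottle group and let C be the subgroup of K generated by {s², f}. Then C is a normal subgroup of index 2 in K, and every g ∈ K ∖ C satisfies: (a) g² lies in the cyclic subgroup generated by s²; and (b) g (f^n s^{2m}) g⁻¹ = f^{-n} s^{2m} for all integers n, m. -/
/-- The Klein bottle group `⟨s, f | s f s⁻¹ = f⁻¹⟩`, with `s` indexed by `true`
and `f` indexed by `false`. -/
def KleinBottleGroup : Type :=
  PresentedGroup ({FreeGroup.of true * FreeGroup.of false * (FreeGroup.of true)⁻¹ *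
    FreeGroup.of false} : Set (FreeGroup Bool))

instance : Group KleinBottleGroup := by unfold KleinBottleGroup; infer_instance

/-- `s`, the first generator of the Klein bottle group. -/
def Ks : KleinBottleGroup := PresentedGroup.of true
/-- `f`, the second generator of the Klein bottle group. -/
def Kf : KleinBottleGroup := PresentedGroup.of false

namespace KleinBottleGroup

theorem semiconjBy_Ks_Kf : SemiconjBy Ks Kf Kf⁻¹ := by
  have h : Ks * Kf * Ks⁻¹ * Kf = 1 :=
    PresentedGroup.one_of_mem (rels := {FreeGroup.of true * FreeGroup.of false *
      (FreeGroup.of true)⁻¹ * FreeGroup.of false}) rfl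
  exact mul_inv_eq_iff_eq_mul.mp (mul_eq_one_iff_eq_inv.mp h)

theorem semiconjBy_Ks_Kf_zpow (n : ℤ) : SemiconjBy Ks (Kf ^ n) (Kf ^ (-n)) := by
  simpa using semiconjBy_Ks_Kf.zpow_right n

theorem commute_Ks_sq_Kf : Commute (Ks ^ 2) Kf := by
  have h := (semiconjBy_Ks_Kf_zpow (-1)).mul_left (semiconjBy_Ks_Kf_zpow 1)
  simpa [sq, Commute] using h

theorem exists_eq_Kf_zpow_mul_Ks_zpow (g : KleinBottleGroup) :
    ∃ n k : ℤ, g = Kf ^ n * Ks ^ k := by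
  have hg : g ∈ Subgroup.closure (Set.range fun b : Bool => bif b then Ks else Kf) := by
    have h : (fun b : Bool => bif b then Ks else Kf) =
        fun b => (PresentedGroup.of b : KleinBottleGroup) := by
      funext b; cases b <;> rfl
    rw [h]
    exact (PresentedGroup.closure_range_of ({FreeGroup.of true * FreeGroup.of false *
      (FreeGroup.of true)⁻¹ * FreeGroup.of false} : Set (FreeGroup Bool))).symm ▸
      Subgroup.mem_top g
  induction hg using Subgroup.closure_induction_left with
  | one => exact ⟨0, 0, by simp⟩
  | mul_left x hx y _ ih =>
    obtain ⟨n, k, rfl⟩ := ih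
    obtain ⟨_ | _, rfl⟩ := hx
    · exact ⟨1 + n, k, by simp [zpow_add, mul_assoc]⟩
    · refine ⟨-n, 1 + k, ?_⟩
      change Ks * _ = _
      rw [← mul_assoc, (semiconjBy_Ks_Kf_zpow n).eq, zpow_one_add, mul_assoc]
  | inv_mul_cancel x hx y _ ih =>
    obtain ⟨n, k, rfl⟩ := ih
    obtain ⟨_ | _, rfl⟩ := hx
    · exact ⟨-1 + n, k, by simp [zpow_add, mul_assoc]⟩
    · refine ⟨-n, -1 + k, ?_⟩
      have h : Ks⁻¹ * Kf ^ n = Kf ^ (-n) * Ks⁻¹ := by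
        simpa using (semiconjBy_Ks_Kf_zpow (-n)).inv_symm_left.eq
      change Ks⁻¹ * _ = _
      rw [← mul_assoc, h, zpow_add, zpow_neg_one, mul_assoc]

theorem Kf_zpow_mul_Ks_zpow_mem_closure (n j : ℤ) :
    Kf ^ n * Ks ^ (2 * j) ∈ Subgroup.closure {Ks ^ 2, Kf} := by
  refine mul_mem (zpow_mem (Subgroup.subset_closure (by simp)) n) ?_
  rw [zpow_mul]
  exact zpow_mem (Subgroup.subset_closure (by simp)) j

/-- The exponent of `s` modulo 2. -/
def parity : KleinBottleGroup →* Multiplicative (ZMod 2) :=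
  PresentedGroup.toGroup (f := fun b => Multiplicative.ofAdd (if b then 1 else 0)) (by
    rintro _ rfl
    simp)

theorem parity_Ks : parity Ks = Multiplicative.ofAdd 1 :=
  PresentedGroup.toGroup.of _

theorem parity_Kf : parity Kf = 1 :=
  PresentedGroup.toGroup.of _

theorem ker_parity : parity.ker = Subgroup.closure {Ks ^ 2, Kf} := by
  apply le_antisymm
  · intro g hg
    obtain ⟨n, k, rfl⟩ := exists_eq_Kf_zpow_mul_Ks_zpow g
    obtain ⟨j, rfl | rfl⟩ := k.even_or_odd'
    · exact Kf_zpow_mul_Ks_zpow_mem_closure n j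
    · have h2 : (Multiplicative.ofAdd (1 : ZMod 2)) ^ 2 = 1 := by decide
      have h1 : Multiplicative.ofAdd (1 : ZMod 2) ≠ 1 := by decide
      simp [MonoidHom.mem_ker, parity_Ks, parity_Kf, zpow_add, zpow_mul, h2, h1] at hg
  · rw [Subgroup.closure_le]
    rintro _ (rfl | rfl)
    · rw [SetLike.mem_coe, MonoidHom.mem_ker, map_pow, parity_Ks]
      decide
    · exact parity_Kf

theorem parity_surjective : Function.Surjective parity := by
  intro x
  have hx : x = 1 ∨ x = Multiplicative.ofAdd 1 := by revert x; decide
  obtain rfl | rfl := hx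
  · exact ⟨1, map_one _⟩
  · exact ⟨Ks, parity_Ks⟩

theorem exists_eq_of_notMem_closure {g : KleinBottleGroup}
    (hg : g ∉ Subgroup.closure {Ks ^ 2, Kf}) : ∃ n j : ℤ, g = Kf ^ n * Ks ^ (2 * j + 1) := by
  obtain ⟨n, k, rfl⟩ := exists_eq_Kf_zpow_mul_Ks_zpow g
  obtain ⟨j, rfl | rfl⟩ := k.even_or_odd'
  · exact absurd (Kf_zpow_mul_Ks_zpow_mem_closure n j) hg
  · exact ⟨n, j, rfl⟩

theorem semiconjBy_Ks_zpow_odd (j n : ℤ) :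
    SemiconjBy (Ks ^ (2 * j + 1)) (Kf ^ n) (Kf ^ (-n)) := by
  rw [zpow_add, zpow_one, zpow_mul]
  exact SemiconjBy.mul_left (commute_Ks_sq_Kf.zpow_zpow j (-n)) (semiconjBy_Ks_Kf_zpow n)

end KleinBottleGroup

/-- **The boundary subgroup of `π₁(Q³)`.**  In the Klein bottle group
`K = ⟨s, f | s f s⁻¹ = f⁻¹⟩`, the subgroup `C = ⟨s², f⟩` is normal of index 2, and every
`g ∈ K ∖ C` satisfies `g² ∈ ⟨s²⟩` and `g (fⁿ s^{2m}) g⁻¹ = f⁻ⁿ s^{2m}` for all `n, m ∈ ℤ`. -/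
theorem kleinBottleGroup_boundary_subgroup :
    Subgroup.Normal (Subgroup.closure {Ks ^ 2, Kf}) ∧
    Subgroup.index (Subgroup.closure {Ks ^ 2, Kf}) = 2 ∧
    ∀ g : KleinBottleGroup, g ∉ Subgroup.closure {Ks ^ 2, Kf} →
      (∃ z : ℤ, g ^ 2 = (Ks ^ 2) ^ z) ∧
      ∀ n m : ℤ, g * (Kf ^ n * Ks ^ (2 * m)) * g⁻¹ = Kf ^ (-n) * Ks ^ (2 * m) := by
  open KleinBottleGroup in
  refine ⟨ker_parity ▸ MonoidHom.normal_ker parity, ?_, fun g hg => ?_⟩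
  · rw [← ker_parity, Subgroup.index_ker, MonoidHom.range_eq_top.mpr parity_surjective,
      Subgroup.card_top, Nat.card_congr Multiplicative.toAdd, Nat.card_zmod]
  obtain ⟨n, j, rfl⟩ := exists_eq_of_notMem_closure hg
  refine ⟨⟨2 * j + 1, ?_⟩, fun a m => ?_⟩
  · rw [sq, mul_assoc, ← mul_assoc (Ks ^ _) (Kf ^ n), (semiconjBy_Ks_zpow_odd j n).eq,
      mul_assoc, ← mul_assoc, ← zpow_add, add_neg_cancel, zpow_zero, one_mul, ← zpow_add,
      ← zpow_natCast Ks 2, ← zpow_mul]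
    congr 1
    push_cast
    ring
  · have hf : SemiconjBy (Kf ^ n * Ks ^ (2 * j + 1)) (Kf ^ a) (Kf ^ (-a)) :=
      SemiconjBy.mul_left (Commute.zpow_zpow_self Kf n (-a)) (semiconjBy_Ks_zpow_odd j a)
    have hs : SemiconjBy (Kf ^ n * Ks ^ (2 * j + 1)) (Ks ^ (2 * m)) (Ks ^ (2 * m)) := by
      refine SemiconjBy.mul_left ?_ (Commute.zpow_zpow_self Ks _ _)
      rw [zpow_mul]
      exact (commute_Ks_sq_Kf.zpow_zpow m n).symm
    exact mul_inv_eq_iff_eq_mul.mpr (hf.mul_right hs).eq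
end

section
/- Let A = ⟨x, y | x² = y²⟩ and let n ≥ 1. Then the subgroup U of A generated by {(xy)^n, x²} is normal in A, the quotient A/U is isomorphic to the dihedral group of order 2n, and the image in A/U of the subgroup C generated by {xy, x²} is cyclic of order n; in particular every g ∈ A ∖ C satisfies g² ∈ U. -/
/-- The group `⟨x, y | x² = y²⟩`, with `x` indexed by `true` and `y` indexed by `false`. -/
def XYSquareGroup : Type :=
  PresentedGroup ({FreeGroup.of true ^ 2 * (FreeGroup.of false)⁻¹ ^ 2} : Set (FreeGroup Bool))

instance : Group XYSquareGroup := by unfold XYSquareGroup; infer_instance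

/-- `x`, the first generator of `⟨x, y | x² = y²⟩`. -/
def Ax : XYSquareGroup := PresentedGroup.of true
/-- `y`, the second generator of `⟨x, y | x² = y²⟩`. -/
def Ay : XYSquareGroup := PresentedGroup.of false

theorem Ax_sq_eq_Ay_sq : Ax ^ 2 = Ay ^ 2 := by
  have h : PresentedGroup.mk
      ({FreeGroup.of true ^ 2 * (FreeGroup.of false)⁻¹ ^ 2} : Set (FreeGroup Bool))
      (FreeGroup.of true ^ 2 * (FreeGroup.of false)⁻¹ ^ 2) = 1 :=
    PresentedGroup.one_of_mem (Set.mem_singleton _)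
  rw [map_mul, map_pow, map_pow, map_inv] at h
  have h' : Ax ^ 2 * Ay⁻¹ ^ 2 = 1 := h
  rwa [inv_pow, mul_inv_eq_one] at h'

theorem Ax_sq_commute_Ax : Commute (Ax ^ 2) Ax := (Commute.refl Ax).pow_left 2

theorem Ax_sq_commute_Ay : Commute (Ax ^ 2) Ay := by
  rw [Ax_sq_eq_Ay_sq]
  exact (Commute.refl Ay).pow_left 2

theorem Ax_sq_commute_Ax_mul_Ay : Commute (Ax ^ 2) (Ax * Ay) :=
  Ax_sq_commute_Ax.mul_right Ax_sq_commute_Ay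

theorem Ax_semiconjBy : SemiconjBy Ax (Ax * Ay) ((Ax * Ay)⁻¹ * (Ax ^ 2) ^ 2) := by
  have h : (Ax * Ay) * (Ax * (Ax * Ay)) = (Ax ^ 2) ^ 2 * Ax := by
    calc (Ax * Ay) * (Ax * (Ax * Ay)) = Ax * Ay * (Ax ^ 2 * Ay) := by simp only [pow_two, mul_assoc]
      _ = Ax * Ay * (Ay * Ax ^ 2) := by rw [Ax_sq_commute_Ay.eq]
      _ = Ax * Ay ^ 2 * Ax ^ 2 := by simp only [pow_two, mul_assoc]
      _ = (Ax ^ 2) ^ 2 * Ax := by rw [← Ax_sq_eq_Ay_sq]; simp only [pow_two, mul_assoc]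
  rw [SemiconjBy, mul_assoc, eq_inv_mul_iff_mul_eq, h]

theorem Ax_mul_zpow (i : ℤ) :
    Ax * (Ax * Ay) ^ i = (Ax * Ay) ^ (-i) * (Ax ^ 2) ^ (2 * i) * Ax := by
  have hc : Commute (Ax * Ay)⁻¹ ((Ax ^ 2) ^ 2) :=
    (Ax_sq_commute_Ax_mul_Ay.pow_left 2).symm.inv_left
  rw [(Ax_semiconjBy.zpow_right i).eq, hc.mul_zpow, inv_zpow', zpow_mul]
  norm_cast

/-- Every element of `⟨x, y | x² = y²⟩` has the form `(xy)ⁱ x²ʲ` or `(xy)ⁱ x²ʲ x`. -/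
theorem exists_zpow_mul_zpow_mul (g : XYSquareGroup) :
    ∃ i j : ℤ, g = (Ax * Ay) ^ i * (Ax ^ 2) ^ j ∨ g = (Ax * Ay) ^ i * (Ax ^ 2) ^ j * Ax := by
  let P (g : XYSquareGroup) : Prop :=
    ∃ i j : ℤ, g = (Ax * Ay) ^ i * (Ax ^ 2) ^ j ∨ g = (Ax * Ay) ^ i * (Ax ^ 2) ^ j * Ax
  have hx (g) (hg : P g) : P (Ax * g) := by
    obtain ⟨i, j, rfl | rfl⟩ := hg
    · refine ⟨-i, 2 * i + j, Or.inr ?_⟩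
      rw [← mul_assoc, Ax_mul_zpow, zpow_add, mul_assoc _ Ax,
        ← (Ax_sq_commute_Ax.zpow_left j).eq]
      simp only [mul_assoc]
    · refine ⟨-i, 2 * i + j + 1, Or.inl ?_⟩
      rw [← mul_assoc, ← mul_assoc, Ax_mul_zpow, zpow_add, zpow_add, zpow_one,
        mul_assoc _ Ax, ← (Ax_sq_commute_Ax.zpow_left j).eq]
      simp only [mul_assoc, pow_two]
  have hz (g) (hg : P g) : P ((Ax ^ 2)⁻¹ * g) := by
    have hc (i : ℤ) : (Ax ^ 2)⁻¹ * (Ax * Ay) ^ i = (Ax * Ay) ^ i * (Ax ^ 2)⁻¹ :=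
      (Ax_sq_commute_Ax_mul_Ay.zpow_right i).inv_left.eq
    obtain ⟨i, j, rfl | rfl⟩ := hg
    · refine ⟨i, -1 + j, Or.inl ?_⟩
      rw [← mul_assoc, hc, zpow_add, zpow_neg_one, mul_assoc]
    · refine ⟨i, -1 + j, Or.inr ?_⟩
      rw [← mul_assoc, ← mul_assoc, hc, zpow_add, zpow_neg_one]
      simp only [mul_assoc]
  have ha (g) (hg : P g) : P (Ax * Ay * g) := by
    obtain ⟨i, j, rfl | rfl⟩ := hg
    · exact ⟨1 + i, j, Or.inl (by rw [zpow_one_add, mul_assoc _ _ ((Ax ^ 2) ^ j)])⟩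
    · exact ⟨1 + i, j, Or.inr (by rw [zpow_one_add]; simp only [mul_assoc])⟩
  have hy (g) (hg : P g) : P (Ay * g) := by
    convert hz _ (hx _ (ha _ hg)) using 1
    group
  have htop : Subgroup.closure (Set.range fun b : Bool => if b then Ax else Ay) = ⊤ := by
    have h : (fun b : Bool => if b then Ax else Ay) = PresentedGroup.of := by
      ext b
      cases b <;> rfl
    rw [h]
    exact PresentedGroup.closure_range_of _
  have hg : g ∈ Subgroup.closure (Set.range fun b : Bool => if b then Ax else Ay) :=
    htop ▸ Subgroup.mem_top g
  induction hg using Subgroup.closure_induction_left with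
  | one => exact ⟨0, 0, Or.inl (by simp)⟩
  | mul_left s hs g _ ih =>
    obtain ⟨_ | _, rfl⟩ := hs
    · exact hy g ih
    · exact hx g ih
  | inv_mul_cancel s hs g _ ih =>
    obtain ⟨_ | _, rfl⟩ := hs
    · convert hz _ (hy g ih) using 1
      rw [Ax_sq_eq_Ay_sq]
      simp [pow_two]
    · convert hz _ (hx g ih) using 1
      simp [pow_two]

/-- The homomorphism from `⟨x, y | x² = y²⟩` to the dihedral group sending `x` and `y` to
adjacent reflections. -/
def toDihedral (n : ℕ) : XYSquareGroup →* DihedralGroup n :=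
  PresentedGroup.toGroup
    (rels := ({FreeGroup.of true ^ 2 * (FreeGroup.of false)⁻¹ ^ 2} : Set (FreeGroup Bool)))
    (f := fun b => if b then DihedralGroup.sr 0 else DihedralGroup.sr 1)
    (by rintro _ rfl; simp [pow_two])

@[simp]
theorem toDihedral_Ax (n : ℕ) : toDihedral n Ax = DihedralGroup.sr 0 :=
  PresentedGroup.toGroup.of _

@[simp]
theorem toDihedral_Ay (n : ℕ) : toDihedral n Ay = DihedralGroup.sr 1 :=
  PresentedGroup.toGroup.of _

theorem toDihedral_zpow_mul_zpow (n : ℕ) (i j : ℤ) :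
    toDihedral n ((Ax * Ay) ^ i * (Ax ^ 2) ^ j) = DihedralGroup.r (i : ZMod n) := by
  simp [pow_two, -DihedralGroup.r_zero]

theorem toDihedral_zpow_mul_zpow_mul_Ax (n : ℕ) (i j : ℤ) :
    toDihedral n ((Ax * Ay) ^ i * (Ax ^ 2) ^ j * Ax) = DihedralGroup.sr (-i : ZMod n) := by
  rw [map_mul, toDihedral_zpow_mul_zpow, toDihedral_Ax, DihedralGroup.r_mul_sr, zero_sub]

theorem toDihedral_surjective (n : ℕ) : Function.Surjective (toDihedral n) := by
  rintro (k | k) <;> obtain ⟨i, rfl⟩ := ZMod.intCast_surjective k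
  · exact ⟨_, toDihedral_zpow_mul_zpow n i 0⟩
  · exact ⟨_, (toDihedral_zpow_mul_zpow_mul_Ax n (-i) 0).trans (by simp)⟩

theorem ker_toDihedral (n : ℕ) :
    (toDihedral n).ker = Subgroup.closure {(Ax * Ay) ^ n, Ax ^ 2} := by
  apply le_antisymm
  · intro g hg
    rw [MonoidHom.mem_ker] at hg
    obtain ⟨i, j, rfl | rfl⟩ := exists_zpow_mul_zpow_mul g
    · rw [toDihedral_zpow_mul_zpow, DihedralGroup.one_def, DihedralGroup.r.injEq,
        ZMod.intCast_zmod_eq_zero_iff_dvd] at hg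
      obtain ⟨k, rfl⟩ := hg
      rw [zpow_mul, zpow_natCast]
      exact mul_mem (zpow_mem (Subgroup.subset_closure (by simp)) k)
        (zpow_mem (Subgroup.subset_closure (by simp)) j)
    · rw [toDihedral_zpow_mul_zpow_mul_Ax, DihedralGroup.one_def] at hg
      cases hg
  · rw [Subgroup.closure_le]
    rintro _ (rfl | rfl)
    · simp
    · simp [pow_two, MonoidHom.mem_ker]

theorem map_toDihedral_closure (n : ℕ) :
    (Subgroup.closure {Ax * Ay, Ax ^ 2}).map (toDihedral n) =
      Subgroup.zpowers (DihedralGroup.r 1) := by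
  have ha : toDihedral n (Ax * Ay) = DihedralGroup.r 1 := by simp
  have hz : toDihedral n (Ax ^ 2) = 1 := by simp [pow_two]
  rw [MonoidHom.map_closure, Set.image_pair, ha, hz, Set.pair_comm, Subgroup.closure_insert_one,
    Subgroup.zpowers_eq_closure]

theorem sq_mem_ker_toDihedral (n : ℕ) {g : XYSquareGroup}
    (hg : g ∉ Subgroup.closure {Ax * Ay, Ax ^ 2}) : g ^ 2 ∈ (toDihedral n).ker := by
  obtain ⟨i, j, rfl | rfl⟩ := exists_zpow_mul_zpow_mul g
  · exact absurd (mul_mem (zpow_mem (Subgroup.subset_closure (by simp)) i)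
      (zpow_mem (Subgroup.subset_closure (by simp)) j)) hg
  · rw [MonoidHom.mem_ker, map_pow, toDihedral_zpow_mul_zpow_mul_Ax, pow_two,
      DihedralGroup.sr_mul_self]

/-- **Dihedral quotients of `π₁(Q³)`.**  In `A = ⟨x, y | x² = y²⟩`, for `n ≥ 1` the subgroup
`U = ⟨(xy)ⁿ, x²⟩` is normal, the quotient `A/U` is dihedral of order `2n` (expressed via a
surjective homomorphism onto `DihedralGroup n` with kernel `U`), and the image of
`C = ⟨xy, x²⟩` in the quotient is cyclic of order `n`; every `g ∈ A ∖ C` satisfies `g² ∈ U`. -/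
theorem xySquareGroup_mod_power_dihedral (n : ℕ) (hn : 1 ≤ n) :
    Subgroup.Normal (Subgroup.closure {(Ax * Ay) ^ n, Ax ^ 2}) ∧
    ∃ φ : XYSquareGroup →* DihedralGroup n,
      Function.Surjective φ ∧
      φ.ker = Subgroup.closure {(Ax * Ay) ^ n, Ax ^ 2} ∧
      IsCyclic ↥(Subgroup.map φ (Subgroup.closure {Ax * Ay, Ax ^ 2})) ∧
      Nat.card ↥(Subgroup.map φ (Subgroup.closure {Ax * Ay, Ax ^ 2})) = n ∧
      ∀ g : XYSquareGroup, g ∉ Subgroup.closure {Ax * Ay, Ax ^ 2} →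
        g ^ 2 ∈ Subgroup.closure {(Ax * Ay) ^ n, Ax ^ 2} := by
  refine ⟨ker_toDihedral n ▸ (toDihedral n).normal_ker, toDihedral n, toDihedral_surjective n,
    ker_toDihedral n, ?_, ?_, fun g hg => ker_toDihedral n ▸ sq_mem_ker_toDihedral n hg⟩
  · rw [map_toDihedral_closure]
    infer_instance
  · rw [map_toDihedral_closure, Nat.card_zpowers, DihedralGroup.orderOf_r_one]
end

section
/- Let C be a group and let A and B be groups containing C as a proper subgroup (C ≠ A and C ≠ B), and let G = A *_C B be the amalgamated free product, with A, B, C identified with their images in G. Assume G is torsion-free and the splitting is malnormal (1-acylindrical), i.e. aCa⁻¹ ∩ C = {1} for all a ∈ A ∖ C and bCb⁻¹ ∩ C = {1} for all b ∈ B ∖ C. If G is generated by two elements, then G is a free group. -/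
/-- A two-element family of types, used to index a binary amalgamated product. -/
def BoolFam (X Y : Type u) : Bool → Type u
  | true => X
  | false => Y

instance instGroupBoolFam (X Y : Type u) [Group X] [Group Y] :
    ∀ b, Group (BoolFam X Y b)
  | true => inferInstanceAs (Group X)
  | false => inferInstanceAs (Group Y)

/-- The two inclusions of a common subgroup, as a `Bool`-indexed family of homomorphisms. -/
def boolFamHom {H : Type*} {X Y : Type u} [Group H] [Group X] [Group Y]
    (f : H →* X) (g : H →* Y) : ∀ b, H →* BoolFam X Y b
  | true => f
  | false => g

/-- The amalgamated free product `X *_H Y` of the maps `f : H →* X` and `g : H →* Y`,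
realized as an indexed pushout. -/
abbrev AmalgamatedProduct {H : Type*} {X Y : Type u} [Group H] [Group X] [Group Y]
    (f : H →* X) (g : H →* Y) : Type _ :=
  Monoid.PushoutI (boolFamHom f g)

/-- The canonical map of the left factor into the amalgamated product. -/
def AmalgamatedProduct.inl {H : Type*} {X Y : Type u} [Group H] [Group X] [Group Y]
    {f : H →* X} {g : H →* Y} : X →* AmalgamatedProduct f g :=
  Monoid.PushoutI.of (φ := boolFamHom f g) true

/-- The canonical map of the right factor into the amalgamated product. -/
def AmalgamatedProduct.inr {H : Type*} {X Y : Type u} [Group H] [Group X] [Group Y]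
    {f : H →* X} {g : H →* Y} : Y →* AmalgamatedProduct f g :=
  Monoid.PushoutI.of (φ := boolFamHom f g) false

open scoped Pointwise in
/-- Two elements generating a group form a free basis as soon as their nontrivial powers play
ping-pong between a set and its complement. -/
theorem isFreeGroup_of_ping_pong {G : Type*} [Group G] {x y : G}
    (hgen : Subgroup.closure {x, y} = ⊤) (X : Set G) (hX : X.Nonempty) (hXc : Xᶜ.Nonempty)
    (hx : ∀ n : ℤ, n ≠ 0 → ∀ z ∉ X, x ^ n * z ∈ X)
    (hy : ∀ n : ℤ, n ≠ 0 → ∀ z ∈ X, y ^ n * z ∉ X) : IsFreeGroup G := by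
  let a : Bool → G := fun b => cond b x y
  let S : Bool → Set G := fun b => cond b X Xᶜ
  have hinj : Function.Injective (FreeGroup.lift a) := by
    have hcomp : FreeGroup.lift a =
        (Monoid.CoprodI.lift fun i => FreeGroup.lift fun _ => a i).comp
          (@freeGroupEquivCoprodI Bool).toMonoidHom := by
      ext i
      simp
    rw [hcomp, MonoidHom.coe_comp]
    refine Function.Injective.comp ?_ (MulEquiv.injective freeGroupEquivCoprodI)
    refine Monoid.CoprodI.lift_injective_of_ping_pong (H := fun _ => FreeGroup Unit)
      (fun i => FreeGroup.lift fun _ => a i) (Or.inr ⟨true, ?_⟩) S ?_ ?_ ?_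
    · exact (Cardinal.natCast_le_aleph0 (n := 3)).trans (Cardinal.aleph0_le_mk _)
    · rintro (_ | _)
      exacts [hXc, hX]
    · rintro (_ | _) (_ | _) hij
      · exact absurd rfl hij
      · exact disjoint_compl_left
      · exact disjoint_compl_right
      · exact absurd rfl hij
    · intro i j hij
      refine FreeGroup.freeGroupUnitEquivInt.forall_congr_left.mpr ?_
      intro n hne
      have hn : n ≠ 0 := by
        rintro rfl
        exact hne rfl
      change FreeGroup.lift (fun _ => a i) (FreeGroup.of () ^ n) • S j ⊆ S i
      simp only [map_zpow, FreeGroup.lift_apply_of]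
      rintro _ ⟨z, hz, rfl⟩
      rcases i with _ | _ <;> rcases j with _ | _
      · exact absurd rfl hij
      · exact hy n hn z hz
      · exact hx n hn z hz
      · exact absurd rfl hij
  have hsurj : Function.Surjective (FreeGroup.lift a) := by
    rw [← MonoidHom.range_eq_top, eq_top_iff, ← hgen, Subgroup.closure_le]
    rintro z (rfl | rfl)
    · exact ⟨FreeGroup.of true, by simp [a]⟩
    · exact ⟨FreeGroup.of false, by simp [a]⟩
  exact IsFreeGroup.ofMulEquiv (MulEquiv.ofBijective _ ⟨hinj, hsurj⟩)

/-- Positive and negative powers of `h` move everything outside `U ∪ V` into `U ∪ V`. -/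
theorem zpow_mul_mem_union {G : Type*} [Group G] {h : G} {U V : Set G} (hUV : Disjoint U V)
    (hU : ∀ z ∉ V, h * z ∈ U) (hV : ∀ z ∉ U, h⁻¹ * z ∈ V) {n : ℤ} (hn : n ≠ 0) {z : G}
    (hz : z ∉ U ∪ V) : h ^ n * z ∈ U ∪ V := by
  have key : ∀ (k : G) (U V : Set G), Disjoint U V → (∀ z ∉ V, k * z ∈ U) →
      ∀ z ∉ V, ∀ m : ℕ, k ^ (m + 1) * z ∈ U := by
    intro k U V hd hk z hz m
    induction m with
    | zero => simpa using hk z hz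
    | succ m ih =>
      rw [pow_succ', mul_assoc]
      exact hk _ (Set.disjoint_left.1 hd ih)
  rw [Set.mem_union, not_or] at hz
  obtain ⟨m, rfl | rfl⟩ := n.eq_nat_or_neg
  · obtain ⟨m, rfl⟩ := Nat.exists_eq_succ_of_ne_zero (by simpa using hn : m ≠ 0)
    refine Or.inl ?_
    rw [zpow_natCast]
    exact key h U V hUV hU z hz.2 m
  · obtain ⟨m, rfl⟩ := Nat.exists_eq_succ_of_ne_zero (by simpa using hn : m ≠ 0)
    refine Or.inr ?_
    rw [zpow_neg, ← inv_zpow, zpow_natCast]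
    exact key h⁻¹ V U hUV.symm hV z hz.1 m

theorem closure_pair_eq_top {G : Type*} [Group G] {x y a b : G}
    (hgen : Subgroup.closure {x, y} = ⊤) (hx : x ∈ Subgroup.closure {a, b})
    (hy : y ∈ Subgroup.closure {a, b}) : Subgroup.closure {a, b} = ⊤ := by
  rw [eq_top_iff, ← hgen, Subgroup.closure_le]
  rintro z (rfl | rfl)
  exacts [hx, hy]

theorem closure_pair_conj_eq_top {G : Type*} [Group G] {x y : G}
    (hgen : Subgroup.closure {x, y} = ⊤) (p : G) :
    Subgroup.closure {p⁻¹ * x * p, p⁻¹ * y * p} = ⊤ := by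
  have h1 := congrArg (Subgroup.map (MulAut.conj p⁻¹).toMonoidHom) hgen
  rw [MonoidHom.map_closure, Set.image_pair,
    Subgroup.map_top_of_surjective _ (MulAut.conj p⁻¹).surjective] at h1
  simpa using h1

theorem closure_pair_inv_eq_top {G : Type*} [Group G] {x y : G}
    (hgen : Subgroup.closure {x, y} = ⊤) : Subgroup.closure {x, y⁻¹} = ⊤ :=
  closure_pair_eq_top hgen (Subgroup.subset_closure (by simp))
    (inv_inv y ▸ inv_mem (Subgroup.subset_closure (by simp)))

/-- The Gromov product of `x` and `y` with respect to a length function, scaled by two. -/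
def gromovProd {G : Type*} [Group G] (L : G → ℕ) (x y : G) : ℤ :=
  L x + L y - L (x⁻¹ * y)

/-- The properties of the syllable length on the amalgamated product of two factors `P true` and
`P false` along a proper malnormal subgroup, which consists of the elements of length zero. -/
structure IsMalnormalLength {G : Type*} [Group G] (P : Bool → Subgroup G) (L : G → ℕ) : Prop where
  one : L 1 = 0
  inv : ∀ x, L x⁻¹ = L x
  min_gromovProd_le : ∀ x y z, min (gromovProd L x y) (gromovProd L y z) ≤ gromovProd L x z
  split : ∀ z k, k ≤ L z → ∃ p r, z = p * r ∧ L p = k ∧ L p + L r = L z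
  le_one : ∀ i, ∀ x ∈ P i, L x ≤ 1
  exists_mem : ∀ x, L x ≤ 1 → ∃ i, x ∈ P i
  mem_of_eq_zero : ∀ i x, L x = 0 → x ∈ P i
  exists_eq_one : ∀ i, ∃ t ∈ P i, L t = 1
  mul_eq_two : ∀ i j, i ≠ j → ∀ x ∈ P i, ∀ y ∈ P j, L x = 1 → L y = 1 → L (x * y) = 2
  malnormal : ∀ i, ∀ x ∈ P i, L x = 1 → ∀ c, L c = 0 → L (x * c * x⁻¹) = 0 → c = 1

/-- The elements whose normal form starts with the left coset of the syllable `x`. -/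
def startsWith {G : Type*} [Group G] (L : G → ℕ) (x : G) : Set G :=
  {z | 2 ≤ gromovProd L z x}

/-- The elements whose normal form starts with a syllable from the subgroup `K`. -/
def startsIn {G : Type*} [Group G] (L : G → ℕ) (K : Subgroup G) : Set G :=
  {z | ∃ t ∈ K, L t = 1 ∧ 1 ≤ gromovProd L z t}

namespace IsMalnormalLength

variable {G : Type*} [Group G] {P : Bool → Subgroup G} {L : G → ℕ}

theorem gromovProd_comm (h : IsMalnormalLength P L) (x y : G) :
    gromovProd L x y = gromovProd L y x := by
  have := h.inv (x⁻¹ * y)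
  rw [mul_inv_rev, inv_inv] at this
  simp only [gromovProd]
  omega

theorem gromovProd_trans (h : IsMalnormalLength P L) {x y z : G} {m : ℤ}
    (hxy : m ≤ gromovProd L x y) (hyz : m ≤ gromovProd L y z) : m ≤ gromovProd L x z :=
  (le_min hxy hyz).trans (h.min_gromovProd_le x y z)

theorem gromovProd_nonneg (h : IsMalnormalLength P L) (x y : G) : 0 ≤ gromovProd L x y := by
  refine h.gromovProd_trans (y := 1) ?_ ?_ <;> simp [gromovProd, h.inv, h.one]

theorem mul_le (h : IsMalnormalLength P L) (x y : G) : L (x * y) ≤ L x + L y := by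
  have := h.gromovProd_nonneg x⁻¹ y
  simp only [gromovProd, h.inv, inv_inv] at this
  omega

theorem gromovProd_inv_left (h : IsMalnormalLength P L) (x y : G) :
    gromovProd L x⁻¹ y = L x + L y - L (x * y) := by
  simp [gromovProd, h.inv]

theorem gromovProd_mul_left (h : IsMalnormalLength P L) (x y : G) :
    gromovProd L (x * y) x = L (x * y) + L x - L y := by
  simp [gromovProd, h.inv]

theorem mul_eq_of_eq_zero (h : IsMalnormalLength P L) {c : G} (hc : L c = 0) (x : G) :
    L (c * x) = L x := by
  have h1 := h.mul_le c x
  have h2 := h.mul_le c⁻¹ (c * x)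
  rw [inv_mul_cancel_left, h.inv] at h2
  omega

theorem gromovProd_mul_mul (h : IsMalnormalLength P L) {c : G} (hc : L c = 0) (x y : G) :
    gromovProd L (c * x) (c * y) = gromovProd L x y := by
  simp only [gromovProd, h.mul_eq_of_eq_zero hc, mul_inv_rev, mul_assoc, inv_mul_cancel_left]

theorem one_le_gromovProd (h : IsMalnormalLength P L) {i : Bool} {s t : G} (hs : s ∈ P i)
    (ht : t ∈ P i) (hs1 : L s = 1) (ht1 : L t = 1) : 1 ≤ gromovProd L s t := by
  have := h.le_one i _ (mul_mem (inv_mem hs) ht)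
  simp only [gromovProd]
  omega

theorem gromovProd_eq_zero (h : IsMalnormalLength P L) {i j : Bool} (hij : i ≠ j) {s t : G}
    (hs : s ∈ P i) (ht : t ∈ P j) (hs1 : L s = 1) (ht1 : L t = 1) : gromovProd L s t = 0 := by
  have := h.mul_eq_two i j hij _ (inv_mem hs) _ ht (by rw [h.inv, hs1]) ht1
  simp only [gromovProd]
  omega

theorem notMem_of_ne (h : IsMalnormalLength P L) {i j : Bool} (hij : i ≠ j) {t : G}
    (ht : t ∈ P i) (ht1 : L t = 1) : t ∉ P j := fun htj => by
  have h1 := h.one_le_gromovProd ht ht ht1 ht1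
  have h2 := h.gromovProd_eq_zero hij ht htj ht1 ht1
  omega

theorem mem_startsIn_iff (h : IsMalnormalLength P L) {i : Bool} {t : G} (ht : t ∈ P i)
    (ht1 : L t = 1) {z : G} : z ∈ startsIn L (P i) ↔ 1 ≤ gromovProd L z t :=
  ⟨fun ⟨_, hs, hs1, hz⟩ => h.gromovProd_trans hz (h.one_le_gromovProd hs ht hs1 ht1),
    fun hz => ⟨t, ht, ht1, hz⟩⟩

theorem notMem_startsIn_of_ne (h : IsMalnormalLength P L) {i j : Bool} (hij : i ≠ j) {z : G}
    (hz : z ∈ startsIn L (P i)) : z ∉ startsIn L (P j) := by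
  rintro ⟨t, ht, ht1, hzt⟩
  obtain ⟨s, hs, hs1, hzs⟩ := hz
  have h1 := h.gromovProd_trans ((h.gromovProd_comm z s).symm ▸ hzs) hzt
  rw [h.gromovProd_eq_zero hij hs ht hs1 ht1] at h1
  omega

theorem startsWith_subset (h : IsMalnormalLength P L) {i : Bool} {x : G} (hx : x ∈ P i)
    (hx1 : L x = 1) : startsWith L x ⊆ startsIn L (P i) := fun z hz => by
  have : 2 ≤ gromovProd L z x := hz
  exact (h.mem_startsIn_iff hx hx1).2 (by omega)

theorem exists_mem_startsWith (h : IsMalnormalLength P L) {z : G} (hz : L z ≠ 0) :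
    ∃ i, ∃ x ∈ P i, L x = 1 ∧ z ∈ startsWith L x := by
  obtain ⟨p, r, rfl, hp, hr⟩ := h.split z 1 (by omega)
  obtain ⟨i, hi⟩ := h.exists_mem p hp.le
  refine ⟨i, p, hi, hp, ?_⟩
  change 2 ≤ gromovProd L (p * r) p
  rw [h.gromovProd_mul_left]
  omega

theorem disjoint_startsWith (h : IsMalnormalLength P L) {x y : G} (hx : L x = 1) (hy : L y = 1)
    (hxy : L (x⁻¹ * y) ≠ 0) : Disjoint (startsWith L x) (startsWith L y) := by
  refine Set.disjoint_left.2 fun z hzx hzy => hxy ?_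
  have hzx : 2 ≤ gromovProd L z x := hzx
  have := h.gromovProd_trans ((h.gromovProd_comm z x).symm ▸ hzx) hzy
  simp only [gromovProd] at this
  omega

theorem disjoint_startsWith_startsIn (h : IsMalnormalLength P L) {i j : Bool} (hij : i ≠ j)
    {x : G} (hx : x ∈ P i) (hx1 : L x = 1) :
    Disjoint (startsWith L x) (startsIn L (P j)) :=
  Set.disjoint_left.2 fun _ hz => h.notMem_startsIn_of_ne hij (h.startsWith_subset hx hx1 hz)

theorem mul_mem_startsWith (h : IsMalnormalLength P L) {i : Bool} {x : G} (hx : x ∈ P i)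
    (hx1 : L x = 1) {z : G} (hz : z ∉ startsIn L (P i)) : x * z ∈ startsWith L x := by
  have h1 := h.gromovProd_nonneg x⁻¹ z
  have h2 := (h.mem_startsIn_iff (inv_mem hx) (by rw [h.inv, hx1])).not.1 hz
  rw [h.gromovProd_comm, h.gromovProd_inv_left] at h2
  change 2 ≤ gromovProd L (x * z) x
  rw [h.gromovProd_mul_left]
  omega

theorem mul_mem_startsWith_mul (h : IsMalnormalLength P L) {x y z : G} (hx : L x = 1)
    (hy : L y = 1) (hxy : L (x * y) = 1) (hz : z ∈ startsWith L y) :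
    x * z ∈ startsWith L (x * y) := by
  have hz : 2 ≤ gromovProd L z y := hz
  have h1 : ¬ 2 ≤ gromovProd L x⁻¹ z := fun hc => by
    have := h.gromovProd_trans hc hz
    rw [h.gromovProd_inv_left] at this
    omega
  rw [h.gromovProd_inv_left] at h1
  change 2 ≤ gromovProd L (x * z) (x * y)
  simp only [gromovProd, mul_inv_rev, mul_assoc, inv_mul_cancel_left] at hz ⊢
  omega

theorem mul_mem_startsWith_of_two_le (h : IsMalnormalLength P L) {k x y z : G} (hk : 2 ≤ L k)
    (hkx : k ∈ startsWith L x) (hky : k⁻¹ ∈ startsWith L y) (hz : z ∉ startsWith L y) :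
    k * z ∈ startsWith L x := by
  have h1 : ¬ 2 ≤ gromovProd L k⁻¹ z := fun hc => by
    rw [h.gromovProd_comm] at hc
    exact hz (h.gromovProd_trans hc hky)
  rw [h.gromovProd_inv_left] at h1
  refine h.gromovProd_trans (y := k) ?_ hkx
  rw [h.gromovProd_mul_left]
  omega

theorem zpow_eq_one (h : IsMalnormalLength P L)
    (htf : ∀ (x : G) (n : ℤ), n ≠ 0 → x ^ n = 1 → x = 1) {i : Bool} {g : G} (hg : g ∈ P i)
    (hg1 : L g = 1) {n : ℤ} (hn : n ≠ 0) : L (g ^ n) = 1 := by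
  by_contra hne
  have h0 : L (g ^ n) = 0 := by
    have := h.le_one i _ (zpow_mem hg n)
    omega
  have h1 := h.malnormal i g hg hg1 (g ^ n) h0 (by
    rwa [← zpow_one_add, add_comm, zpow_add_one, mul_inv_cancel_right])
  rw [htf g n hn h1, h.one] at hg1
  omega

theorem conj_eq_one (h : IsMalnormalLength P L) {i : Bool} {x c : G} (hx : x ∈ P i)
    (hx1 : L x = 1) (hc : L c = 0) (hc1 : c ≠ 1) : L (x⁻¹ * c * x) = 1 := by
  by_contra hne
  have h0 : L (x⁻¹ * c * x) = 0 := by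
    have := h.le_one i _ (mul_mem (mul_mem (inv_mem hx) (h.mem_of_eq_zero i c hc)) hx)
    omega
  exact hc1 (h.malnormal i x⁻¹ (inv_mem hx) (by rw [h.inv, hx1]) c hc (by rwa [inv_inv]))

theorem conj_le (h : IsMalnormalLength P L) {i : Bool} {k x y : G} (hk : 2 ≤ L k)
    (hx : x ∈ P i) (hy : y ∈ P i) (hx1 : L x = 1) (hy1 : L y = 1)
    (hkx : k ∈ startsWith L x) (hky : k⁻¹ ∈ startsWith L y) : L (x⁻¹ * k * x) + 1 ≤ L k := by
  have h1 : 1 ≤ gromovProd L k⁻¹ x := by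
    refine h.gromovProd_trans (y := y) ?_ (h.one_le_gromovProd hy hx hy1 hx1)
    have : 2 ≤ gromovProd L k⁻¹ y := hky
    omega
  rw [h.gromovProd_inv_left] at h1
  have h2 := h.mul_le (k * x) x⁻¹
  rw [mul_inv_cancel_right, h.inv] at h2
  have h3 : 2 ≤ gromovProd L (k * x) x := by
    refine h.gromovProd_trans (y := k) ?_ hkx
    rw [h.gromovProd_mul_left]
    omega
  rw [h.gromovProd_comm] at h3
  simp only [gromovProd, ← mul_assoc] at h3
  omega

theorem exists_mem_startsWith_of_mem_startsIn (h : IsMalnormalLength P L) {i : Bool} {z : G}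
    (hz : z ∈ startsIn L (P i)) : ∃ x ∈ P i, L x = 1 ∧ z ∈ startsWith L x := by
  have hz0 : L z ≠ 0 := fun h0 => by
    obtain ⟨t, -, -, ht⟩ := hz
    have := h.mul_eq_of_eq_zero (c := z⁻¹) (by rw [h.inv, h0]) t
    simp only [gromovProd] at ht
    omega
  obtain ⟨j, x, hx, hx1, hzx⟩ := h.exists_mem_startsWith hz0
  obtain rfl : j = i := by
    by_contra hji
    exact h.notMem_startsIn_of_ne hji (h.startsWith_subset hx hx1 hzx) hz
  exact ⟨x, hx, hx1, hzx⟩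

theorem mem_startsIn_not_of_conj (h : IsMalnormalLength P L) {i : Bool} {x q : G} (hx : x ∈ P i)
    (hx1 : L x = 1) (hq0 : L q ≠ 0) (hq : L (x * q * x⁻¹) = L q + 2) :
    q ∈ startsIn L (P !i) := by
  obtain ⟨j, t, ht, ht1, hqt⟩ := h.exists_mem_startsWith hq0
  obtain rfl | rfl : j = i ∨ j = !i := by cases i <;> cases j <;> simp
  · have h1 : 1 ≤ gromovProd L x⁻¹ q := by
      rw [h.gromovProd_comm]
      exact (h.mem_startsIn_iff (inv_mem hx) (by rw [h.inv, hx1])).1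
        (h.startsWith_subset ht ht1 hqt)
    rw [h.gromovProd_inv_left] at h1
    have h2 := h.mul_le (x * q) x⁻¹
    rw [h.inv] at h2
    omega
  · exact h.startsWith_subset ht ht1 hqt

theorem mem_of_mem_startsWith (h : IsMalnormalLength P L) {i : Bool} {x k : G} (hx : x ∈ P i)
    (hx1 : L x = 1) (hk : L k ≤ 1) (hkx : k ∈ startsWith L x) : k ∈ P i := by
  have hkx : 2 ≤ gromovProd L k x := hkx
  simp only [gromovProd] at hkx
  have h0 : L (k⁻¹ * x) = 0 := by omega
  have := mul_mem hx (inv_mem (h.mem_of_eq_zero i _ h0))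
  rwa [mul_inv_rev, inv_inv, mul_inv_cancel_left] at this

/-- If the normal forms of `k` and `k⁻¹` both start with a syllable from `P i`, then so does
the normal form of every nontrivial power of `k`. -/
theorem zpow_mul_mem_startsIn (h : IsMalnormalLength P L)
    (htf : ∀ (x : G) (n : ℤ), n ≠ 0 → x ^ n = 1 → x = 1) {i : Bool} {k : G}
    (hk : k ∈ startsIn L (P i)) (hk' : k⁻¹ ∈ startsIn L (P i)) {n : ℤ} (hn : n ≠ 0) {z : G}
    (hz : z ∉ startsIn L (P i)) : k ^ n * z ∈ startsIn L (P i) := by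
  induction hm : L k using Nat.strong_induction_on generalizing i k z with
  | _ m ih =>
  obtain ⟨x, hx, hx1, hkx⟩ := h.exists_mem_startsWith_of_mem_startsIn hk
  obtain ⟨y, hy, hy1, hky⟩ := h.exists_mem_startsWith_of_mem_startsIn hk'
  by_cases hk2 : L k ≤ 1
  · have hkP := h.mem_of_mem_startsWith hx hx1 hk2 hkx
    have hk1 : L k = 1 := by
      have h2 : 2 ≤ gromovProd L k x := hkx
      simp only [gromovProd] at h2
      omega
    exact h.startsWith_subset (zpow_mem hkP n) (h.zpow_eq_one htf hkP hk1 hn)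
      (h.mul_mem_startsWith (zpow_mem hkP n) (h.zpow_eq_one htf hkP hk1 hn) hz)
  by_cases hxy : L (x⁻¹ * y) = 0
  · have hkx' : 2 ≤ gromovProd L k⁻¹ x := by
      refine h.gromovProd_trans hky ?_
      rw [h.gromovProd_comm]
      simp only [gromovProd]
      omega
    rw [h.gromovProd_inv_left] at hkx'
    have h2 := h.mul_le (k * x) x⁻¹
    rw [mul_inv_cancel_right, h.inv] at h2
    have h3 : 2 ≤ gromovProd L (k * x) x := by
      refine h.gromovProd_trans (y := k) ?_ hkx
      rw [h.gromovProd_mul_left]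
      omega
    rw [h.gromovProd_comm] at h3
    simp only [gromovProd, ← mul_assoc] at h3
    obtain ⟨q, hq⟩ : ∃ q, q = x⁻¹ * k * x := ⟨_, rfl⟩
    obtain rfl : k = x * q * x⁻¹ := by rw [hq]; group
    rw [← hq] at h3
    have h4 := h.mul_le (x * q) x⁻¹
    have h5 := h.mul_le x q
    rw [h.inv] at h4
    have hq2 : L (x * q * x⁻¹) = L q + 2 := by omega
    have hq0 : L q ≠ 0 := fun h0 => hk2 <|
      h.le_one i _ (mul_mem (mul_mem hx (h.mem_of_eq_zero i q h0)) (inv_mem hx))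
    rw [conj_zpow, mul_assoc, mul_assoc]
    refine h.startsWith_subset hx hx1 (h.mul_mem_startsWith hx hx1 ?_)
    refine h.notMem_startsIn_of_ne (i := !i) (by simp) ?_
    refine ih (L q) (by omega) (h.mem_startsIn_not_of_conj hx hx1 hq0 hq2)
      (h.mem_startsIn_not_of_conj hx hx1 (by rwa [h.inv]) ?_) ?_ rfl
    · rw [h.inv, ← hq2, ← h.inv (x * q * x⁻¹)]
      congr 1
      group
    · exact h.notMem_startsIn_of_ne (i := i) (by simp) (h.startsWith_subset (inv_mem hx)
        (by rw [h.inv, hx1]) (h.mul_mem_startsWith (inv_mem hx) (by rw [h.inv, hx1]) hz))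
  · have := zpow_mul_mem_union (h.disjoint_startsWith hx1 hy1 hxy)
      (fun z hz => h.mul_mem_startsWith_of_two_le (by omega) hkx hky hz)
      (fun z hz => h.mul_mem_startsWith_of_two_le (by rw [h.inv]; omega) hky
        (by rwa [inv_inv]) hz) hn (z := z)
      (fun hc => hz (hc.elim (fun hc => h.startsWith_subset hx hx1 hc)
        (fun hc => h.startsWith_subset hy hy1 hc)))
    exact this.elim (fun hc => h.startsWith_subset hx hx1 hc)
      (fun hc => h.startsWith_subset hy hy1 hc)

theorem ne_one_of_closure_eq_top (h : IsMalnormalLength P L) {g k : G}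
    (hgen : Subgroup.closure {g, k} = ⊤) : g ≠ 1 := by
  rintro rfl
  obtain ⟨a, ha, ha1⟩ := h.exists_eq_one true
  obtain ⟨b, hb, hb1⟩ := h.exists_eq_one false
  have hk : ∀ z, z ∈ Subgroup.zpowers k := fun z => by
    have : z ∈ Subgroup.closure {1, k} := hgen ▸ Subgroup.mem_top z
    rwa [Subgroup.closure_insert_one, ← Subgroup.zpowers_eq_closure] at this
  obtain ⟨m, hm⟩ := hk a
  obtain ⟨n, hn⟩ := hk b
  have hab : a * b = b * a := by
    simp only at hm hn
    rw [← hm, ← hn, ← zpow_add, ← zpow_add, add_comm]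
  have h1 := h.mul_eq_two true false (by simp) a ha b hb ha1 hb1
  have h2 : 2 ≤ gromovProd L (a * b) a := by rw [h.gromovProd_mul_left]; omega
  have h3 : 2 ≤ gromovProd L (a * b) b := by
    rw [hab, h.gromovProd_mul_left, ← hab]
    omega
  rw [h.gromovProd_comm] at h2
  have h4 := h.gromovProd_trans h2 h3
  rw [h.gromovProd_eq_zero (i := true) (j := false) (by simp) ha hb ha1 hb1] at h4
  omega

theorem notMem_of_closure_eq_top (h : IsMalnormalLength P L) {i : Bool} {g k : G} (hg : g ∈ P i)
    (hgen : Subgroup.closure {g, k} = ⊤) : k ∉ P i := fun hk => by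
  obtain ⟨t, ht, ht1⟩ := h.exists_eq_one (!i)
  have hle : Subgroup.closure {g, k} ≤ P i := by
    rw [Subgroup.closure_le]
    rintro z (rfl | rfl)
    exacts [hg, hk]
  exact h.notMem_of_ne (by simp) ht ht1 (hle (hgen ▸ Subgroup.mem_top t))

theorem zpow_eq_zero (h : IsMalnormalLength P L) {g : G} (hg : L g = 0) (n : ℤ) :
    L (g ^ n) = 0 := by
  have hmem : ∀ i, g ^ n ∈ P i := fun i => zpow_mem (h.mem_of_eq_zero i g hg) n
  by_contra hne
  have := h.le_one true _ (hmem true)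
  exact h.notMem_of_ne (i := true) (j := false) (by simp) (hmem true) (by omega) (hmem false)

theorem mul_notMem_startsWith_union (h : IsMalnormalLength P L) {i j : Bool} (hij : i ≠ j)
    {c x y z : G} (hc : L c = 0) (hc1 : c ≠ 1) (hx : x ∈ P i) (hx1 : L x = 1) (hy : y ∈ P j)
    (hy1 : L y = 1) (hz : z ∈ startsWith L x) : c * z ∉ startsWith L x ∪ startsWith L y := by
  have hcx : L (c * x) = 1 := by rw [h.mul_eq_of_eq_zero hc, hx1]
  have hcz : c * z ∈ startsWith L (c * x) := by
    change 2 ≤ gromovProd L (c * z) (c * x)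
    rw [h.gromovProd_mul_mul hc]
    exact hz
  rintro (hcz' | hcz')
  · refine Set.disjoint_left.1 (h.disjoint_startsWith hx1 hcx ?_) hcz' hcz
    rw [← mul_assoc, h.conj_eq_one hx hx1 hc hc1]
    exact one_ne_zero
  · exact Set.disjoint_left.1 (h.disjoint_startsWith_startsIn hij
      (mul_mem (h.mem_of_eq_zero i c hc) hx) hcx) hcz (h.startsWith_subset hy hy1 hcz')

/-- The mixed case of a reduced generating pair with an elliptic generator: the normal forms of
`k` and `k⁻¹` start in different factors. -/
theorem isFreeGroup_of_mixed (h : IsMalnormalLength P L)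
    (htf : ∀ (x : G) (n : ℤ), n ≠ 0 → x ^ n = 1 → x = 1) {i j : Bool} (hij : i ≠ j) {g k x y : G}
    (hg : g ∈ P i) (hgen : Subgroup.closure {g, k} = ⊤)
    (hmin : ∀ i, ∀ g' ∈ P i, ∀ k', Subgroup.closure {g', k'} = ⊤ → 2 * L k + L g ≤ 2 * L k' + L g')
    (hx : x ∈ P i) (hx1 : L x = 1) (hkx : k ∈ startsWith L x)
    (hy : y ∈ P j) (hy1 : L y = 1) (hky : k⁻¹ ∈ startsWith L y) : IsFreeGroup G := by
  have hg1 := h.ne_one_of_closure_eq_top hgen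
  have hk2 : 2 ≤ L k := by
    by_contra hlt
    exact h.notMem_of_closure_eq_top hg hgen
      (h.mem_of_mem_startsWith hx hx1 (by omega) hkx)
  have hone : ∀ t, (1 : G) ∉ startsWith L t := fun t ht => by
    have ht : 2 ≤ gromovProd L 1 t := ht
    simp [gromovProd, h.one] at ht
  have hmaps : ∀ z ∉ startsWith L y, k * z ∈ startsWith L x := fun z hz =>
    h.mul_mem_startsWith_of_two_le hk2 hkx hky hz
  have hmaps' : ∀ z ∉ startsWith L x, k⁻¹ * z ∈ startsWith L y := fun z hz =>
    h.mul_mem_startsWith_of_two_le (by rwa [h.inv]) hky (by rwa [inv_inv]) hz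
  have hdisj : Disjoint (startsWith L x) (startsWith L y) :=
    (h.disjoint_startsWith_startsIn hij hx hx1).mono_right (h.startsWith_subset hy hy1)
  have hkx' : L (x⁻¹ * k) + 1 ≤ L k := by
    have hkx : 2 ≤ gromovProd L k x := hkx
    rw [h.gromovProd_comm] at hkx
    simp only [gromovProd] at hkx
    omega
  rw [Set.pair_comm] at hgen
  by_cases hg0 : L g = 0
  · refine isFreeGroup_of_ping_pong hgen (startsWith L x ∪ startsWith L y) ⟨k, Or.inl hkx⟩
      ⟨1, not_or.2 ⟨hone x, hone y⟩⟩
      (fun n hn z hz => zpow_mul_mem_union hdisj hmaps hmaps' hn hz) ?_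
    intro n hn z hz
    have hgn : g ^ n ≠ 1 := fun hc => hg1 (htf g n hn hc)
    rcases hz with hz | hz
    · exact h.mul_notMem_startsWith_union hij (h.zpow_eq_zero hg0 n) hgn hx hx1 hy hy1 hz
    · rw [Set.union_comm]
      exact h.mul_notMem_startsWith_union hij.symm (h.zpow_eq_zero hg0 n) hgn hy hy1 hx hx1 hz
  · have hgl : L g = 1 := by
      have := h.le_one i g hg
      omega
    have hcP : x⁻¹ * g * x ∈ P i := mul_mem (mul_mem (inv_mem hx) hg) hx
    have hconj : L (x⁻¹ * g * x) = 1 := by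
      by_contra hne
      have h1 := h.le_one i _ hcP
      have h2 := hmin i _ hcP _ (closure_pair_conj_eq_top (Set.pair_comm k g ▸ hgen) x)
      have h3 := h.mul_le (x⁻¹ * k) x
      omega
    have hconjn : ∀ n : ℤ, n ≠ 0 → L (x⁻¹ * (g ^ n * x)) = 1 := fun n hn => by
      have h1 := h.zpow_eq_one htf hcP hconj hn
      have h2 := conj_zpow (a := x⁻¹) (b := g) (i := n)
      rw [inv_inv] at h2
      rwa [h2, mul_assoc] at h1
    have hgx : ∀ n : ℤ, L (g ^ n * x) = 1 := fun n => by
      by_contra hne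
      have h1 := h.le_one i _ (mul_mem (zpow_mem hg n) hx)
      have h2 := h.mul_le (g ^ n * x) (x⁻¹ * k)
      rw [mul_assoc, mul_inv_cancel_left] at h2
      have h3 := hmin i g hg (g ^ n * k) (closure_pair_eq_top hgen (by
        have h4 : g ∈ Subgroup.closure {g, g ^ n * k} := Subgroup.subset_closure (by simp)
        have h5 : g ^ n * k ∈ Subgroup.closure {g, g ^ n * k} :=
          Subgroup.subset_closure (by simp)
        have h6 := mul_mem (inv_mem (zpow_mem h4 n)) h5
        rwa [inv_mul_cancel_left] at h6) (Subgroup.subset_closure (by simp)))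
      omega
    refine isFreeGroup_of_ping_pong hgen (startsWith L x ∪ startsIn L (P j)) ⟨k, Or.inl hkx⟩
      ⟨1, ?_⟩ ?_ ?_
    · rintro (h1 | h1)
      · exact hone x h1
      · obtain ⟨t, -, -, ht⟩ := h.exists_mem_startsWith_of_mem_startsIn h1
        exact hone t ht
    · intro n hn z hz
      refine Or.imp_right (fun h1 => h.startsWith_subset hy hy1 h1)
        (zpow_mul_mem_union hdisj hmaps hmaps' hn (z := z) ?_)
      exact fun hc => hz (hc.imp_right fun h1 => h.startsWith_subset hy hy1 h1)
    · intro n hn z hz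
      have hgn := h.zpow_eq_one htf hg hgl hn
      have hgP := zpow_mem hg n
      rcases hz with hz | hz
      · have h1 := h.mul_mem_startsWith_mul hgn hx1 (hgx n) hz
        rintro (h2 | h2)
        · refine Set.disjoint_left.1 (h.disjoint_startsWith hx1 (hgx n) ?_) h2 h1
          rw [hconjn n hn]
          exact one_ne_zero
        · exact Set.disjoint_left.1
            (h.disjoint_startsWith_startsIn hij (mul_mem hgP hx) (hgx n)) h1 h2
      · have h1 := h.mul_mem_startsWith hgP hgn (h.notMem_startsIn_of_ne hij.symm hz)
        rintro (h2 | h2)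
        · refine Set.disjoint_left.1 (h.disjoint_startsWith hgn hx1 ?_) h1 h2
          rw [← zpow_neg, hgx]
          exact one_ne_zero
        · exact Set.disjoint_left.1 (h.disjoint_startsWith_startsIn hij hgP hgn) h1 h2

theorem false_of_startsIn_startsIn (h : IsMalnormalLength P L) {i : Bool} {g k x y : G}
    (hg : g ∈ P i) (hgen : Subgroup.closure {g, k} = ⊤)
    (hmin : ∀ i, ∀ g' ∈ P i, ∀ k', Subgroup.closure {g', k'} = ⊤ → 2 * L k + L g ≤ 2 * L k' + L g')
    (hx : x ∈ P i) (hx1 : L x = 1) (hkx : k ∈ startsWith L x)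
    (hy : y ∈ P i) (hy1 : L y = 1) (hky : k⁻¹ ∈ startsWith L y) : False := by
  have hk2 : 2 ≤ L k := by
    by_contra hlt
    exact h.notMem_of_closure_eq_top hg hgen
      (h.mem_of_mem_startsWith hx hx1 (by omega) hkx)
  have hcP : x⁻¹ * g * x ∈ P i := mul_mem (mul_mem (inv_mem hx) hg) hx
  have h1 := h.le_one i _ hcP
  have h2 := hmin i _ hcP _ (closure_pair_conj_eq_top hgen x)
  have h3 := h.conj_le hk2 hx hy hx1 hy1 hkx hky
  omega

/-- A group generated by two elements, one of which lies in a factor, is free. -/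
theorem isFreeGroup_of_mem (h : IsMalnormalLength P L)
    (htf : ∀ (x : G) (n : ℤ), n ≠ 0 → x ^ n = 1 → x = 1)
    (hgen : ∃ i, ∃ g ∈ P i, ∃ k, Subgroup.closure {g, k} = ⊤) : IsFreeGroup G := by
  classical
  have hex : ∃ n, ∃ i, ∃ g ∈ P i, ∃ k, Subgroup.closure {g, k} = ⊤ ∧ 2 * L k + L g = n := by
    obtain ⟨i, g, hg, k, hgk⟩ := hgen
    exact ⟨_, i, g, hg, k, hgk, rfl⟩
  obtain ⟨i, g, hg, k, hgk, hn⟩ := Nat.find_spec hex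
  have hmin : ∀ i, ∀ g' ∈ P i, ∀ k', Subgroup.closure {g', k'} = ⊤ →
      2 * L k + L g ≤ 2 * L k' + L g' := fun i g' hg' k' hgk' =>
    hn.trans_le (Nat.find_min' hex ⟨i, g', hg', k', hgk', rfl⟩)
  have hk0 : L k ≠ 0 := fun h0 =>
    h.notMem_of_closure_eq_top hg hgk (h.mem_of_eq_zero i k h0)
  obtain ⟨a, x, hx, hx1, hkx⟩ := h.exists_mem_startsWith hk0
  obtain ⟨b, y, hy, hy1, hky⟩ := h.exists_mem_startsWith (z := k⁻¹) (by rwa [h.inv])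
  by_cases hai : i = a
  · subst hai
    by_cases hbi : i = b
    · subst hbi
      exact (h.false_of_startsIn_startsIn hg hgk hmin hx hx1 hkx hy hy1 hky).elim
    · exact h.isFreeGroup_of_mixed htf hbi hg hgk hmin hx hx1 hkx hy hy1 hky
  · by_cases hbi : i = b
    · subst hbi
      refine h.isFreeGroup_of_mixed htf hai hg (closure_pair_inv_eq_top hgk) ?_ hy hy1 hky hx hx1
        (by rwa [inv_inv])
      rwa [h.inv]
    · obtain rfl : a = b := by
        cases i <;> cases a <;> cases b <;> simp_all
      by_cases hg0 : L g = 0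
      · exact (h.false_of_startsIn_startsIn (h.mem_of_eq_zero a g hg0) hgk hmin hx hx1 hkx
          hy hy1 hky).elim
      · have hg1 : L g = 1 := by
          have := h.le_one i g hg
          omega
        have hkT := h.startsWith_subset hx hx1 hkx
        have hkT' := h.startsWith_subset hy hy1 hky
        have hmaps : ∀ n : ℤ, n ≠ 0 → ∀ z ∈ startsIn L (P a), g ^ n * z ∉ startsIn L (P a) := by
          intro n hn' z hz
          have hgn := h.zpow_eq_one htf hg hg1 hn'
          exact Set.disjoint_left.1 (h.disjoint_startsWith_startsIn hai (zpow_mem hg n) hgn)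
            (h.mul_mem_startsWith (zpow_mem hg n) hgn
              (h.notMem_startsIn_of_ne (fun hc => hai hc.symm) hz))
        exact isFreeGroup_of_ping_pong (Set.pair_comm g k ▸ hgk) (startsIn L (P a)) ⟨k, hkT⟩
          ⟨_, hmaps 1 one_ne_zero k hkT⟩
          (fun n hn' z hz => h.zpow_mul_mem_startsIn htf hkT hkT' hn' hz) hmaps

theorem exists_middle (h : IsMalnormalLength P L) (z : G) : ∃ p s r, z = p * s * r ∧
    L p = L z / 2 ∧ L r = L z / 2 ∧ L s = L z % 2 ∧ L z - L z % 2 ≤ gromovProd L p z ∧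
      L z - L z % 2 ≤ gromovProd L z⁻¹ r⁻¹ := by
  obtain ⟨p, q, hz, hp, hq⟩ := h.split z (L z / 2) (by omega)
  obtain ⟨s, r, rfl, hs, hr⟩ := h.split q (L z % 2) (by omega)
  refine ⟨p, s, r, by rw [hz, mul_assoc], hp, by omega, hs, ?_, ?_⟩
  · have : p⁻¹ * z = s * r := by rw [hz]; group
    simp only [gromovProd, this]
    omega
  · have h1 : z * r⁻¹ = p * s := by rw [hz]; group
    have h2 := h.mul_le p s
    rw [h.gromovProd_inv_left, h1, h.inv]
    omega

theorem gromovProd_inv_lt (h : IsMalnormalLength P L)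
    (hell : ∀ i, ∀ g ∈ P i, ∀ k, Subgroup.closure {g, k} ≠ ⊤) {x y : G}
    (hgen : Subgroup.closure {x, y} = ⊤) : gromovProd L x x⁻¹ < L x := by
  by_contra! hle
  obtain ⟨p, s, r, hx, hp, hr, hs, h1, h2⟩ := h.exists_middle x
  have h3 := h.gromovProd_trans (h.gromovProd_trans h1 (by omega : _ ≤ gromovProd L x x⁻¹)) h2
  simp only [gromovProd, h.inv] at h3
  have h4 : L (r * p) = 0 := by
    rw [← h.inv, mul_inv_rev]
    omega
  obtain ⟨i, hi⟩ := h.exists_mem s (by omega)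
  have h5 : p⁻¹ * x * p = s * (r * p) := by
    rw [hx]
    group
  exact hell i _ (h5 ▸ mul_mem hi (h.mem_of_eq_zero i _ h4)) _ (closure_pair_conj_eq_top hgen p)

theorem gromovProd_le {x y : G}
    (hgen : Subgroup.closure {x, y} = ⊤)
    (hmin : ∀ x' y', Subgroup.closure {x', y'} = ⊤ → L x + L y ≤ L x' + L y') :
    gromovProd L x y ≤ L y := by
  have := hmin (x⁻¹ * y) y (closure_pair_eq_top hgen (by
    have h1 : x⁻¹ * y ∈ Subgroup.closure {x⁻¹ * y, y} := Subgroup.subset_closure (by simp)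
    have h2 : y ∈ Subgroup.closure {x⁻¹ * y, y} := Subgroup.subset_closure (by simp)
    simpa using mul_mem h2 (inv_mem h1)) (Subgroup.subset_closure (by simp)))
  simp only [gromovProd]
  omega

theorem gromovProd_lt_or (h : IsMalnormalLength P L)
    (hell : ∀ i, ∀ g ∈ P i, ∀ k, Subgroup.closure {g, k} ≠ ⊤) {x y : G}
    (hgen : Subgroup.closure {x, y} = ⊤)
    (hmin : ∀ x' y', Subgroup.closure {x', y'} = ⊤ → L x + L y ≤ L x' + L y')
    (hyx : L y ≤ L x) : gromovProd L x y < L y ∨ gromovProd L x⁻¹ y⁻¹ < L y := by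
  by_contra! hle
  obtain ⟨hc, hc'⟩ := hle
  obtain ⟨p, s, r, hy, hp, hr, hs, h1, h2⟩ := h.exists_middle y
  have hy2 : 2 ≤ L y := by
    by_contra hlt
    obtain ⟨i, hi⟩ := h.exists_mem y (by omega)
    exact hell i y hi x (Set.pair_comm x y ▸ hgen)
  rw [h.gromovProd_comm] at hc
  have h3 := h.gromovProd_trans h1 (by omega : _ ≤ gromovProd L y x)
  have h4 := h.gromovProd_trans (by omega : _ ≤ gromovProd L x⁻¹ y⁻¹) h2
  rw [h.gromovProd_inv_left, h.inv] at h4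
  have h5 := h.mul_le (x * r⁻¹) r
  rw [inv_mul_cancel_right] at h5
  have h6 := h.gromovProd_trans h3 (z := x * r⁻¹) (by
    rw [h.gromovProd_comm, h.gromovProd_mul_left, h.inv]
    omega)
  simp only [gromovProd] at h6
  have h7 := h.mul_le (p⁻¹ * (x * r⁻¹)) s⁻¹
  have h8 := h.mul_le (s * r) p
  have h9 := h.mul_le s r
  rw [h.inv] at h7
  have hgen' : Subgroup.closure {x * y⁻¹, y} = ⊤ := closure_pair_eq_top hgen (by
    have h1 : x * y⁻¹ ∈ Subgroup.closure {x * y⁻¹, y} := Subgroup.subset_closure (by simp)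
    have h2 : y ∈ Subgroup.closure {x * y⁻¹, y} := Subgroup.subset_closure (by simp)
    simpa using mul_mem h1 h2) (Subgroup.subset_closure (by simp))
  have h10 := hmin _ _ (closure_pair_conj_eq_top hgen' p)
  have e1 : p⁻¹ * (x * y⁻¹) * p = p⁻¹ * (x * r⁻¹) * s⁻¹ := by
    rw [hy]
    group
  have e2 : p⁻¹ * y * p = s * r * p := by
    rw [hy]
    group
  rw [e1, e2] at h10
  omega

theorem zpow_mul_mem_gromovProd (h : IsMalnormalLength P L) {x : G}
    (hx : gromovProd L x x⁻¹ < L x) {n : ℤ} (hn : n ≠ 0) {z : G}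
    (hz : z ∉ {z | L x < gromovProd L x z} ∪ {z | L x ≤ gromovProd L x⁻¹ z}) :
    x ^ n * z ∈ {z | L x < gromovProd L x z} ∪ {z | L x ≤ gromovProd L x⁻¹ z} := by
  refine zpow_mul_mem_union ?_ ?_ ?_ hn hz
  · refine Set.disjoint_left.2 fun z h1 h2 => ?_
    have h1 : L x < gromovProd L x z := h1
    have h2 : L x ≤ gromovProd L x⁻¹ z := h2
    rw [h.gromovProd_comm] at h2
    have := h.gromovProd_trans h1.le h2
    omega
  · intro z hz
    have hz : ¬ L x ≤ gromovProd L x⁻¹ z := hz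
    rw [h.gromovProd_inv_left] at hz
    change L x < gromovProd L x (x * z)
    simp only [gromovProd, inv_mul_cancel_left]
    omega
  · intro z hz
    have hz : ¬ L x < gromovProd L x z := hz
    simp only [gromovProd] at hz
    change L x ≤ gromovProd L x⁻¹ (x⁻¹ * z)
    rw [h.gromovProd_inv_left, mul_inv_cancel_left]
    omega

theorem isFreeGroup_of_gromovProd_lt (h : IsMalnormalLength P L) {x y : G}
    (hgen : Subgroup.closure {x, y} = ⊤) (hyx : L y ≤ L x) (hx0 : L x ≠ 0)
    (hx : gromovProd L x x⁻¹ < L x) (hy : gromovProd L y y⁻¹ < L y)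
    (h1 : gromovProd L x y ≤ L y) (h2 : gromovProd L x⁻¹ y ≤ L y)
    (h3 : gromovProd L x y⁻¹ < L y) (h4 : gromovProd L x⁻¹ y⁻¹ < L y)
    (h5 : L y < L x ∨ gromovProd L x⁻¹ y < L y) : IsFreeGroup G := by
  have hdisj : ∀ z,
      z ∈ {z | (L x : ℤ) < gromovProd L x z} ∪ {z | (L x : ℤ) ≤ gromovProd L x⁻¹ z} →
      z ∉ {z | (L y : ℤ) < gromovProd L y z} ∪ {z | (L y : ℤ) ≤ gromovProd L y⁻¹ z} := by
    have hmin : ∀ (x y z : G) (m n : ℤ), m ≤ gromovProd L x z → n ≤ gromovProd L y z →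
        min m n ≤ gromovProd L x y := fun x y z m n hz hz' =>
      h.gromovProd_trans (min_le_of_left_le hz)
        (min_le_of_right_le ((h.gromovProd_comm y z) ▸ hz'))
    rintro z (hz | hz) (hz' | hz')
    · have := hmin x y z (L x + 1) (L y + 1) hz hz'
      omega
    · have := hmin x y⁻¹ z (L x + 1) (L y) hz hz'
      omega
    · have := hmin x⁻¹ y z (L x) (L y + 1) hz hz'
      omega
    · have := hmin x⁻¹ y⁻¹ z (L x) (L y) hz hz'
      omega
  have hone : (1 : G) ∉
      {z | (L x : ℤ) < gromovProd L x z} ∪ {z | (L x : ℤ) ≤ gromovProd L x⁻¹ z} := by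
    rintro (hz | hz) <;> simp [gromovProd, h.one, h.inv] at hz <;> omega
  exact isFreeGroup_of_ping_pong hgen _ ⟨_, h.zpow_mul_mem_gromovProd hx one_ne_zero hone⟩
    ⟨1, hone⟩ (fun n hn z hz => h.zpow_mul_mem_gromovProd hx hn hz)
    (fun n hn z hz hz' => hdisj _ hz' (h.zpow_mul_mem_gromovProd hy hn (hdisj z hz)))

theorem isFreeGroup_of_minimal (h : IsMalnormalLength P L)
    (hell : ∀ i, ∀ g ∈ P i, ∀ k, Subgroup.closure {g, k} ≠ ⊤) {x y : G}
    (hgen : Subgroup.closure {x, y} = ⊤)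
    (hmin : ∀ x' y', Subgroup.closure {x', y'} = ⊤ → L x + L y ≤ L x' + L y')
    (hyx : L y ≤ L x) : IsFreeGroup G := by
  have hgx : Subgroup.closure {x⁻¹, y} = ⊤ := by
    rw [Set.pair_comm] at hgen ⊢
    exact closure_pair_inv_eq_top hgen
  have hx0 : L x ≠ 0 := fun h0 => hell true x (h.mem_of_eq_zero true x h0) y hgen
  have hx := h.gromovProd_inv_lt hell hgen
  have hy := h.gromovProd_inv_lt hell (Set.pair_comm x y ▸ hgen)
  have n1 := gromovProd_le hgen hmin
  have n2 := gromovProd_le (L := L) hgx (by rwa [h.inv])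
  have n3 := gromovProd_le (L := L) (closure_pair_inv_eq_top hgen) (by rwa [h.inv])
  have n4 := gromovProd_le (L := L) (closure_pair_inv_eq_top hgx) (by rwa [h.inv, h.inv])
  have e1 := h.gromovProd_lt_or hell hgen hmin hyx
  have e2 := h.gromovProd_lt_or hell hgx (by rwa [h.inv]) (by rwa [h.inv])
  rw [inv_inv] at e2
  rw [h.inv] at n3 n4
  have hxx : ∀ w, L y = L x → gromovProd L x w < L y ∨ gromovProd L x⁻¹ w < L y := fun w hw => by
    by_contra! hc
    rw [h.gromovProd_comm x⁻¹] at hc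
    have := h.gromovProd_trans hc.1 hc.2
    omega
  have hyy : ∀ w, gromovProd L w y < L y ∨ gromovProd L w y⁻¹ < L y := fun w => by
    by_contra! hc
    rw [h.gromovProd_comm w] at hc
    have := h.gromovProd_trans hc.1 hc.2
    omega
  have key : ∀ w, Subgroup.closure {x, w} = ⊤ → Subgroup.closure {x⁻¹, w} = ⊤ → L w = L y →
      gromovProd L w w⁻¹ < L y → gromovProd L x w ≤ L y → gromovProd L x⁻¹ w ≤ L y →
      gromovProd L x w⁻¹ < L y → gromovProd L x⁻¹ w⁻¹ < L y → IsFreeGroup G := by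
    intro w hw hw' hwy k1 k2 k3 k4 k5
    by_cases hc : L y < L x ∨ gromovProd L x⁻¹ w < L y
    · apply h.isFreeGroup_of_gromovProd_lt hw <;> (try rw [hwy]) <;> assumption
    · refine h.isFreeGroup_of_gromovProd_lt hw' ?_ ?_ ?_ ?_ ?_ ?_ ?_ ?_ ?_ <;>
        simp only [h.inv, inv_inv, hwy]
      · assumption
      · assumption
      · rwa [h.gromovProd_comm]
      · assumption
      · assumption
      · assumption
      · assumption
      · assumption
      · have := hxx w (by omega)
        omega
  by_cases hc : gromovProd L x y⁻¹ < L y ∧ gromovProd L x⁻¹ y⁻¹ < L y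
  · exact key y hgen hgx rfl hy n1 n2 hc.1 hc.2
  · have := hyy x
    have := hyy x⁻¹
    refine key y⁻¹ (closure_pair_inv_eq_top hgen) (closure_pair_inv_eq_top hgx) (h.inv y) ?_ n3 n4
      ?_ ?_ <;> rw [inv_inv]
    · rwa [h.gromovProd_comm]
    · omega
    · omega

/-- A torsion-free two-generated group with a malnormal syllable length is free. -/
theorem isFreeGroup_of_two_generated (h : IsMalnormalLength P L)
    (htf : ∀ (x : G) (n : ℤ), n ≠ 0 → x ^ n = 1 → x = 1)
    (hgen : ∃ x y : G, Subgroup.closure {x, y} = ⊤) : IsFreeGroup G := by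
  classical
  by_cases hell : ∃ i, ∃ g ∈ P i, ∃ k, Subgroup.closure {g, k} = ⊤
  · exact h.isFreeGroup_of_mem htf hell
  push Not at hell
  have hex : ∃ n, ∃ x y : G, Subgroup.closure {x, y} = ⊤ ∧ L x + L y = n := by
    obtain ⟨x, y, hxy⟩ := hgen
    exact ⟨_, x, y, hxy, rfl⟩
  obtain ⟨x, y, hxy, hn⟩ := Nat.find_spec hex
  have hmin : ∀ x' y', Subgroup.closure {x', y'} = ⊤ → L x + L y ≤ L x' + L y' :=
    fun x' y' hxy' => hn.trans_le (Nat.find_min' hex ⟨x', y', hxy', rfl⟩)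
  rcases le_total (L y) (L x) with hle | hle
  · exact h.isFreeGroup_of_minimal hell hxy hmin hle
  · exact h.isFreeGroup_of_minimal hell (Set.pair_comm x y ▸ hxy) (by rwa [add_comm (L y)]) hle

end IsMalnormalLength

namespace Monoid.PushoutI

open scoped Classical in
/-- Twice the length of the common prefix of two lists of letters, plus one if the subsequent
letters come from the same factor. -/
noncomputable def overlap {ι : Type*} {G : ι → Type*} : List (Σ i, G i) → List (Σ i, G i) → ℕ
  | a :: u, b :: v => if a = b then 2 + overlap u v else if a.1 = b.1 then 1 else 0
  | _, _ => 0

theorem min_overlap_le {ι : Type*} {G : ι → Type*} (a b c : List (Σ i, G i)) :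
    min (overlap a b) (overlap b c) ≤ overlap a c := by
  induction a generalizing b c with
  | nil => cases b <;> simp [overlap]
  | cons x a ih =>
    cases b with
    | nil => simp [overlap]
    | cons y b =>
      cases c with
      | nil => simp [overlap]
      | cons z c =>
        have := ih b c
        simp only [overlap]
        split_ifs <;> first | omega | simp_all

variable {ι : Type*} {G : ι → Type*} {H : Type*} [∀ i, Group (G i)] [Group H]
  {φ : ∀ i, H →* G i}

variable (φ) in
/-- The product in the amalgamated product of a list of letters from the factors. -/
def letterProd (l : List (Σ i, G i)) : PushoutI φ :=
  (l.map fun a => of a.1 a.2).prod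

variable (φ) in
/-- A list of letters is reduced if neighbours come from distinct factors and no letter lies in
the amalgamated subgroup. -/
def IsReducedList (l : List (Σ i, G i)) : Prop :=
  (l.map Sigma.fst).IsChain (· ≠ ·) ∧ ∀ a ∈ l, a.2 ∉ (φ a.1).range

/-- The list of the inverses of the letters. -/
def invLetters (l : List (Σ i, G i)) : List (Σ i, G i) :=
  l.map fun a => ⟨a.1, a.2⁻¹⟩

variable (φ) in
/-- The syllable length of an element of an amalgamated product. -/
noncomputable def syllableLength (x : PushoutI φ) : ℕ :=
  sInf {n | ∃ h l, IsReducedList φ l ∧ x = base φ h * letterProd φ l ∧ l.length = n}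

theorem letterProd_nil : letterProd φ [] = 1 := rfl

theorem letterProd_cons (a : Σ i, G i) (l : List (Σ i, G i)) :
    letterProd φ (a :: l) = of a.1 a.2 * letterProd φ l := by
  simp [letterProd]

theorem letterProd_append (l m : List (Σ i, G i)) :
    letterProd φ (l ++ m) = letterProd φ l * letterProd φ m := by
  simp [letterProd]

theorem letterProd_invLetters (l : List (Σ i, G i)) :
    letterProd φ (invLetters l) = (letterProd φ l.reverse)⁻¹ := by
  induction l with
  | nil => simp [invLetters, letterProd]
  | cons a l ih =>
    rw [List.reverse_cons, letterProd_append, mul_inv_rev, ← ih]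
    simp [invLetters, letterProd]

theorem map_fst_invLetters (l : List (Σ i, G i)) :
    (invLetters l).map Sigma.fst = l.map Sigma.fst := by
  simp [invLetters]

theorem isReducedList_nil : IsReducedList φ [] := by
  simp [IsReducedList]

theorem IsReducedList.of_cons {a : Σ i, G i} {l : List (Σ i, G i)}
    (hl : IsReducedList φ (a :: l)) : IsReducedList φ l :=
  ⟨by simpa using hl.1.tail, fun b hb => hl.2 b (List.mem_cons_of_mem _ hb)⟩

theorem IsReducedList.reverse {l : List (Σ i, G i)} (hl : IsReducedList φ l) :
    IsReducedList φ l.reverse := by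
  refine ⟨?_, fun a ha => hl.2 a (List.mem_reverse.1 ha)⟩
  rw [List.map_reverse, List.isChain_reverse]
  exact hl.1.imp fun _ _ h => h.symm

theorem IsReducedList.invLetters {l : List (Σ i, G i)} (hl : IsReducedList φ l) :
    IsReducedList φ (invLetters l) := by
  refine ⟨by rw [map_fst_invLetters]; exact hl.1, fun a ha => ?_⟩
  obtain ⟨b, hb, rfl⟩ := List.mem_map.1 ha
  simpa using hl.2 b hb

theorem IsReducedList.of_append {l m : List (Σ i, G i)} (hlm : IsReducedList φ (l ++ m)) :
    IsReducedList φ l ∧ IsReducedList φ m := by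
  obtain ⟨h1, h2⟩ := hlm
  rw [List.map_append] at h1
  exact ⟨⟨h1.left_of_append, fun a ha => h2 a (List.mem_append_left _ ha)⟩,
    ⟨h1.right_of_append, fun a ha => h2 a (List.mem_append_right _ ha)⟩⟩

theorem IsReducedList.exists_normalWord (d : NormalWord.Transversal φ) {l : List (Σ i, G i)}
    (hl : IsReducedList φ l) :
    ∃ w : NormalWord d, w.prod = letterProd φ l ∧ w.toList.length = l.length := by
  obtain ⟨w, hw, hwl⟩ := Reduced.exists_normalWord_prod_eq d
    (w := ⟨l, fun a ha h1 => hl.2 a ha (h1 ▸ one_mem _), (List.isChain_map _).1 hl.1⟩) hl.2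
  refine ⟨w, ?_, by simpa using congrArg List.length hwl⟩
  rw [hw]
  simp [CoprodI.Word.prod, letterProd, Function.comp_def, map_list_prod]

theorem IsReducedList.length_eq (hφ : ∀ i, Function.Injective (φ i)) {l m : List (Σ i, G i)}
    (hl : IsReducedList φ l) (hm : IsReducedList φ m) {h k : H}
    (heq : base φ h * letterProd φ l = base φ k * letterProd φ m) : l.length = m.length := by
  obtain ⟨d⟩ := NormalWord.transversal_nonempty φ hφ
  obtain ⟨v, hv, hvl⟩ := hl.exists_normalWord d
  obtain ⟨w, hw, hwm⟩ := hm.exists_normalWord d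
  rw [← hv, ← hw, ← NormalWord.prod_base_smul, ← NormalWord.prod_base_smul] at heq
  have := congrArg (fun w : NormalWord d => w.toList.length) (NormalWord.prod_injective heq)
  rw [← hvl, ← hwm]
  exact this

theorem syllableLength_eq (hφ : ∀ i, Function.Injective (φ i)) {l : List (Σ i, G i)}
    (hl : IsReducedList φ l) (h : H) :
    syllableLength φ (base φ h * letterProd φ l) = l.length := by
  have : {n | ∃ k m, IsReducedList φ m ∧ base φ h * letterProd φ l = base φ k * letterProd φ m ∧
      m.length = n} = {l.length} := by
    ext n
    constructor
    · rintro ⟨k, m, hm, heq, rfl⟩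
      exact hm.length_eq hφ hl heq.symm
    · rintro rfl
      exact ⟨h, l, hl, rfl, rfl⟩
  rw [syllableLength, this, csInf_singleton]

theorem syllableLength_letterProd (hφ : ∀ i, Function.Injective (φ i)) {l : List (Σ i, G i)}
    (hl : IsReducedList φ l) : syllableLength φ (letterProd φ l) = l.length := by
  simpa using syllableLength_eq hφ hl 1

theorem eq_of_mul_inv_mem_range (d : NormalWord.Transversal φ) {i : ι} {x y : G i}
    (hx : x ∈ d.set i) (hy : y ∈ d.set i) (hxy : x * y⁻¹ ∈ (φ i).range) : x = y :=
  congrArg Subtype.val <|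
    (Subgroup.isComplement_iff_existsUnique_mul_inv_mem.1 (d.compl i) x).unique
      (y₁ := ⟨x, hx⟩) (y₂ := ⟨y, hy⟩) (by rw [mul_inv_cancel]; exact one_mem _) hxy

theorem exists_eq_base_mul_letterProd (d : NormalWord.Transversal φ) (x : PushoutI φ) :
    ∃ h l, IsReducedList φ l ∧ (∀ a ∈ l, a.2 ∈ d.set a.1) ∧ x = base φ h * letterProd φ l := by
  classical
  obtain ⟨w, rfl⟩ := (NormalWord.equiv (d := d)).symm.surjective x
  refine ⟨w.head, w.toList, ⟨(List.isChain_map _).2 w.chain_ne, fun a ha hr => ?_⟩,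
    fun a ha => w.normalized a.1 a.2 ha, ?_⟩
  · have h1 := (Subgroup.IsComplement.equiv_snd_eq_self_iff_mem (d.compl a.1) (one_mem _)).2
      (w.normalized a.1 a.2 ha)
    exact w.ne_one a ha (h1.symm.trans
      ((Subgroup.IsComplement.coe_equiv_snd_eq_one_iff_mem _ (d.one_mem _)).2 hr))
  · change base φ w.head * _ = _
    simp [CoprodI.Word.prod, letterProd, Function.comp_def, map_list_prod]

theorem syllableLength_base_mul (hφ : ∀ i, Function.Injective (φ i)) (h : H) (x : PushoutI φ) :
    syllableLength φ (base φ h * x) = syllableLength φ x := by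
  obtain ⟨d⟩ := NormalWord.transversal_nonempty φ hφ
  obtain ⟨k, l, hl, -, rfl⟩ := exists_eq_base_mul_letterProd d x
  rw [← mul_assoc, ← map_mul, syllableLength_eq hφ hl, syllableLength_eq hφ hl]

theorem syllableLength_mul_base (hφ : ∀ i, Function.Injective (φ i)) (h : H) (x : PushoutI φ) :
    syllableLength φ (x * base φ h) = syllableLength φ x := by
  obtain ⟨d⟩ := NormalWord.transversal_nonempty φ hφ
  obtain ⟨k, l, hl, -, rfl⟩ := exists_eq_base_mul_letterProd d x
  rw [mul_assoc, syllableLength_base_mul hφ, syllableLength_eq hφ hl]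
  rcases l.eq_nil_or_concat with rfl | ⟨m, a, rfl⟩
  · simpa [letterProd] using syllableLength_eq hφ isReducedList_nil h
  · have : letterProd φ (m ++ [a]) * base φ h = letterProd φ (m ++ [⟨a.1, a.2 * φ a.1 h⟩]) := by
      simp [letterProd, mul_assoc, of_apply_eq_base]
    rw [List.concat_eq_append] at hl ⊢
    rw [this, syllableLength_letterProd hφ]
    · simp
    · refine ⟨by simpa using hl.1, fun b hb => ?_⟩
      rcases List.mem_append.1 hb with hb | hb
      · exact hl.2 b (List.mem_append_left _ hb)
      · obtain rfl := List.mem_singleton.1 hb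
        have := hl.2 a (by simp)
        rwa [Subgroup.mul_mem_cancel_right _ (MonoidHom.mem_range.2 ⟨h, rfl⟩)]

theorem syllableLength_inv (hφ : ∀ i, Function.Injective (φ i)) (x : PushoutI φ) :
    syllableLength φ x⁻¹ = syllableLength φ x := by
  obtain ⟨d⟩ := NormalWord.transversal_nonempty φ hφ
  obtain ⟨k, l, hl, -, rfl⟩ := exists_eq_base_mul_letterProd d x
  rw [mul_inv_rev, ← map_inv, syllableLength_mul_base hφ, syllableLength_eq hφ hl,
    ← List.reverse_reverse l, ← letterProd_invLetters,
    syllableLength_letterProd hφ hl.reverse.invLetters]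
  simp [invLetters]

theorem syllableLength_mul_inv (hφ : ∀ i, Function.Injective (φ i)) (d : NormalWord.Transversal φ)
    {a b : List (Σ i, G i)} (ha : IsReducedList φ a) (had : ∀ x ∈ a, x.2 ∈ d.set x.1)
    (hb : IsReducedList φ b) (hbd : ∀ x ∈ b, x.2 ∈ d.set x.1) :
    syllableLength φ (letterProd φ a.reverse * (letterProd φ b.reverse)⁻¹) + overlap a b =
      a.length + b.length := by
  induction a generalizing b with
  | nil =>
    rw [← letterProd_invLetters, List.reverse_nil, letterProd_nil, one_mul,
      syllableLength_letterProd hφ hb.invLetters]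
    simp [overlap, invLetters]
  | cons x u ih =>
    cases b with
    | nil =>
      rw [List.reverse_nil, letterProd_nil, inv_one, mul_one,
        syllableLength_letterProd hφ ha.reverse]
      simp [overlap]
    | cons y v =>
      have hu := ha.reverse
      have hv := hb.invLetters
      rw [List.reverse_cons] at hu
      by_cases hxy : x = y
      · subst hxy
        have h1 := ih ha.of_cons (fun z hz => had z (List.mem_cons_of_mem _ hz)) hb.of_cons
          (fun z hz => hbd z (List.mem_cons_of_mem _ hz))
        simp only [overlap, if_true, List.reverse_cons, letterProd_append, mul_inv_rev, mul_assoc,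
          mul_inv_cancel_left, List.length_cons]
        omega
      by_cases hi : x.1 = y.1
      · obtain ⟨i, x⟩ := x
        obtain ⟨j, y⟩ := y
        obtain rfl : i = j := hi
        have h1 : letterProd φ (⟨i, x⟩ :: u).reverse * (letterProd φ (⟨i, y⟩ :: v).reverse)⁻¹ =
            letterProd φ (u.reverse ++ ⟨i, x * y⁻¹⟩ :: invLetters v) := by
          simp [letterProd_append, letterProd_cons, letterProd_nil, letterProd_invLetters,
            mul_assoc]
        rw [h1, syllableLength_letterProd hφ]
        · simp only [overlap, if_neg hxy, if_true, List.length_append, List.length_reverse,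
            List.length_cons, invLetters, List.length_map]
          omega
        · have hxy' : x ≠ y := fun hc => hxy (by rw [hc])
          refine ⟨?_, fun z hz => ?_⟩
          · have hu1 := hu.1
            have hv1 := hb.1
            rw [List.map_append, List.map_cons, map_fst_invLetters, List.isChain_split]
            rw [List.map_append] at hu1
            exact ⟨hu1, hv1⟩
          · rw [List.mem_append, List.mem_cons] at hz
            rcases hz with hz | rfl | hz
            · exact hu.2 z (List.mem_append_left _ hz)
            · exact fun hr => hxy' (eq_of_mul_inv_mem_range d (had _ List.mem_cons_self)
                (hbd _ List.mem_cons_self) hr)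
            · exact hb.of_cons.invLetters.2 z hz
      · rw [← letterProd_invLetters, ← letterProd_append, syllableLength_letterProd hφ]
        · simp [overlap, hxy, hi, invLetters]
          omega
        · refine ⟨?_, fun z hz => ?_⟩
          · have hu1 := hu.1
            have hv1 := hb.1
            rw [List.map_append, map_fst_invLetters, List.reverse_cons, List.map_append,
              List.append_assoc]
            rw [List.map_append] at hu1
            exact List.isChain_append_cons_cons.2 ⟨hu1, hi, hv1⟩
          · rw [List.mem_append, List.reverse_cons] at hz
            exact hz.elim (hu.2 z) (hv.2 z)

theorem min_gromovProd_syllableLength_le (hφ : ∀ i, Function.Injective (φ i))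
    (x y z : PushoutI φ) :
    min (gromovProd (syllableLength φ) x y) (gromovProd (syllableLength φ) y z) ≤
      gromovProd (syllableLength φ) x z := by
  obtain ⟨d⟩ := NormalWord.transversal_nonempty φ hφ
  have hex : ∀ x : PushoutI φ, ∃ l, IsReducedList φ l ∧ (∀ a ∈ l, a.2 ∈ d.set a.1) ∧
      ∃ h, x = (letterProd φ l.reverse)⁻¹ * base φ h := fun x => by
    obtain ⟨h, l, hl, hld, hx⟩ := exists_eq_base_mul_letterProd d x⁻¹
    refine ⟨l.reverse, hl.reverse, fun a ha => hld a (List.mem_reverse.1 ha), h⁻¹, ?_⟩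
    rw [List.reverse_reverse, map_inv, ← mul_inv_rev, ← hx, inv_inv]
  have hprod : ∀ l m : List (Σ i, G i), IsReducedList φ l → (∀ a ∈ l, a.2 ∈ d.set a.1) →
      IsReducedList φ m → (∀ a ∈ m, a.2 ∈ d.set a.1) → ∀ h k : H,
      gromovProd (syllableLength φ) ((letterProd φ l.reverse)⁻¹ * base φ h)
        ((letterProd φ m.reverse)⁻¹ * base φ k) = overlap l m := by
    intro l m hl hld hm hmd h k
    have h1 := syllableLength_mul_inv hφ d hl hld hm hmd
    have h2 : ((letterProd φ l.reverse)⁻¹ * base φ h)⁻¹ * ((letterProd φ m.reverse)⁻¹ * base φ k) =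
        base φ h⁻¹ * (letterProd φ l.reverse * (letterProd φ m.reverse)⁻¹ * base φ k) := by
      rw [map_inv]
      group
    rw [gromovProd, h2, syllableLength_base_mul hφ, syllableLength_mul_base hφ,
      syllableLength_mul_base hφ, syllableLength_mul_base hφ, syllableLength_inv hφ,
      syllableLength_inv hφ, syllableLength_letterProd hφ hl.reverse,
      syllableLength_letterProd hφ hm.reverse, List.length_reverse, List.length_reverse]
    omega
  obtain ⟨l, hl, hld, h, rfl⟩ := hex x
  obtain ⟨m, hm, hmd, k, rfl⟩ := hex y
  obtain ⟨n, hn, hnd, j, rfl⟩ := hex z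
  rw [hprod l m hl hld hm hmd, hprod m n hm hmd hn hnd, hprod l n hl hld hn hnd]
  exact_mod_cast min_overlap_le l m n

theorem exists_eq_mul_syllableLength (hφ : ∀ i, Function.Injective (φ i)) (x : PushoutI φ) (k : ℕ)
    (hk : k ≤ syllableLength φ x) : ∃ p r, x = p * r ∧ syllableLength φ p = k ∧
      syllableLength φ p + syllableLength φ r = syllableLength φ x := by
  obtain ⟨d⟩ := NormalWord.transversal_nonempty φ hφ
  obtain ⟨h, l, hl, -, rfl⟩ := exists_eq_base_mul_letterProd d x
  rw [syllableLength_eq hφ hl] at hk ⊢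
  have hsplit := List.take_append_drop k l
  obtain ⟨h1, h2⟩ := IsReducedList.of_append (hsplit.symm ▸ hl)
  refine ⟨base φ h * letterProd φ (l.take k), letterProd φ (l.drop k), ?_, ?_, ?_⟩
  · rw [mul_assoc, ← letterProd_append, hsplit]
  · rw [syllableLength_eq hφ h1, List.length_take_of_le hk]
  · rw [syllableLength_eq hφ h1, syllableLength_letterProd hφ h2, ← List.length_append, hsplit]

theorem syllableLength_eq_zero_iff (hφ : ∀ i, Function.Injective (φ i)) {x : PushoutI φ} :
    syllableLength φ x = 0 ↔ x ∈ (base φ).range := by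
  constructor
  · intro h0
    obtain ⟨d⟩ := NormalWord.transversal_nonempty φ hφ
    obtain ⟨h, l, hl, -, rfl⟩ := exists_eq_base_mul_letterProd d x
    rw [syllableLength_eq hφ hl, List.length_eq_zero_iff] at h0
    exact ⟨h, by rw [h0, letterProd_nil, mul_one]⟩
  · rintro ⟨h, rfl⟩
    simpa [letterProd] using syllableLength_eq hφ isReducedList_nil h

theorem isReducedList_singleton {i : ι} {x : G i} (hx : x ∉ (φ i).range) :
    IsReducedList φ [⟨i, x⟩] := by
  refine ⟨by simp, fun a ha => ?_⟩
  obtain rfl := List.mem_singleton.1 ha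
  exact hx

theorem syllableLength_of_eq_one (hφ : ∀ i, Function.Injective (φ i)) {i : ι} {x : G i}
    (hx : x ∉ (φ i).range) : syllableLength φ (of (φ := φ) i x) = 1 := by
  simpa [letterProd] using syllableLength_letterProd hφ (isReducedList_singleton hx)

theorem base_mem_range_of (i : ι) (h : H) : base φ h ∈ (of (φ := φ) i).range :=
  ⟨φ i h, of_apply_eq_base φ i h⟩

theorem syllableLength_of_le_one (hφ : ∀ i, Function.Injective (φ i)) (i : ι) (x : G i) :
    syllableLength φ (of (φ := φ) i x) ≤ 1 := by
  by_cases hx : x ∈ (φ i).range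
  · obtain ⟨h, rfl⟩ := hx
    rw [of_apply_eq_base, (syllableLength_eq_zero_iff hφ).2 ⟨h, rfl⟩]
    exact zero_le_one
  · exact (syllableLength_of_eq_one hφ hx).le

theorem notMem_range_of_syllableLength_eq_one (hφ : ∀ i, Function.Injective (φ i)) {i : ι}
    {x : G i} (hx : syllableLength φ (of (φ := φ) i x) = 1) : x ∉ (φ i).range := by
  rintro ⟨h, rfl⟩
  rw [of_apply_eq_base, (syllableLength_eq_zero_iff hφ).2 ⟨h, rfl⟩] at hx
  exact zero_ne_one hx

theorem exists_mem_range_of [Nonempty ι] (hφ : ∀ i, Function.Injective (φ i)) {x : PushoutI φ}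
    (hx : syllableLength φ x ≤ 1) : ∃ i, x ∈ (of (φ := φ) i).range := by
  obtain ⟨d⟩ := NormalWord.transversal_nonempty φ hφ
  obtain ⟨h, l, hl, -, rfl⟩ := exists_eq_base_mul_letterProd d x
  rw [syllableLength_eq hφ hl] at hx
  match l, hx with
  | [], _ => exact ⟨Classical.arbitrary ι, by
      simpa [letterProd] using base_mem_range_of _ h⟩
  | [a], _ => exact ⟨a.1, by
      simpa [letterProd] using mul_mem (base_mem_range_of a.1 h) ⟨a.2, rfl⟩⟩

theorem syllableLength_of_mul_of (hφ : ∀ i, Function.Injective (φ i)) {i j : ι} (hij : i ≠ j)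
    {x : G i} {y : G j} (hx : x ∉ (φ i).range) (hy : y ∉ (φ j).range) :
    syllableLength φ (of (φ := φ) i x * of j y) = 2 := by
  have h : IsReducedList φ [⟨i, x⟩, ⟨j, y⟩] := by
    refine ⟨by simpa using hij, fun a ha => ?_⟩
    rcases List.mem_cons.1 ha with rfl | ha
    · exact hx
    · obtain rfl := List.mem_singleton.1 ha
      exact hy
  simpa [letterProd] using syllableLength_letterProd hφ h

/-- The syllable length of an amalgamated product of two groups along a proper malnormal
subgroup. -/
theorem isMalnormalLength_syllableLength {G : Bool → Type*} [∀ i, Group (G i)]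
    {φ : ∀ i, H →* G i} (hφ : ∀ i, Function.Injective (φ i))
    (hsurj : ∀ i, ¬ Function.Surjective (φ i))
    (hmal : ∀ i, ∀ x ∈ (of (φ := φ) i).range, x ∉ (base φ).range →
      ∀ c ∈ (base φ).range, x * c * x⁻¹ ∈ (base φ).range → c = 1) :
    IsMalnormalLength (fun i => (of (φ := φ) i).range) (syllableLength φ) where
  one := (syllableLength_eq_zero_iff hφ).2 (one_mem _)
  inv := syllableLength_inv hφ
  min_gromovProd_le := min_gromovProd_syllableLength_le hφ
  split := exists_eq_mul_syllableLength hφ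
  le_one := by
    rintro i _ ⟨x, rfl⟩
    exact syllableLength_of_le_one hφ i x
  exists_mem _ hx := exists_mem_range_of hφ hx
  mem_of_eq_zero i x hx := by
    obtain ⟨h, rfl⟩ := (syllableLength_eq_zero_iff hφ).1 hx
    exact base_mem_range_of i h
  exists_eq_one i := by
    obtain ⟨t, ht⟩ := not_forall.1 (hsurj i)
    exact ⟨of i t, ⟨t, rfl⟩, syllableLength_of_eq_one hφ ht⟩
  mul_eq_two := by
    rintro i j hij _ ⟨x, rfl⟩ _ ⟨y, rfl⟩ hx hy
    exact syllableLength_of_mul_of hφ hij (notMem_range_of_syllableLength_eq_one hφ hx)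
      (notMem_range_of_syllableLength_eq_one hφ hy)
  malnormal i x hx hx1 c hc hxc := by
    rw [syllableLength_eq_zero_iff hφ] at hc hxc
    refine hmal i x hx (fun h0 => ?_) c hc hxc
    rw [(syllableLength_eq_zero_iff hφ).2 h0] at hx1
    exact zero_ne_one hx1

end Monoid.PushoutI

/-- **Karrass–Solitar.**  Let `G = A *_C B` with `C` proper in each factor, `G` torsion-free,
and the splitting malnormal (1-acylindrical): `aCa⁻¹ ∩ C = 1` for `a ∈ A ∖ C` and
`bCb⁻¹ ∩ C = 1` for `b ∈ B ∖ C`.  If `G` is generated by two elements, then `G` is free. -/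
theorem free_of_two_generated_malnormal_amalgam
    {C : Type*} {A B : Type u} [Group A] [Group B] [Group C]
    (f : C →* A) (g : C →* B)
    (hf : Function.Injective f) (hg : Function.Injective g)
    (hfp : ¬ Function.Surjective f) (hgp : ¬ Function.Surjective g)
    (htf : ∀ (x : AmalgamatedProduct f g) (n : ℕ), 1 ≤ n → x ^ n = 1 → x = 1)
    (hmalA : ∀ a ∈ AmalgamatedProduct.inl.range,
      a ∉ (Monoid.PushoutI.base (boolFamHom f g)).range →
      ∀ x ∈ (Monoid.PushoutI.base (boolFamHom f g)).range,
        a * x * a⁻¹ ∈ (Monoid.PushoutI.base (boolFamHom f g)).range → x = 1)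
    (hmalB : ∀ b ∈ AmalgamatedProduct.inr.range,
      b ∉ (Monoid.PushoutI.base (boolFamHom f g)).range →
      ∀ x ∈ (Monoid.PushoutI.base (boolFamHom f g)).range,
        b * x * b⁻¹ ∈ (Monoid.PushoutI.base (boolFamHom f g)).range → x = 1)
    (h2gen : ∃ x y : AmalgamatedProduct f g, Subgroup.closure {x, y} = ⊤) :
    IsFreeGroup (AmalgamatedProduct f g) := by
  have htf' : ∀ (x : AmalgamatedProduct f g) (n : ℤ), n ≠ 0 → x ^ n = 1 → x = 1 := by
    intro x n hn hx
    refine htf x n.natAbs (Int.natAbs_pos.2 hn) ?_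
    rwa [← pow_natAbs_eq_one] at hx
  have hlen : IsMalnormalLength _ (Monoid.PushoutI.syllableLength (boolFamHom f g)) :=
    Monoid.PushoutI.isMalnormalLength_syllableLength (by rintro (_ | _) <;> assumption)
      (by rintro (_ | _) <;> assumption) (by rintro (_ | _) <;> assumption)
  exact hlen.isFreeGroup_of_two_generated htf' h2gen
end

section
/- Let A and B be elements of SL(2,ℂ) having no common eigenvector, i.e. there is no nonzero vector u ∈ ℂ² and scalars λ, μ ∈ ℂ with Au = λu and Bu = μu. Then there exists T ∈ SL(2,ℂ) with trace 0 (equivalently T² = -1) such that T A T⁻¹ = A⁻¹ and T B T⁻¹ = B⁻¹; in particular conjugation by T maps the subgroup of SL(2,ℂ) generated by {A, B} onto itself. -/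
open Matrix

/-- A nonzero singular `2 × 2` matrix has a one-dimensional kernel. -/
theorem exists_span_ker_of_det_eq_zero {K : Type*} [Field K] {N : Matrix (Fin 2) (Fin 2) K}
    (hN : N ≠ 0) (hdet : N.det = 0) :
    ∃ u : Fin 2 → K, u ≠ 0 ∧ N *ᵥ u = 0 ∧ ∀ v, N *ᵥ v = 0 → ∃ c : K, v = c • u := by
  obtain ⟨u, hu, hNu⟩ := Matrix.exists_mulVec_eq_zero_iff.mpr hdet
  refine ⟨u, hu, hNu, fun v hNv => ?_⟩
  have hD : u 0 * v 1 - u 1 * v 0 = 0 := by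
    by_contra hD
    refine hN (Matrix.ext fun i j => ?_)
    have h₁ := congrFun hNu i
    have h₂ := congrFun hNv i
    simp only [mulVec, dotProduct, Fin.sum_univ_two, Pi.zero_apply] at h₁ h₂
    refine (mul_eq_zero.mp ?_).resolve_right hD
    revert j
    rw [Fin.forall_fin_two]
    constructor
    · linear_combination v 1 * h₁ - u 1 * h₂
    · linear_combination u 0 * h₂ - v 0 * h₁
  by_cases h0 : u 0 = 0
  · have h1 : u 1 ≠ 0 := fun h1 => hu (by ext i; fin_cases i <;> simp [h0, h1])
    have hv0 : v 0 = 0 := by simpa [h0, h1] using hD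
    refine ⟨v 1 / u 1, ?_⟩
    ext i
    fin_cases i <;> simp [h0, h1, hv0]
  · refine ⟨v 0 / u 0, ?_⟩
    ext i
    fin_cases i
    · simp [h0]
    · simp only [Fin.mk_one, Pi.smul_apply, smul_eq_mul]
      field_simp
      linear_combination hD

/-- If the kernel of a nonzero singular `2 × 2` matrix is stable under `A` and `B`, then it
consists of common eigenvectors of `A` and `B`. -/
theorem exists_common_eigenvector_of_intertwining {K : Type*} [Field K]
    {N A B C D : Matrix (Fin 2) (Fin 2) K} (hN : N ≠ 0) (hdet : N.det = 0)
    (hA : N * A = C * N) (hB : N * B = D * N) :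
    ∃ u : Fin 2 → K, u ≠ 0 ∧ ∃ a b : K, A *ᵥ u = a • u ∧ B *ᵥ u = b • u := by
  obtain ⟨u, hu, hNu, hspan⟩ := exists_span_ker_of_det_eq_zero hN hdet
  obtain ⟨a, ha⟩ := hspan (A *ᵥ u) (by rw [mulVec_mulVec, hA, ← mulVec_mulVec, hNu, mulVec_zero])
  obtain ⟨b, hb⟩ := hspan (B *ᵥ u) (by rw [mulVec_mulVec, hB, ← mulVec_mulVec, hNu, mulVec_zero])
  exact ⟨u, hu, a, b, ha, hb⟩

theorem exists_det_algebraMap_sub_eq_zero {K : Type*} [Field K] [IsAlgClosed K]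
    (A : Matrix (Fin 2) (Fin 2) K) :
    ∃ a : K, (algebraMap K (Matrix (Fin 2) (Fin 2) K) a - A).det = 0 := by
  obtain ⟨a, ha⟩ := spectrum.nonempty_of_isAlgClosed_of_finiteDimensional K A
  refine ⟨a, ?_⟩
  rwa [spectrum.mem_iff, Matrix.isUnit_iff_isUnit_det, isUnit_iff_ne_zero, not_not] at ha

theorem exists_common_eigenvector_of_commute {K : Type*} [Field K] [IsAlgClosed K]
    {A B : Matrix (Fin 2) (Fin 2) K} (h : Commute A B) :
    ∃ u : Fin 2 → K, u ≠ 0 ∧ ∃ a b : K, A *ᵥ u = a • u ∧ B *ᵥ u = b • u := by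
  obtain ⟨a, ha⟩ := exists_det_algebraMap_sub_eq_zero A
  by_cases hA : algebraMap K (Matrix (Fin 2) (Fin 2) K) a - A = 0
  · obtain ⟨b, hb⟩ := exists_det_algebraMap_sub_eq_zero B
    obtain ⟨u, hu, hBu⟩ := Matrix.exists_mulVec_eq_zero_iff.mpr hb
    refine ⟨u, hu, a, b, ?_, ?_⟩
    · rw [← sub_eq_zero.mp hA, Algebra.algebraMap_eq_smul_one, smul_mulVec, one_mulVec]
    · rw [sub_mulVec, Algebra.algebraMap_eq_smul_one, smul_mulVec, one_mulVec] at hBu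
      exact (sub_eq_zero.mp hBu).symm
  · exact exists_common_eigenvector_of_intertwining hA ha
      ((Algebra.commute_algebraMap_left a A).sub_left (Commute.refl A))
      ((Algebra.commute_algebraMap_left a B).sub_left h)

/-- The commutator of `2 × 2` matrices intertwines the left factor with its adjugate. -/
theorem lie_mul_eq_adjugate_mul_lie {R : Type*} [CommRing R] (A B : Matrix (Fin 2) (Fin 2) R) :
    (A * B - B * A) * A = A.adjugate * (A * B - B * A) := by
  ext i j
  fin_cases i <;> fin_cases j <;>
    simp [adjugate_fin_two, Matrix.mul_apply, Fin.sum_univ_two] <;> ring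

theorem exists_common_eigenvector_of_det_lie_eq_zero {K : Type*} [Field K] [IsAlgClosed K]
    {A B : Matrix (Fin 2) (Fin 2) K} (h : (A * B - B * A).det = 0) :
    ∃ u : Fin 2 → K, u ≠ 0 ∧ ∃ a b : K, A *ᵥ u = a • u ∧ B *ᵥ u = b • u := by
  by_cases h0 : A * B - B * A = 0
  · exact exists_common_eigenvector_of_commute (sub_eq_zero.mp h0)
  · refine exists_common_eigenvector_of_intertwining h0 h (lie_mul_eq_adjugate_mul_lie A B)
      (D := B.adjugate) ?_
    rw [← neg_sub (B * A), neg_mul, mul_neg, lie_mul_eq_adjugate_mul_lie]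

/-- **Jørgensen's inverting involution (matrix form).**  If `A, B ∈ SL(2,ℂ)` have no common
eigenvector, then there is a trace-zero `T ∈ SL(2,ℂ)` conjugating `A` to `A⁻¹` and `B` to
`B⁻¹`; in particular conjugation by `T` maps the subgroup generated by `{A, B}` onto itself. -/
theorem exists_traceless_inverting_conjugator
    (A B : Matrix.SpecialLinearGroup (Fin 2) ℂ)
    (hcommon : ¬ ∃ u : Fin 2 → ℂ, u ≠ 0 ∧ ∃ lam mu : ℂ,
      (A : Matrix (Fin 2) (Fin 2) ℂ).mulVec u = lam • u ∧
      (B : Matrix (Fin 2) (Fin 2) ℂ).mulVec u = mu • u) :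
    ∃ T : Matrix.SpecialLinearGroup (Fin 2) ℂ,
      Matrix.trace (T : Matrix (Fin 2) (Fin 2) ℂ) = 0 ∧
      T * A * T⁻¹ = A⁻¹ ∧ T * B * T⁻¹ = B⁻¹ ∧
      Subgroup.map (MulAut.conj T).toMonoidHom (Subgroup.closure {A, B}) =
        Subgroup.closure {A, B} := by
  set M : Matrix (Fin 2) (Fin 2) ℂ := A.1 * B.1 - B.1 * A.1 with hM
  have hdet : M.det ≠ 0 := fun h =>
    hcommon (exists_common_eigenvector_of_det_lie_eq_zero h)
  have hMA : M * A.1 = A.1.adjugate * M := lie_mul_eq_adjugate_mul_lie A.1 B.1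
  have hMB : M * B.1 = B.1.adjugate * M := by
    rw [hM, ← neg_sub (B.1 * A.1), neg_mul, mul_neg, lie_mul_eq_adjugate_mul_lie]
  obtain ⟨s, hs⟩ := IsAlgClosed.exists_pow_nat_eq M.det (n := 2) two_pos
  have hs0 : s ≠ 0 := by
    rintro rfl
    exact hdet (by simpa using hs.symm)
  let T : Matrix.SpecialLinearGroup (Fin 2) ℂ := ⟨s⁻¹ • M, by
    rw [det_smul, Fintype.card_fin, ← hs, ← mul_pow, inv_mul_cancel₀ hs0, one_pow]⟩
  have hconj (X : Matrix.SpecialLinearGroup (Fin 2) ℂ) (hX : M * X.1 = X.1.adjugate * M) :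
      T * X * T⁻¹ = X⁻¹ := by
    rw [mul_inv_eq_iff_eq_mul]
    apply Subtype.ext
    change (s⁻¹ • M) * X.1 = X.1.adjugate * (s⁻¹ • M)
    rw [smul_mul_assoc, mul_smul_comm, hX]
  have hTA := hconj A hMA
  have hTB := hconj B hMB
  refine ⟨T, ?_, hTA, hTB, ?_⟩
  · change trace (s⁻¹ • M) = 0
    rw [trace_smul, hM, trace_sub, trace_mul_comm, sub_self, smul_zero]
  · rw [MonoidHom.map_closure, Set.image_pair]
    simp only [MulEquiv.toMonoidHom_eq_coe, MonoidHom.coe_coe, MulAut.conj_apply, hTA, hTB]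
    rw [← Subgroup.closure_inv {A, B}, Set.inv_insert, Set.inv_singleton]
end

section
/- Let A and B be elements of SL(2,ℂ) having no common eigenvector (there is no nonzero vector u ∈ ℂ² and scalars λ, μ ∈ ℂ with Au = λu and Bu = μu), and suppose A and B are conjugate in SL(2,ℂ), i.e. there is S ∈ SL(2,ℂ) with S A S⁻¹ = B. Then there exists R ∈ SL(2,ℂ) with trace 0 such that R A R⁻¹ = B and R B R⁻¹ = A; moreover, for every T ∈ SL(2,ℂ) with trace 0 satisfying T A T⁻¹ = A⁻¹ and T B T⁻¹ = B⁻¹, one has T R T⁻¹ R⁻¹ = 1 or T R T⁻¹ R⁻¹ = -1 (so the images of T and R commute in PSL(2,ℂ)). -/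
open Matrix

namespace Matrix

variable {K : Type*} [CommRing K]

/-- The adjugate of a `2 × 2` matrix in terms of its trace. -/
theorem adjugate_fin_two_eq_trace_smul_one_sub (A : Matrix (Fin 2) (Fin 2) K) :
    A.adjugate = A.trace • 1 - A := by
  ext i j
  fin_cases i <;> fin_cases j <;> simp [adjugate_fin_two, trace_fin_two]

/-- If `A` and `B` have the same trace and determinant, then `A + B - tr A` intertwines them. -/
theorem add_sub_trace_smul_one_mul_eq {A B : Matrix (Fin 2) (Fin 2) K}
    (htr : A.trace = B.trace) (hdet : A.det = B.det) :
    (A + B - A.trace • 1) * A = B * (A + B - A.trace • 1) := by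
  have hA := A.adjugate_mul
  have hB := B.mul_adjugate
  rw [adjugate_fin_two_eq_trace_smul_one_sub] at hA hB
  rw [← htr, ← hdet, ← hA] at hB
  calc (A + B - A.trace • 1) * A = B * A - (A.trace • 1 - A) * A := by noncomm_ring
    _ = B * A - B * (A.trace • 1 - B) := by rw [hB]
    _ = B * (A + B - A.trace • 1) := by noncomm_ring

/-- If `A` and `B` have the same trace and determinant and `A + B - tr A` is singular, then
`A` and `B` have a common eigenvector. -/
theorem exists_common_eigenvector_of_det_add_sub_trace_smul_one_eq_zero
    {K : Type*} [Field K] [IsAlgClosed K] {A B : Matrix (Fin 2) (Fin 2) K}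
    (htr : A.trace = B.trace) (hdet : A.det = B.det) (h : (A + B - A.trace • 1).det = 0) :
    ∃ u : Fin 2 → K, u ≠ 0 ∧ ∃ lam mu : K, A *ᵥ u = lam • u ∧ B *ᵥ u = mu • u := by
  set N := A + B - A.trace • 1 with hN
  have hNA : N * A = B * N := add_sub_trace_smul_one_mul_eq htr hdet
  obtain ⟨v, hv, hNv⟩ := exists_mulVec_eq_zero_iff.2 h
  let W := LinearMap.ker N.mulVecLin
  have hW : ∀ w ∈ W, A.mulVecLin w ∈ W := fun w hw => by
    have hw' : N *ᵥ w = 0 := hw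
    change N *ᵥ (A *ᵥ w) = 0
    rw [mulVec_mulVec, hNA, ← mulVec_mulVec, hw', mulVec_zero]
  have : Nontrivial W := ⟨⟨⟨v, hNv⟩, 0, fun h0 => hv (congrArg Subtype.val h0)⟩⟩
  obtain ⟨lam, hlam⟩ := Module.End.exists_eigenvalue (A.mulVecLin.restrict hW)
  obtain ⟨w, hw⟩ := hlam.exists_hasEigenvector
  have hAw : A *ᵥ (w : Fin 2 → K) = lam • (w : Fin 2 → K) :=
    congrArg Subtype.val hw.apply_eq_smul
  have hNw : N *ᵥ (w : Fin 2 → K) = 0 := w.2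
  refine ⟨w, fun h0 => hw.2 (Subtype.ext h0), lam, A.trace - lam, hAw, ?_⟩
  rw [hN, sub_mulVec, add_mulVec, hAw, smul_mulVec, one_mulVec] at hNw
  rw [sub_smul]
  linear_combination hNw

end Matrix

/-- **Jørgensen's lemma, second part (matrix form).**  If `A, B ∈ SL(2,ℂ)` have no common
eigenvector and are conjugate in `SL(2,ℂ)`, then there is a trace-zero `R ∈ SL(2,ℂ)`
exchanging `A` and `B` by conjugation; moreover for every trace-zero `T` conjugating `A` to
`A⁻¹` and `B` to `B⁻¹`, the commutator `T R T⁻¹ R⁻¹` is `±1` (so the images of `T` and `R`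
commute in `PSL(2,ℂ)`). -/
theorem exists_traceless_exchanging_conjugator
    (A B : Matrix.SpecialLinearGroup (Fin 2) ℂ)
    (hcommon : ¬ ∃ u : Fin 2 → ℂ, u ≠ 0 ∧ ∃ lam mu : ℂ,
      (A : Matrix (Fin 2) (Fin 2) ℂ).mulVec u = lam • u ∧
      (B : Matrix (Fin 2) (Fin 2) ℂ).mulVec u = mu • u)
    (S : Matrix.SpecialLinearGroup (Fin 2) ℂ) (hS : S * A * S⁻¹ = B) :
    ∃ R : Matrix.SpecialLinearGroup (Fin 2) ℂ,
      Matrix.trace (R : Matrix (Fin 2) (Fin 2) ℂ) = 0 ∧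
      R * A * R⁻¹ = B ∧ R * B * R⁻¹ = A ∧
      ∀ T : Matrix.SpecialLinearGroup (Fin 2) ℂ,
        Matrix.trace (T : Matrix (Fin 2) (Fin 2) ℂ) = 0 →
        T * A * T⁻¹ = A⁻¹ → T * B * T⁻¹ = B⁻¹ →
        (T * R * T⁻¹ * R⁻¹ = 1 ∨
          ((T * R * T⁻¹ * R⁻¹ : Matrix.SpecialLinearGroup (Fin 2) ℂ) :
            Matrix (Fin 2) (Fin 2) ℂ) = -1) := by
  have htr : (A : Matrix (Fin 2) (Fin 2) ℂ).trace = (B : Matrix (Fin 2) (Fin 2) ℂ).trace := by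
    rw [← hS, mul_assoc]
    change _ = ((S : Matrix (Fin 2) (Fin 2) ℂ) * (A * S⁻¹ : SpecialLinearGroup (Fin 2) ℂ)).trace
    rw [trace_mul_comm]
    change _ = ((A * S⁻¹ * S : SpecialLinearGroup (Fin 2) ℂ) : Matrix (Fin 2) (Fin 2) ℂ).trace
    rw [inv_mul_cancel_right]
  have hdet : (A : Matrix (Fin 2) (Fin 2) ℂ).det = (B : Matrix (Fin 2) (Fin 2) ℂ).det :=
    A.2.trans B.2.symm
  set N : Matrix (Fin 2) (Fin 2) ℂ := A + B - (A : Matrix (Fin 2) (Fin 2) ℂ).trace • 1 with hN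
  have hN0 : N.det ≠ 0 := fun h =>
    hcommon (exists_common_eigenvector_of_det_add_sub_trace_smul_one_eq_zero htr hdet h)
  have hNA : N * A = B * N := add_sub_trace_smul_one_mul_eq htr hdet
  have hNB : N * B = A * N := by
    have := add_sub_trace_smul_one_mul_eq htr.symm hdet.symm
    rwa [add_comm, ← htr] at this
  obtain ⟨c, hc⟩ := IsAlgClosed.exists_pow_nat_eq N.det⁻¹ two_pos
  let R : SpecialLinearGroup (Fin 2) ℂ :=
    ⟨c • N, by rw [det_smul, Fintype.card_fin, hc, inv_mul_cancel₀ hN0]⟩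
  have hR : (R : Matrix (Fin 2) (Fin 2) ℂ) = c • N := rfl
  refine ⟨R, ?_, ?_, ?_, fun T _ hTA hTB => Or.inr ?_⟩
  · rw [hR, trace_smul, hN, trace_sub, trace_add, ← htr, trace_smul, trace_one, Fintype.card_fin]
    simp only [smul_eq_mul]
    push_cast
    ring
  · rw [mul_inv_eq_iff_eq_mul]
    apply Subtype.ext
    change (R : Matrix (Fin 2) (Fin 2) ℂ) * A = B * R
    rw [hR, smul_mul_assoc, hNA, mul_smul_comm]
  · rw [mul_inv_eq_iff_eq_mul]
    apply Subtype.ext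
    change (R : Matrix (Fin 2) (Fin 2) ℂ) * B = A * R
    rw [hR, smul_mul_assoc, hNB, mul_smul_comm]
  · have hTmul : ∀ X : SpecialLinearGroup (Fin 2) ℂ, T * X * T⁻¹ = X⁻¹ →
        (T : Matrix (Fin 2) (Fin 2) ℂ) * X =
          ((X : Matrix (Fin 2) (Fin 2) ℂ).trace • 1 - (X : Matrix (Fin 2) (Fin 2) ℂ)) * T :=
        fun X hX => by
      rw [mul_inv_eq_iff_eq_mul] at hX
      rw [← adjugate_fin_two_eq_trace_smul_one_sub]
      exact congrArg Subtype.val hX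
    have hTN : (T : Matrix (Fin 2) (Fin 2) ℂ) * N = -(N * T) := by
      rw [hN, mul_sub, mul_add, hTmul A hTA, hTmul B hTB, ← htr]
      simp only [sub_mul, add_mul, smul_mul_assoc, mul_smul_comm, one_mul, mul_one]
      abel
    have hTR : T * R = -(R * T) := by
      apply Subtype.ext
      change (T : Matrix (Fin 2) (Fin 2) ℂ) * R = -((R : Matrix (Fin 2) (Fin 2) ℂ) * T)
      rw [hR, mul_smul_comm, hTN, smul_mul_assoc, smul_neg]
    have hcomm : T * R * T⁻¹ * R⁻¹ = -1 := by
      rw [hTR, neg_mul, neg_mul, mul_inv_cancel_right, mul_inv_cancel]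
    rw [hcomm]
    rfl
end

section
/- Let F be the free group on four generators a, b, c, d, and let φ : F → F be the group endomorphism determined by φ(a) = c⁻¹a⁻¹, φ(b) = b⁻¹a⁻¹, φ(c) = b⁻¹a⁻¹d, φ(d) = c⁻¹. Then F is generated by the four elements b, φ(b), φ²(b), φ³(b). -/
/-- The endomorphism of the free group on `a, b, c, d` (indexed by `Fin 4`) from
Nielsen's example #13: `a ↦ c⁻¹a⁻¹`, `b ↦ b⁻¹a⁻¹`, `c ↦ b⁻¹a⁻¹d`, `d ↦ c⁻¹`. -/
def nielsenPhi : FreeGroup (Fin 4) →* FreeGroup (Fin 4) :=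
  FreeGroup.lift fun i =>
    match i with
    | 0 => (FreeGroup.of 2)⁻¹ * (FreeGroup.of 0)⁻¹
    | 1 => (FreeGroup.of 1)⁻¹ * (FreeGroup.of 0)⁻¹
    | 2 => (FreeGroup.of 1)⁻¹ * (FreeGroup.of 0)⁻¹ * FreeGroup.of 3
    | 3 => (FreeGroup.of 2)⁻¹

theorem nielsenPhi_of_zero :
    nielsenPhi (FreeGroup.of 0) = (FreeGroup.of 2)⁻¹ * (FreeGroup.of 0)⁻¹ := by
  simp [nielsenPhi]

theorem nielsenPhi_of_one :
    nielsenPhi (FreeGroup.of 1) = (FreeGroup.of 1)⁻¹ * (FreeGroup.of 0)⁻¹ := by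
  simp [nielsenPhi]

theorem nielsenPhi_of_two :
    nielsenPhi (FreeGroup.of 2) =
      (FreeGroup.of 1)⁻¹ * (FreeGroup.of 0)⁻¹ * FreeGroup.of 3 := by
  simp [nielsenPhi]

/-- **Nielsen's example #13 fills up the fundamental group:**
the free group on `a, b, c, d` is generated by `b, φ(b), φ²(b), φ³(b)`. -/
theorem nielsenPhi_orbit_of_b_generates :
    Subgroup.closure
      ({FreeGroup.of 1, nielsenPhi (FreeGroup.of 1),
        nielsenPhi (nielsenPhi (FreeGroup.of 1)),
        nielsenPhi (nielsenPhi (nielsenPhi (FreeGroup.of 1)))} :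
        Set (FreeGroup (Fin 4))) = ⊤ := by
  simp only [nielsenPhi_of_zero, nielsenPhi_of_one, nielsenPhi_of_two, map_mul, map_inv]
  set S : Set (FreeGroup (Fin 4)) := {_, _, _, _} with hS
  have hb : FreeGroup.of 1 ∈ Subgroup.closure S :=
    Subgroup.subset_closure (by simp [hS])
  have ha : FreeGroup.of 0 ∈ Subgroup.closure S := by
    have h : (FreeGroup.of 1)⁻¹ * (FreeGroup.of 0)⁻¹ ∈ Subgroup.closure S :=
      Subgroup.subset_closure (by simp [hS])
    rwa [Subgroup.mul_mem_cancel_left _ (inv_mem hb), inv_mem_iff] at h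
  have hc : FreeGroup.of 2 ∈ Subgroup.closure S := by
    have h : ((FreeGroup.of 1)⁻¹ * (FreeGroup.of 0)⁻¹)⁻¹ *
        ((FreeGroup.of 2)⁻¹ * (FreeGroup.of 0)⁻¹)⁻¹ ∈ Subgroup.closure S :=
      Subgroup.subset_closure (by simp [hS])
    rwa [Subgroup.mul_mem_cancel_left _ (inv_mem (mul_mem (inv_mem hb) (inv_mem ha))),
      inv_mem_iff, Subgroup.mul_mem_cancel_right _ (inv_mem ha), inv_mem_iff] at h
  have hd : FreeGroup.of 3 ∈ Subgroup.closure S := by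
    have h : _ ∈ Subgroup.closure S :=
      Subgroup.subset_closure (Or.inr (Or.inr (Or.inr rfl)))
    simp only [mul_inv_rev, inv_inv] at h
    have hca := mul_mem (inv_mem hc) (inv_mem ha)
    have hba := mul_mem (inv_mem hb) (inv_mem ha)
    rwa [Subgroup.mul_mem_cancel_left _ (mul_mem hca hba),
      Subgroup.mul_mem_cancel_left _ hca, Subgroup.mul_mem_cancel_left _ hba] at h
  rw [eq_top_iff, ← FreeGroup.closure_range_of, Subgroup.closure_le]
  rintro _ ⟨i, rfl⟩
  fin_cases i
  exacts [ha, hb, hc, hd]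
end
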